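/- Interior Hessian estimate for augmented Hessian equations, convex quadratic case (a priori form of Theorem 1.4, Case 1). Let n ≥ 3, let Ω ⊆ ℝⁿ be a domain, let 2 ≤ k ≤ n and p > kn/2. Let f : Ω×ℝ×ℝⁿ → ℝ be positive and C^{1,1}_loc, let H₁ : Ω×ℝ → ℝ be C^{1,1}_loc with H₁ ≥ 0, and set H(x,z,ξ) := H₁(x,z)|ξ|² I. Fix concentric open balls B_R ⊂ B_{2R} with closure(B_{2R}) ⊂ Ω and a constant M > 0. Then there exists a constant C, depending only on n, k, p, R, f, H₁ and M, such that every u ∈ C²(Ω) satisfying σ_k(A_H[u](x)) = f(x,u(x),∇u(x))^k and λ(A_H[u](x)) ∈ Γ_k^+ for every x ∈ Ω, together with ‖u‖_{W^{2,p}(B_{2R})} ≤ M, obeys sup_{x ∈ B_R} |∇²u(x)| ≤ C. -/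

import Mathlib

open MeasureTheory Metric Set Matrix

noncomputable section

/-- The `k`-th elementary symmetric polynomial of the eigenvalues of an `n × n` real
matrix, defined via the coefficients of the characteristic polynomial. -/
def esymmMat {n : ℕ} (k : ℕ) (A : Matrix (Fin n) (Fin n) ℝ) : ℝ :=
  (-1 : ℝ) ^ k * A.charpoly.coeff (n - k)

/-- `λ(A) ∈ Γ_k^+`, i.e. `σ_j(A) > 0` for all `1 ≤ j ≤ k`. -/
def GammaPlus {n : ℕ} (k : ℕ) (A : Matrix (Fin n) (Fin n) ℝ) : Prop :=
  ∀ j : ℕ, 1 ≤ j → j ≤ k → 0 < esymmMat j A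

/-- The Newton tensors `T_0(A) = I`, `T_j(A) = σ_j(A) I - T_{j-1}(A) A`. -/
def newtonT {n : ℕ} : ℕ → Matrix (Fin n) (Fin n) ℝ → Matrix (Fin n) (Fin n) ℝ
  | 0, _ => 1
  | (j + 1), A => esymmMat (j + 1) A • (1 : Matrix (Fin n) (Fin n) ℝ) - newtonT j A * A

/-- `i`-th partial derivative. -/
def pd {n : ℕ} (i : Fin n) (w : (Fin n → ℝ) → ℝ) (x : Fin n → ℝ) : ℝ :=
  fderiv ℝ w x (Pi.single i 1)

/-- Gradient as a vector. -/
def grad {n : ℕ} (w : (Fin n → ℝ) → ℝ) (x : Fin n → ℝ) : Fin n → ℝ :=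
  fun i => pd i w x

/-- Hessian matrix. -/
def hess {n : ℕ} (w : (Fin n → ℝ) → ℝ) (x : Fin n → ℝ) : Matrix (Fin n) (Fin n) ℝ :=
  Matrix.of fun i j => pd i (pd j w) x

/-- Squared Euclidean norm of a vector. -/
def normSq {n : ℕ} (ξ : Fin n → ℝ) : ℝ := ∑ i, ξ i ^ 2

/-- Euclidean norm of a vector. -/
def vnorm {n : ℕ} (ξ : Fin n → ℝ) : ℝ := Real.sqrt (∑ i, ξ i ^ 2)

/-- Operator norm of a matrix, viewed as a linear map between Euclidean spaces. -/
def matNorm {n : ℕ} (M : Matrix (Fin n) (Fin n) ℝ) : ℝ :=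
  ‖LinearMap.toContinuousLinearMap (Matrix.toEuclideanLin M)‖

/-- Laplacian. -/
def lapl {n : ℕ} (w : (Fin n → ℝ) → ℝ) (x : Fin n → ℝ) : ℝ := ∑ l, pd l (pd l w) x

/-- `W^{2,p}` norm (with classical derivatives) on a set. -/
def W2pNorm {n : ℕ} (p : ℝ) (w : (Fin n → ℝ) → ℝ) (B : Set (Fin n → ℝ)) : ℝ :=
  (∫ x in B, (|w x| ^ p + vnorm (grad w x) ^ p + matNorm (hess w x) ^ p)) ^ (1 / p)

/-- `C^{1,1}_loc` on a set: continuously differentiable with locally Lipschitz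
first derivatives. -/
def C11On {E F : Type*} [NormedAddCommGroup E] [NormedSpace ℝ E]
    [NormedAddCommGroup F] [NormedSpace ℝ F] (f : E → F) (s : Set E) : Prop :=
  ContDiffOn ℝ 1 f s ∧
    ∀ x ∈ s, ∃ (K : NNReal) (t : Set E), t ∈ nhdsWithin x s ∧
      LipschitzOnWith K (fderivWithin ℝ f s) t

/-- First order difference quotient `∇_l^h`. -/
def dq {n : ℕ} (l : Fin n) (h : ℝ) (w : (Fin n → ℝ) → ℝ) (x : Fin n → ℝ) : ℝ :=
  (w (x + h • (Pi.single l 1 : Fin n → ℝ)) - w x) / h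

/-- Second order difference quotient `Δ_{ll}^h`. -/
def ddq {n : ℕ} (l : Fin n) (h : ℝ) (w : (Fin n → ℝ) → ℝ) (x : Fin n → ℝ) : ℝ :=
  (w (x + h • (Pi.single l 1 : Fin n → ℝ)) - 2 * w x + w (x - h • (Pi.single l 1 : Fin n → ℝ))) / h ^ 2

/-- `L^s` seminorm (as an extended real number) of a function on a set. -/
def lpN {n : ℕ} (s : ℝ) (w : (Fin n → ℝ) → ℝ) (S : Set (Fin n → ℝ)) : ENNReal :=
  (∫⁻ x in S, ENNReal.ofReal (|w x| ^ s)) ^ (1 / s)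

end

noncomputable section
set_option linter.unusedSectionVars false
set_option linter.style.longLine false
namespace IHE
open Polynomial

section vec
variable {ι : Type*} [DecidableEq ι]

def EP (l : ι → ℝ) (s : Finset ι) : ℝ[X] := ∏ i ∈ s, (1 + C (l i) * X)
def ee (l : ι → ℝ) (s : Finset ι) (j : ℕ) : ℝ := (EP l s).coeff j

lemma ee_zero (l : ι → ℝ) (s : Finset ι) : ee l s 0 = 1 := by
  simp [ee, EP, coeff_zero_eq_eval_zero, eval_prod]

lemma ee_empty_succ (l : ι → ℝ) (j : ℕ) : ee l ∅ (j+1) = 0 := by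
  simp [ee, EP, coeff_one]

lemma ee_insert (l : ι → ℝ) {s : Finset ι} {i : ι} (hi : i ∉ s) (j : ℕ) :
    ee l (insert i s) (j+1) = ee l s (j+1) + l i * ee l s j := by
  unfold ee
  have : EP l (insert i s) = EP l s + C (l i) * (X * EP l s) := by
    unfold EP; rw [Finset.prod_insert hi]; ring
  rw [this, coeff_add, coeff_C_mul, coeff_X_mul]

lemma ee_erase (l : ι → ℝ) {s : Finset ι} {i : ι} (hi : i ∈ s) (j : ℕ) :
    ee l s (j+1) = ee l (s.erase i) (j+1) + l i * ee l (s.erase i) j := by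
  conv_lhs => rw [← Finset.insert_erase hi]
  exact ee_insert l (Finset.notMem_erase i s) j

lemma ee_euler (l : ι → ℝ) (s : Finset ι) (j : ℕ) :
    ((j:ℝ)+1) * ee l s (j+1) = ∑ i ∈ s, l i * ee l (s.erase i) j := by
  have h := congrArg (fun P => coeff P j) (derivative_prod_finset (s := s) (f := fun i => (1 + C (l i) * X : ℝ[X])))
  simp only [coeff_derivative, finsetSum_coeff] at h
  rw [mul_comm]
  refine h.trans (Finset.sum_congr rfl fun i _ => ?_)
  have h1 : derivative (1 + C (l i) * X : ℝ[X]) = C (l i) := by simp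
  change ((∏ b ∈ s.erase i, (1 + C (l b) * X)) * derivative (1 + C (l i) * X : ℝ[X])).coeff j = _
  rw [h1, coeff_mul_C, mul_comm]
  rfl

lemma ee_gt (l : ι → ℝ) (s : Finset ι) : ∀ j, s.card < j → ee l s j = 0 := by
  induction s using Finset.induction_on with
  | empty =>
    intro j hj
    obtain ⟨j, rfl⟩ : ∃ i, j = i + 1 := ⟨j - 1, by simp at hj; omega⟩
    exact ee_empty_succ l j
  | insert a s ha ih =>
    intro j hj
    rw [Finset.card_insert_of_notMem ha] at hj
    obtain ⟨j, rfl⟩ : ∃ i, j = i + 1 := ⟨j - 1, by omega⟩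
    rw [ee_insert l ha, ih _ (by omega), ih _ (by omega)]; simp

lemma splits_deriv (P : ℝ[X]) (hP : P.Splits) : (derivative P).Splits := by
  rw [splits_iff_card_roots]
  have h1 := card_roots_le_derivative P
  have h2 := card_roots' (derivative P)
  have h3 := hP.natDegree_eq_card_roots
  have h4 := natDegree_derivative_le P
  by_cases h0 : P.natDegree = 0
  · omega
  · omega

lemma laguerre (P : ℝ[X]) (hP : P.Splits) (x : ℝ) :
    P.eval x * (derivative (derivative P)).eval x ≤ (derivative P).eval x ^ 2 := by
  obtain ⟨m, hm⟩ := splits_iff_exists_multiset.1 hP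
  have key : ∀ m : Multiset ℝ, ∀ Q : ℝ[X], Q = (m.map (X - C ·)).prod →
    Q.eval x * (derivative (derivative Q)).eval x ≤ (derivative Q).eval x ^ 2 := by
    intro m
    induction m using Multiset.induction_on with
    | empty => intro Q hQ; simp at hQ; subst hQ; simp
    | cons a m ih =>
      intro Q hQ
      have := ih _ rfl
      rw [Multiset.map_cons, Multiset.prod_cons] at hQ
      set R := (m.map (X - C ·)).prod
      subst hQ
      simp only [derivative_mul, derivative_sub, derivative_X, derivative_C, eval_mul, eval_add,
        eval_sub, eval_X, eval_C, eval_one, eval_zero, derivative_add, derivative_one, derivative_zero]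
      nlinarith [sq_nonneg (x - a), sq_nonneg (R.eval x), mul_le_mul_of_nonneg_left this (sq_nonneg (x-a))]
  have := key m _ rfl
  rw [hm]
  simp only [derivative_mul, derivative_C, zero_mul, zero_add, eval_mul, eval_C]
  nlinarith [mul_le_mul_of_nonneg_left this (sq_nonneg P.leadingCoeff)]

lemma EP_splits (l : ι → ℝ) (s : Finset ι) : (EP l s).Splits := by
  refine Splits.prod fun i _ => Splits.of_natDegree_le_one ?_
  have := natDegree_linear_le (a := l i) (b := 1)
  rw [add_comm] at this; simpa using this

lemma newton (l : ι → ℝ) (s : Finset ι) (j : ℕ) :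
    ee l s j * ee l s (j+2) ≤ ee l s (j+1) ^ 2 := by
  have hs : ∀ j, (derivative^[j] (EP l s)).Splits := by
    intro j
    induction j with
    | zero => exact EP_splits l s
    | succ j ih => rw [Function.iterate_succ_apply']; exact splits_deriv _ ih
  have h := laguerre _ (hs j) 0
  rw [← Function.iterate_succ_apply' derivative, ← Function.iterate_succ_apply' derivative] at h
  simp only [← coeff_zero_eq_eval_zero, coeff_iterate_derivative, zero_add, Nat.descFactorial_self,
    nsmul_eq_mul] at h
  change (j.factorial:ℝ) * ee l s j * (((j+1+1).factorial : ℕ) * ee l s (j+2)) ≤ (((j+1).factorial:ℕ) * ee l s (j+1))^2 at h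
  rw [Nat.factorial_succ (j+1), Nat.factorial_succ j] at h
  push_cast at h
  have hf : (0:ℝ) < (j.factorial:ℝ) := by positivity
  have h2 : ((j:ℝ)+1+1) * (ee l s j * ee l s (j+2)) ≤ (j+1) * ee l s (j+1)^2 := by
    have : (0:ℝ) < (j.factorial:ℝ)^2 * (j+1) := by positivity
    refine le_of_mul_le_mul_left ?_ this
    nlinarith
  by_cases h0 : ee l s j * ee l s (j+2) ≤ 0
  · exact h0.trans (sq_nonneg _)
  · push Not at h0
    have : (0:ℝ) < (j:ℝ)+1 := by positivity
    refine le_of_mul_le_mul_left ?_ this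
    nlinarith

def Gam (l : ι → ℝ) (s : Finset ι) (k : ℕ) : Prop := ∀ j, j ≤ k → 0 < ee l s j

lemma Gam.mono {l : ι → ℝ} {s : Finset ι} {k k' : ℕ} (h : Gam l s k) (hk : k' ≤ k) : Gam l s k' :=
  fun j hj => h j (hj.trans hk)

lemma Gam_erase {l : ι → ℝ} {s : Finset ι} {i : ι} (hi : i ∈ s) :
    ∀ k, Gam l s (k+1) → Gam l (s.erase i) k := by
  intro k
  induction k with
  | zero => intro _ j hj; obtain rfl : j = 0 := by omega
            rw [ee_zero]; exact one_pos
  | succ k ih =>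
    intro h
    have h1 := ih (h.mono (by omega))
    intro j hj
    rcases Nat.lt_or_ge j (k+1) with hlt | hge
    · exact h1 j (by omega)
    obtain rfl : j = k+1 := by omega
    by_contra hneg
    push Not at hneg
    have a := h1 k le_rfl
    have b := h (k+1) (by omega)
    have c := h (k+1+1) le_rfl
    rw [ee_erase l hi] at b c
    have N := newton l (s.erase i) k
    set x := ee l (s.erase i) k
    set y := ee l (s.erase i) (k+1)
    set z := ee l (s.erase i) (k+1+1)
    have hli : 0 < l i := by
      by_contra hh
      push Not at hh
      nlinarith
    have : -(l i * y) * x < z * x := by nlinarith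
    nlinarith

def qq (l : ι → ℝ) (s : Finset ι) (k : ℕ) : ℝ := ee l s (k+1) / ee l s k

lemma qq_formula {l : ι → ℝ} {s : Finset ι} (k : ℕ) (h : Gam l s (k+1)) :
    ((k:ℝ)+1+1) * qq l s (k+1) = ∑ i ∈ s, (l i - l i ^2 / (l i + qq l (s.erase i) k)) := by
  unfold qq
  have hp := h (k+1) le_rfl
  rw [mul_div_assoc']
  have := ee_euler l s (k+1)
  push_cast at this
  rw [this, Finset.sum_div]
  refine Finset.sum_congr rfl fun i hi => ?_
  have h1 := Gam_erase hi k h k le_rfl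
  have h2 := ee_erase l hi k
  have h3 : l i + ee l (s.erase i) (k+1) / ee l (s.erase i) k = ee l s (k+1) / ee l (s.erase i) k := by
    rw [h2]; field_simp; ring
  rw [h3]
  field_simp
  rw [h2]; ring

lemma den_pos {l : ι → ℝ} {s : Finset ι} {i : ι} (hi : i ∈ s) (k : ℕ) (h : Gam l s (k+1)) :
    0 < l i + qq l (s.erase i) k := by
  have hp := h (k+1) le_rfl
  have h1 := Gam_erase hi k h k le_rfl
  have h2 := ee_erase l hi k
  have h3 : l i + ee l (s.erase i) (k+1) / ee l (s.erase i) k = ee l s (k+1) / ee l (s.erase i) k := by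
    rw [h2]; field_simp; ring
  rw [qq, h3]; positivity

lemma sq_div_sub {a b y1 y2 y : ℝ} (h1 : 0 < y1) (h2 : 0 < y2) (hy : y1 + y2 ≤ y) :
    (a+b)^2 / y ≤ a^2/y1 + b^2/y2 := by
  have h3 : (a+b)^2 / y ≤ (a+b)^2/(y1+y2) := by gcongr
  refine h3.trans ?_
  rw [div_add_div _ _ h1.ne' h2.ne', div_le_div_iff₀ (by positivity) (by positivity)]
  nlinarith [sq_nonneg (a*y2 - b*y1)]

lemma ee_one (l : ι → ℝ) (s : Finset ι) : ee l s 1 = ∑ i ∈ s, l i := by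
  have := ee_euler l s 0
  simpa [ee_zero] using this

lemma superadd : ∀ (k : ℕ) (s : Finset ι) (l m : ι → ℝ), Gam l s (k+1) → Gam m s (k+1) →
    Gam (l+m) s (k+1) ∧ qq l s k + qq m s k ≤ qq (l+m) s k := by
  intro k
  induction k with
  | zero =>
    intro s l m hl hm
    have h1 := hl 1 le_rfl
    have h2 := hm 1 le_rfl
    rw [ee_one] at h1 h2
    have e1 : ee (l+m) s 1 = ∑ i ∈ s, l i + ∑ i ∈ s, m i := by
      rw [ee_one, ← Finset.sum_add_distrib]; rfl
    refine ⟨fun j hj => ?_, ?_⟩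
    · interval_cases j
      · rw [ee_zero]; exact one_pos
      · rw [e1]; positivity
    · simp only [qq, ee_zero, zero_add, div_one, e1]; rw [ee_one, ee_one]
  | succ k ih =>
    intro s l m hl hm
    have hl' := hl.mono (Nat.le_succ (k+1))
    have hm' := hm.mono (Nat.le_succ (k+1))
    obtain ⟨hG, -⟩ := ih s l m hl' hm'
    have key : qq l s (k+1) + qq m s (k+1) ≤ qq (l+m) s (k+1) := by
      have hk : (0:ℝ) < (k:ℝ)+1+1 := by positivity
      refine le_of_mul_le_mul_left ?_ hk
      rw [mul_add, qq_formula k hl', qq_formula k hm', qq_formula k hG, ← Finset.sum_add_distrib]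
      refine Finset.sum_le_sum fun i hi => ?_
      have := (ih (s.erase i) l m (Gam_erase hi _ hl) (Gam_erase hi _ hm)).2
      have h4 := sq_div_sub (a := l i) (b := m i) (den_pos hi k hl') (den_pos hi k hm')
        (y := l i + m i + qq (l+m) (s.erase i) k) (by linarith)
      simp only [Pi.add_apply]
      linarith
    refine ⟨fun j hj => ?_, key⟩
    rcases Nat.lt_or_ge j (k+1+1) with hlt | hge
    · exact hG j (by omega)
    obtain rfl : j = k+1+1 := by omega
    have h1 : 0 < qq l s (k+1) := div_pos (hl _ le_rfl) (hl _ (by omega))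
    have h2 : 0 < qq m s (k+1) := div_pos (hm _ le_rfl) (hm _ (by omega))
    have h3 : 0 < qq (l+m) s (k+1) := by linarith
    have h4 := hG (k+1) le_rfl
    unfold qq at h3
    exact (div_pos_iff_of_pos_right h4).1 h3

lemma ee_prod {l : ι → ℝ} {s : Finset ι} : ∀ (k : ℕ) (_ : Gam l s k), ee l s k = ∏ j ∈ Finset.range k, qq l s j := by
  intro k
  induction k with
  | zero => intro _; simp [ee_zero]
  | succ k ih =>
    intro h
    rw [Finset.prod_range_succ, ← ih (h.mono (Nat.le_succ k)), qq]
    have := h k (Nat.le_succ k)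
    field_simp

lemma geom_super (k : ℕ) (hk : 0 < k) (x y : ℕ → ℝ) (hx : ∀ j ∈ Finset.range k, 0 < x j)
    (hy : ∀ j ∈ Finset.range k, 0 < y j) (a b : ℝ) (ha : 0 < a) (hb : 0 < b)
    (hax : a^k = ∏ j ∈ Finset.range k, x j) (hby : b^k = ∏ j ∈ Finset.range k, y j) :
    (a+b)^k ≤ ∏ j ∈ Finset.range k, (x j + y j) := by
  have hk' : (0:ℝ) < k := by exact_mod_cast hk
  set c : ℝ := (∏ j ∈ Finset.range k, (x j + y j)) ^ ((1:ℝ)/k) with hc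
  have hpos : 0 < ∏ j ∈ Finset.range k, (x j + y j) :=
    Finset.prod_pos fun j hj => add_pos (hx j hj) (hy j hj)
  have hcpos : 0 < c := Real.rpow_pos_of_pos hpos _
  have hck : c^k = ∏ j ∈ Finset.range k, (x j + y j) := by
    rw [hc, one_div, Real.rpow_inv_natCast_pow hpos.le hk.ne']
  have am : ∀ (z : ℕ → ℝ) (d : ℝ), (∀ j ∈ Finset.range k, 0 < z j) → 0 < d → d^k = ∏ j ∈ Finset.range k, z j →
      d / c ≤ ∑ j ∈ Finset.range k, (1/k:ℝ) * (z j / (x j + y j)) := by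
    intro z d hz hd hdz
    have := Real.geom_mean_le_arith_mean_weighted (Finset.range k) (fun _ => (1/k:ℝ))
      (fun j => z j / (x j + y j)) (fun _ _ => by positivity) (by simp [hk'.ne'])
      (fun j hj => (div_pos (hz j hj) (add_pos (hx j hj) (hy j hj))).le)
    refine le_trans (le_of_eq ?_) this
    rw [Real.finsetProd_rpow _ _ (fun j hj => (div_pos (hz j hj) (add_pos (hx j hj) (hy j hj))).le),
      Finset.prod_div_distrib, ← hdz, ← hck, ← div_pow, one_div,
      Real.pow_rpow_inv_natCast (div_pos hd hcpos).le hk.ne']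
  have h1 := am x a hx ha hax
  have h2 := am y b hy hb hby
  have h3 : ∑ j ∈ Finset.range k, (1/k:ℝ) * (x j / (x j + y j)) + ∑ j ∈ Finset.range k, (1/k:ℝ) * (y j / (x j + y j)) = 1 := by
    rw [← Finset.sum_add_distrib]
    rw [Finset.sum_congr rfl (g := fun _ => (1/k:ℝ))]
    · simp [hk'.ne']
    · intro j hj
      have := add_pos (hx j hj) (hy j hj)
      field_simp
  have h4 : (a+b)/c ≤ 1 := by rw [add_div]; linarith
  rw [div_le_one hcpos] at h4
  rw [← hck]
  gcongr

lemma ee_smul (t : ℝ) (l : ι → ℝ) (s : Finset ι) : ∀ j, ee (t • l) s j = t^j * ee l s j := by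
  induction s using Finset.induction_on with
  | empty => intro j; cases j with
    | zero => simp [ee_zero]
    | succ j => simp [ee_empty_succ]
  | insert a s ha ih =>
    intro j; cases j with
    | zero => simp [ee_zero]
    | succ j => rw [ee_insert _ ha, ee_insert _ ha, ih, ih]; simp; ring

lemma ee_deriv (l m : ι → ℝ) (s : Finset ι) : ∀ j,
    HasDerivAt (fun t : ℝ => ee (l + t • m) s (j+1)) (∑ i ∈ s, m i * ee l (s.erase i) j) 0 := by
  induction s using Finset.induction_on with
  | empty => intro j; simp only [ee_empty_succ, Finset.sum_empty]; exact hasDerivAt_const _ _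
  | insert a s ha ih =>
    intro j
    simp only [ee_insert _ ha]
    have hlin : HasDerivAt (fun t : ℝ => (l + t • m) a) (m a) 0 := by
      simpa using ((hasDerivAt_id (0:ℝ)).mul_const (m a)).const_add (l a)
    rw [Finset.sum_insert ha, Finset.erase_insert ha]
    have he : ∀ i ∈ s, (insert a s).erase i = insert a (s.erase i) := fun i hi =>
      Finset.erase_insert_of_ne (by rintro rfl; exact ha hi)
    have ha' : ∀ i, a ∉ s.erase i := fun i h => ha (Finset.mem_of_mem_erase h)
    cases j with
    | zero =>
      simp only [ee_zero, mul_one]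
      have := (ih 0).add hlin
      simp only [ee_zero, mul_one] at this
      rw [add_comm (m a)]
      exact this
    | succ j =>
      have := (ih (j+1)).add (hlin.mul (ih j))
      refine this.congr_deriv ?_
      simp only [zero_smul, add_zero]
      rw [Finset.mul_sum, Finset.sum_congr rfl (g := fun i => m i * ee l (s.erase i) (j+1) + l a * (m i * ee l (s.erase i) j)) (s₁ := s) (s₂ := s) (f := fun i => m i * ee l ((insert a s).erase i) (j+1)), Finset.sum_add_distrib]
      · ring
      · intro i hi
        rw [he i hi, ee_insert l (ha' i)]; ring

lemma garding (k : ℕ) (s : Finset ι) (l m : ι → ℝ) (hl : Gam l s (k+1)) (hm : Gam m s (k+1))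
    (a b : ℝ) (ha : 0 < a) (hb : 0 < b) (hal : ee l s (k+1) = a^(k+1)) (hbm : ee m s (k+1) = b^(k+1)) :
    ((k:ℝ)+1) * a^k * b ≤ ∑ i ∈ s, m i * ee l (s.erase i) k := by
  have hd := ee_deriv l m s k
  have hd2 : HasDerivAt (fun t : ℝ => (a + t*b)^(k+1)) (((k:ℝ)+1) * a^k * b) 0 := by
    have := (((hasDerivAt_id (0:ℝ)).mul_const b).const_add a).fun_pow (k+1)
    simpa using this
  have hd3 := hd.sub hd2
  by_contra hcon
  push Not at hcon
  have hineq : ∀ t : ℝ, 0 < t → 0 ≤ ee (l + t • m) s (k+1) - (a + t*b)^(k+1) := by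
    intro t ht
    have htm : Gam (t • m) s (k+1) := fun j hj => by rw [ee_smul]; exact mul_pos (pow_pos ht _) (hm j hj)
    have hs : ∀ j ≤ k, Gam (l + t • m) s (j+1) ∧ qq l s j + qq (t•m) s j ≤ qq (l + t • m) s j := fun j hj =>
      superadd j s l (t•m) (hl.mono (by omega)) (htm.mono (by omega))
    have hq : ∀ (z : ι → ℝ), Gam z s (k+1) → ∀ j ∈ Finset.range (k+1), 0 < qq z s j := fun z hz j hj =>
      div_pos (hz _ (by have := Finset.mem_range.1 hj; omega)) (hz _ (by have := Finset.mem_range.1 hj; omega))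
    have := geom_super (k+1) (by omega) (qq l s) (qq (t•m) s) (hq l hl) (hq _ htm) a (t*b) ha (by positivity)
      (by rw [← hal, ee_prod _ hl]) (by rw [mul_pow, ← hbm, ← ee_smul, ee_prod _ htm])
    rw [sub_nonneg, ee_prod _ (hs k le_rfl).1]
    refine this.trans (Finset.prod_le_prod (fun j hj => (add_pos (hq l hl j hj) (hq _ htm j hj)).le) fun j hj =>
      (hs j (by have := Finset.mem_range.1 hj; omega)).2)
  have hneg := sub_neg.2 hcon
  have h0 : ee (l + (0:ℝ) • m) s (k+1) - (a + 0*b)^(k+1) = 0 := by simp [hal]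
  have hslope := (hasDerivAt_iff_tendsto_slope_zero.1 hd3)
  have h1 := hslope.mono_left (nhdsGT_le_nhdsNE (0:ℝ))
  have h2 : ∀ᶠ t in nhdsWithin (0:ℝ) (Set.Ioi 0), (0:ℝ) ≤ t⁻¹ • (((fun t : ℝ => ee (l + t • m) s (k+1)) - fun t : ℝ => (a + t*b)^(k+1)) (0+t) - ((fun t : ℝ => ee (l + t • m) s (k+1)) - fun t : ℝ => (a + t*b)^(k+1)) 0) := by
    filter_upwards [self_mem_nhdsWithin] with t ht
    have ht' : 0 < t := ht
    simp only [Pi.sub_apply, h0, zero_add, sub_zero, smul_eq_mul]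
    have := hineq t ht'
    positivity
  have := ge_of_tendsto h1 h2
  linarith

lemma qq_le {l : ι → ℝ} {s : Finset ι} : ∀ k, Gam l s (k+1) → ee l s (k+1) ≤ ee l s 1 * ee l s k := by
  intro k
  induction k with
  | zero => intro _; simp [ee_zero]
  | succ k ih =>
    intro h
    have h1 := ih (h.mono (by omega))
    have N := newton l s k
    have p0 := h k (by omega)
    have p1 := h (k+1) (by omega)
    have p3 := h 1 (by omega)
    refine le_of_mul_le_mul_left ?_ p0
    calc ee l s k * ee l s (k+1+1) ≤ ee l s (k+1)^2 := N
      _ ≤ (ee l s 1 * ee l s k) * ee l s (k+1) := by rw [sq]; gcongr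
      _ = _ := by ring

/-- lower bound for the Newton tensor eigenvalues -/
lemma newton_lower {l : ι → ℝ} {s : Finset ι} {i : ι} (hi : i ∈ s) (k : ℕ) (h : Gam l s (k+1))
    (habs : ∀ i ∈ s, |l i| ≤ ee l s 1) :
    ee l s (k+1) / (4 * ee l s 1) ≤ ee l (s.erase i) k := by
  have h1 := h 1 (by omega)
  have hk := h (k+1) le_rfl
  have hG := Gam_erase hi k h
  have hp := hG k le_rfl
  rw [div_le_iff₀ (by positivity)]
  have he := ee_erase l hi k
  have hb := abs_le.1 (habs i hi)
  have he1 : ee l s 1 = ee l (s.erase i) 1 + l i := by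
    have := ee_erase l hi 0
    simpa [ee_zero] using this
  by_cases hc : ee l (s.erase i) (k+1) ≤ ee l s (k+1) / 2
  · nlinarith
  · push Not at hc
    have hG' : Gam l (s.erase i) (k+1) := by
      intro j hj
      rcases Nat.lt_or_ge j (k+1) with hlt | hge
      · exact hG j (by omega)
      obtain rfl : j = k+1 := by omega
      linarith
    have := qq_le k hG'
    nlinarith

end vec
end IHE

end

noncomputable section
set_option linter.unusedSectionVars false
set_option linter.style.longLine false
namespace IHE
section mat
variable {n : ℕ}

def TT {n : ℕ} : ℕ → Matrix (Fin n) (Fin n) ℝ → Matrix (Fin n) (Fin n) ℝ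
  | 0, _ => 1
  | (m+1), A => (trace (TT m A * A) / ((m:ℝ)+1)) • (1 : Matrix (Fin n) (Fin n) ℝ) - TT m A * A

def SS {n : ℕ} : ℕ → Matrix (Fin n) (Fin n) ℝ → ℝ
  | 0, _ => 1
  | (m+1), A => trace (TT m A * A) / ((m:ℝ)+1)

lemma TT_succ (m : ℕ) (A : Matrix (Fin n) (Fin n) ℝ) :
    TT (m+1) A = SS (m+1) A • (1 : Matrix (Fin n) (Fin n) ℝ) - TT m A * A := rfl

lemma SS_succ (m : ℕ) (A : Matrix (Fin n) (Fin n) ℝ) :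
    ((m:ℝ)+1) * SS (m+1) A = trace (TT m A * A) := by
  have : (0:ℝ) < (m:ℝ)+1 := by positivity
  simp only [SS]; field_simp

lemma TT_comm (m : ℕ) (A : Matrix (Fin n) (Fin n) ℝ) : TT m A * A = A * TT m A := by
  induction m with
  | zero => simp [TT]
  | succ m ih =>
    rw [TT_succ, sub_mul, mul_sub]
    simp only [Matrix.smul_mul, Matrix.mul_smul, Matrix.one_mul, Matrix.mul_one]
    congr 1
    rw [← Matrix.mul_assoc, ← ih]

lemma TT_symm (m : ℕ) {A : Matrix (Fin n) (Fin n) ℝ} (hA : Aᵀ = A) : (TT m A)ᵀ = TT m A := by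
  induction m with
  | zero => simp [TT]
  | succ m ih =>
    rw [TT_succ, transpose_sub, transpose_smul, transpose_one, transpose_mul, ih, hA, TT_comm]

lemma trace_TT (m : ℕ) (A : Matrix (Fin n) (Fin n) ℝ) : trace (TT m A) = ((n:ℝ) - m) * SS m A := by
  cases m with
  | zero => simp [TT, SS]
  | succ m =>
    rw [TT_succ, trace_sub, trace_smul, ← SS_succ]
    simp; ring

lemma conj_TT (m : ℕ) (U A : Matrix (Fin n) (Fin n) ℝ) (hU : Uᵀ * U = 1) (hU' : U * Uᵀ = 1) :
    TT m (U * A * Uᵀ) = U * TT m A * Uᵀ ∧ SS m (U * A * Uᵀ) = SS m A := by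
  have key : ∀ m, TT m (U * A * Uᵀ) = U * TT m A * Uᵀ → TT m (U * A * Uᵀ) * (U * A * Uᵀ) = U * (TT m A * A) * Uᵀ := by
    intro m ih
    rw [ih]
    calc U * TT m A * Uᵀ * (U * A * Uᵀ) = U * TT m A * (Uᵀ * U) * A * Uᵀ := by simp only [Matrix.mul_assoc]
      _ = _ := by rw [hU]; simp only [Matrix.mul_assoc, Matrix.mul_one, Matrix.one_mul]
  have tr : ∀ B : Matrix (Fin n) (Fin n) ℝ, trace (U * B * Uᵀ) = trace B := by
    intro B
    rw [Matrix.trace_mul_comm, ← Matrix.mul_assoc, hU, Matrix.one_mul]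
  have hT : ∀ m, TT m (U * A * Uᵀ) = U * TT m A * Uᵀ := by
    intro m
    induction m with
    | zero => simp [TT, hU']
    | succ m ih =>
      simp only [TT]
      rw [key m ih, tr, Matrix.mul_sub, Matrix.sub_mul]
      simp [hU']
  refine ⟨hT m, ?_⟩
  cases m with
  | zero => rfl
  | succ m => simp only [SS]; rw [key m (hT m), tr]

lemma diag_TT (l : Fin n → ℝ) (m : ℕ) :
    TT m (diagonal l) = diagonal (fun i => ee l (Finset.univ.erase i) m) ∧
      SS m (diagonal l) = ee l Finset.univ m := by
  have hS : ∀ m, TT m (diagonal l) = diagonal (fun i => ee l (Finset.univ.erase i) m) →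
      SS (m+1) (diagonal l) = ee l Finset.univ (m+1) := by
    intro m ih
    have : (0:ℝ) < (m:ℝ)+1 := by positivity
    have h1 := SS_succ m (diagonal l)
    rw [ih, diagonal_mul_diagonal, trace_diagonal] at h1
    have h2 := ee_euler l Finset.univ m
    simp only [mul_comm (ee l _ m)] at h1
    rw [← h1] at h2
    exact (mul_left_cancel₀ this.ne' h2).symm
  have hT : ∀ m, TT m (diagonal l) = diagonal (fun i => ee l (Finset.univ.erase i) m) := by
    intro m
    induction m with
    | zero => simp only [TT, ee_zero]; exact diagonal_one.symm
    | succ m ih =>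
      rw [TT_succ, hS m ih, ih, diagonal_mul_diagonal, ← diagonal_one, ← diagonal_smul, diagonal_sub]
      congr 1; funext i
      have := ee_erase l (Finset.mem_univ i) m
      simp only [Pi.smul_apply, Pi.one_apply, smul_eq_mul, mul_one]
      rw [this]; ring
  refine ⟨hT m, ?_⟩
  cases m with
  | zero => simp [SS, ee_zero]
  | succ m => exact hS m (hT m)

open Polynomial in
lemma coeff_prod_sub {ι : Type*} [DecidableEq ι] (l : ι → ℝ) (s : Finset ι) : ∀ i j, i + j = s.card →
    (∏ i ∈ s, (X - C (l i))).coeff i = (-1)^j * ee l s j := by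
  induction s using Finset.induction_on with
  | empty => intro i j h; simp at h; obtain ⟨rfl, rfl⟩ := h; simp [ee_zero]
  | insert a s ha ih =>
    intro i j h
    rw [Finset.card_insert_of_notMem ha] at h
    rw [Finset.prod_insert ha]
    set Q := ∏ i ∈ s, (X - C (l i)) with hQ
    have hdeg : Q.natDegree = s.card := by simp [hQ]
    rw [sub_mul, coeff_sub, coeff_C_mul]
    rcases i with _ | i <;> rcases j with _ | j
    · omega
    · rw [mul_coeff_zero, coeff_X_zero, ih 0 j (by omega), ee_insert l ha, ee_gt l s (j+1) (by omega)]; ring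
    · rw [coeff_X_mul, ih i 0 (by omega), coeff_eq_zero_of_natDegree_lt (by omega)]; simp [ee_zero]
    · rw [coeff_X_mul, ih i (j+1) (by omega), ih (i+1) j (by omega), ee_insert l ha]; ring

lemma spectral {A : Matrix (Fin n) (Fin n) ℝ} (hA : Aᵀ = A) : ∃ (U : Matrix (Fin n) (Fin n) ℝ) (l : Fin n → ℝ),
    Uᵀ * U = 1 ∧ U * Uᵀ = 1 ∧ A = U * diagonal l * Uᵀ := by
  have hH : A.IsHermitian := by rw [Matrix.IsHermitian, conjTranspose_eq_transpose_of_trivial, hA]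
  refine ⟨hH.eigenvectorUnitary, hH.eigenvalues, ?_, ?_, ?_⟩
  · have := Unitary.coe_star_mul_self hH.eigenvectorUnitary
    rwa [star_eq_conjTranspose, conjTranspose_eq_transpose_of_trivial] at this
  · have := Matrix.mem_unitaryGroup_iff.1 hH.eigenvectorUnitary.2
    rwa [star_eq_conjTranspose, conjTranspose_eq_transpose_of_trivial] at this
  · have := hH.spectral_theorem
    rw [Unitary.conjStarAlgAut_apply, star_eq_conjTranspose, conjTranspose_eq_transpose_of_trivial] at this
    exact this

lemma esymmMat_eq {A : Matrix (Fin n) (Fin n) ℝ} (hA : Aᵀ = A) (m : ℕ) (hm : m ≤ n) :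
    esymmMat m A = SS m A := by
  obtain ⟨U, l, h1, h2, rfl⟩ := spectral hA
  rw [(conj_TT m U _ h1 h2).2, (diag_TT l m).2, esymmMat, Matrix.charpoly_mul_comm, ← Matrix.mul_assoc, h1, Matrix.one_mul,
    charpoly_diagonal, coeff_prod_sub l Finset.univ (n-m) m (by simp; omega), ← mul_assoc, ← mul_pow]
  simp

/-- cone condition in terms of SS -/
def GS (k : ℕ) (A : Matrix (Fin n) (Fin n) ℝ) : Prop := ∀ j, j ≤ k → 0 < SS j A

lemma GS_of {A : Matrix (Fin n) (Fin n) ℝ} (hA : Aᵀ = A) {k : ℕ} (hk : k ≤ n) (h : GammaPlus k A) : GS k A := by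
  intro j hj
  rcases Nat.eq_zero_or_pos j with rfl | hp
  · simp [SS]
  · rw [← esymmMat_eq hA j (by omega)]; exact h j hp hj

lemma spectral' {A : Matrix (Fin n) (Fin n) ℝ} (hA : Aᵀ = A) {k : ℕ} (h : GS k A) :
    ∃ (U : Matrix (Fin n) (Fin n) ℝ) (l : Fin n → ℝ),
    Uᵀ * U = 1 ∧ U * Uᵀ = 1 ∧ A = U * diagonal l * Uᵀ ∧ Gam l Finset.univ k ∧
    (∀ m, SS m A = ee l Finset.univ m) ∧ (∀ m, TT m A = U * diagonal (fun i => ee l (Finset.univ.erase i) m) * Uᵀ) := by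
  obtain ⟨U, l, h1, h2, rfl⟩ := spectral hA
  have hs : ∀ m, SS m (U * diagonal l * Uᵀ) = ee l Finset.univ m := fun m => by
    rw [(conj_TT m U _ h1 h2).2, (diag_TT l m).2]
  refine ⟨U, l, h1, h2, rfl, fun j hj => by rw [← hs]; exact h j hj, hs, fun m => ?_⟩
  rw [(conj_TT m U _ h1 h2).1, (diag_TT l m).1]

lemma sum_sq_le {l : Fin n → ℝ} (h : Gam l Finset.univ 2) : ∑ i, l i ^ 2 ≤ (ee l Finset.univ 1)^2 := by
  have h1 := ee_euler l Finset.univ 1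
  have h2 := h 2 le_rfl
  have h3 : ∀ i : Fin n, ee l (Finset.univ.erase i) 1 = ee l Finset.univ 1 - l i := fun i => by
    have := ee_erase l (Finset.mem_univ i) 0
    simp only [ee_zero, zero_add, mul_one] at this; rw [this]; ring
  simp only [h3, mul_sub, Finset.sum_sub_distrib, ← Finset.sum_mul, ← ee_one l Finset.univ] at h1
  have h4 : ∑ i, l i ^2 = ∑ i, l i * l i := Finset.sum_congr rfl fun i _ => sq _
  rw [h4]; push_cast at h1; nlinarith

lemma quad_form (U : Matrix (Fin n) (Fin n) ℝ) (d : Fin n → ℝ) (v : Fin n → ℝ) :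
    ∑ i, ∑ j, (U * diagonal d * Uᵀ) i j * v i * v j = ∑ i, d i * (Uᵀ *ᵥ v) i ^ 2 := by
  have : ∀ i j, (U * diagonal d * Uᵀ) i j = ∑ a, U i a * d a * U j a := by
    intro i j; rw [Matrix.mul_apply]; simp [Matrix.mul_diagonal]
  have h2 : ∀ a, (Uᵀ *ᵥ v) a = ∑ i, U i a * v i := fun a => by simp [Matrix.mulVec, dotProduct]
  simp only [this, h2, sq, Finset.sum_mul_sum, Finset.mul_sum, Finset.sum_mul]
  rw [Finset.sum_congr rfl fun i _ => Finset.sum_comm]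
  rw [Finset.sum_comm]
  refine Finset.sum_congr rfl fun a _ => Finset.sum_congr rfl fun i _ => Finset.sum_congr rfl fun j _ => ?_
  ring

lemma entries_le {A : Matrix (Fin n) (Fin n) ℝ} (hA : Aᵀ = A) (h : GS 2 A) (i j : Fin n) :
    |A i j| ≤ trace A := by
  obtain ⟨U, l, h1, h2, hAe, hG, hS, -⟩ := spectral' hA h
  have ht : trace A = ee l Finset.univ 1 := by rw [← hS 1]; simp [SS, TT]
  have hsq : trace (A * A) = ∑ i, l i ^ 2 := by
    have : A * A = U * (diagonal l * diagonal l) * Uᵀ := by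
      conv_lhs => rw [hAe]
      calc U * diagonal l * Uᵀ * (U * diagonal l * Uᵀ) = U * diagonal l * (Uᵀ * U) * diagonal l * Uᵀ := by simp only [Matrix.mul_assoc]
        _ = _ := by rw [h1]; simp only [Matrix.mul_assoc, Matrix.mul_one, Matrix.one_mul]
    rw [this, Matrix.trace_mul_comm, ← Matrix.mul_assoc, h1, Matrix.one_mul, diagonal_mul_diagonal, trace_diagonal]
    exact Finset.sum_congr rfl fun i _ => (sq _).symm
  have h3 : A i j ^ 2 ≤ trace (A * A) := by
    have : trace (A * A) = ∑ i, ∑ j, A i j ^ 2 := by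
      simp only [trace, diag, Matrix.mul_apply]
      refine Finset.sum_congr rfl fun i _ => Finset.sum_congr rfl fun j _ => ?_
      have := congrFun (congrFun hA i) j
      rw [transpose_apply] at this; rw [this, sq]
    rw [this]
    calc A i j ^ 2 ≤ ∑ j, A i j ^ 2 := Finset.single_le_sum (f := fun j => A i j ^2) (fun _ _ => sq_nonneg _) (Finset.mem_univ j)
      _ ≤ _ := Finset.single_le_sum (f := fun i => ∑ j, A i j ^2) (fun _ _ => Finset.sum_nonneg fun _ _ => sq_nonneg _) (Finset.mem_univ i)
  have h4 := sum_sq_le hG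
  have h5 := hG 1 (by omega)
  rw [ht]
  exact abs_le_of_sq_le_sq (by linarith) h5.le

lemma G1 {A : Matrix (Fin n) (Fin n) ℝ} (hA : Aᵀ = A) (k : ℕ) (h : GS (k+2) A) (v : Fin n → ℝ) :
    SS (k+2) A / (4 * trace A) * ∑ i, v i ^2 ≤ ∑ i, ∑ j, TT (k+1) A i j * v i * v j := by
  obtain ⟨U, l, h1, h2, hAe, hG, hS, hT⟩ := spectral' hA h
  have ht : trace A = ee l Finset.univ 1 := by rw [← hS 1]; simp [SS, TT]
  have h4 := sum_sq_le (hG.mono (by omega : 2 ≤ k+2))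
  have h5 := hG 1 (by omega)
  have habs : ∀ i ∈ Finset.univ, |l i| ≤ ee l Finset.univ 1 := fun i _ => by
    refine abs_le_of_sq_le_sq (le_trans ?_ h4) h5.le
    exact Finset.single_le_sum (f := fun i => l i ^2) (fun _ _ => sq_nonneg _) (Finset.mem_univ i)
  rw [hT, quad_form, ht, hS]
  have hv : ∑ i, v i ^ 2 = ∑ i, (Uᵀ *ᵥ v) i ^ 2 := by
    have := quad_form U (fun _ => 1) v
    simp only [one_mul] at this
    rw [← this]
    have e : (diagonal fun _ : Fin n => (1:ℝ)) = 1 := diagonal_one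
    rw [e, Matrix.mul_one, h2]
    refine Finset.sum_congr rfl fun i _ => ?_
    simp [Matrix.one_apply, sq]
  rw [hv, Finset.mul_sum]
  refine Finset.sum_le_sum fun i _ => ?_
  exact mul_le_mul_of_nonneg_right (newton_lower (Finset.mem_univ i) (k+1) hG habs) (sq_nonneg _)

lemma ee_perm (l : Fin n → ℝ) (σ : Equiv.Perm (Fin n)) (j : ℕ) :
    ee (l ∘ σ) Finset.univ j = ee l Finset.univ j := by
  unfold ee EP
  congr 1
  exact Equiv.prod_comp σ (fun i => 1 + Polynomial.C (l i) * Polynomial.X)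

lemma G4 {A B : Matrix (Fin n) (Fin n) ℝ} (hA : Aᵀ = A) (hB : Bᵀ = B) (k : ℕ) (h : GS (k+1) A) (hb : GS (k+1) B)
    (a b : ℝ) (ha0 : 0 < a) (hb0 : 0 < b) (haA : SS (k+1) A = a^(k+1)) (hbB : SS (k+1) B = b^(k+1)) :
    ((k:ℝ)+1) * a^k * b ≤ trace (TT k A * B) := by
  obtain ⟨U, l, h1, h2, hAe, hG, hS, hT⟩ := spectral' hA h
  obtain ⟨V, m, g1, g2, hBe, hG', hS', -⟩ := spectral' hB hb
  set Q := Uᵀ * V with hQ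
  have q1 : Q * Qᵀ = 1 := by
    rw [hQ, transpose_mul, transpose_transpose]
    calc Uᵀ * V * (Vᵀ * U) = Uᵀ * (V * Vᵀ) * U := by simp only [Matrix.mul_assoc]
      _ = 1 := by rw [g2, Matrix.mul_one, h1]
  have q2 : Qᵀ * Q = 1 := by
    rw [hQ, transpose_mul, transpose_transpose]
    calc Vᵀ * U * (Uᵀ * V) = Vᵀ * (U * Uᵀ) * V := by simp only [Matrix.mul_assoc]
      _ = 1 := by rw [h2, Matrix.mul_one, g1]
  set d := fun i => ee l (Finset.univ.erase i) k
  have htr : trace (TT k A * B) = ∑ i, ∑ j, d i * (Q i j ^ 2) * m j := by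
    rw [hT, hBe]
    have : trace (U * diagonal d * Uᵀ * (V * diagonal m * Vᵀ)) = trace (diagonal d * (Q * diagonal m * Qᵀ)) := by
      rw [hQ, transpose_mul, transpose_transpose]
      rw [show U * diagonal d * Uᵀ * (V * diagonal m * Vᵀ) = U * (diagonal d * Uᵀ * V * diagonal m * Vᵀ) by simp only [Matrix.mul_assoc],
        Matrix.trace_mul_comm]
      simp only [Matrix.mul_assoc]
    rw [this]
    have hq : ∀ i, (Q*diagonal m*Qᵀ) i i = ∑ j, Q i j * m j * Q i j := by
      intro i; rw [Matrix.mul_apply]; simp [Matrix.mul_diagonal]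
    simp only [trace, diag, Matrix.diagonal_mul, hq, Finset.mul_sum]
    refine Finset.sum_congr rfl fun i _ => Finset.sum_congr rfl fun j _ => ?_
    ring
  have hds : (Matrix.of fun i j => Q i j ^ 2) ∈ doublyStochastic ℝ (Fin n) := by
    rw [mem_doublyStochastic_iff_sum]
    refine ⟨fun i j => sq_nonneg _, fun i => ?_, fun j => ?_⟩
    · have := congrFun (congrFun q1 i) i
      simpa [Matrix.mul_apply, sq] using this
    · have := congrFun (congrFun q2 j) j
      simpa [Matrix.mul_apply, sq] using this
  obtain ⟨w, w0, w1, hw⟩ := exists_eq_sum_perm_of_mem_doublyStochastic hds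
  have hQe : ∀ i j, Q i j ^ 2 = ∑ σ : Equiv.Perm (Fin n), w σ * (if σ i = j then 1 else 0) := by
    intro i j
    have := congrFun (congrFun hw i) j
    rw [Matrix.of_apply] at this
    rw [← this, Matrix.sum_apply]
    refine Finset.sum_congr rfl fun σ _ => ?_
    simp [Equiv.Perm.permMatrix, PEquiv.toMatrix_apply, Equiv.toPEquiv_apply, eq_comm]
  have hfin : trace (TT k A * B) = ∑ σ : Equiv.Perm (Fin n), w σ * ∑ i, (m ∘ σ) i * d i := by
    rw [htr]
    simp only [hQe, Finset.mul_sum, Finset.sum_mul]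
    rw [Finset.sum_congr rfl fun i _ => Finset.sum_comm, Finset.sum_comm]
    refine Finset.sum_congr rfl fun σ _ => Finset.sum_congr rfl fun i _ => ?_
    rw [Finset.sum_eq_single (σ i)]
    · simp; ring
    · intro j _ hj; simp [hj.symm]
    · simp
  rw [hfin]
  calc ((k:ℝ)+1) * a^k * b = ∑ σ : Equiv.Perm (Fin n), w σ * (((k:ℝ)+1) * a^k * b) := by
        rw [← Finset.sum_mul, w1, one_mul]
    _ ≤ _ := by
        refine Finset.sum_le_sum fun σ _ => mul_le_mul_of_nonneg_left ?_ (w0 σ)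
        refine garding k Finset.univ l (m ∘ σ) hG (fun j hj => by rw [ee_perm]; exact hG' j hj) a b ha0 hb0 ?_ ?_
        · rw [← hS, haA]
        · rw [ee_perm, ← hS', hbB]

end mat
end IHE

end

noncomputable section
set_option linter.unusedSectionVars false
set_option linter.style.longLine false
set_option linter.unusedSimpArgs false
namespace IHE
section dd
variable {n : ℕ}

def DTT {n : ℕ} : ℕ → Matrix (Fin n) (Fin n) ℝ → Matrix (Fin n) (Fin n) ℝ → Matrix (Fin n) (Fin n) ℝ
  | 0, _, _ => 0
  | (m+1), A, B => (trace (DTT m A B * A + TT m A * B) / ((m:ℝ)+1)) • (1 : Matrix (Fin n) (Fin n) ℝ)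
      - (DTT m A B * A + TT m A * B)

lemma TT_expand (A : Matrix (Fin n) (Fin n) ℝ) (m : ℕ) :
    TT m A = ∑ p ∈ Finset.HasAntidiagonal.antidiagonal m, SS p.2 A • (-A)^p.1 := by
  induction m with
  | zero => simp [TT, SS]
  | succ m ih =>
    rw [Finset.Nat.sum_antidiagonal_succ, TT_succ, sub_eq_add_neg, ← Matrix.mul_neg]
    conv_lhs => rw [ih]
    rw [Finset.sum_mul]
    simp [pow_succ]

lemma UV (A : Matrix (Fin n) (Fin n) ℝ) (m : ℕ) :
    ∑ p ∈ Finset.HasAntidiagonal.antidiagonal m, (trace ((-A)^p.1 * A) • TT p.2 A + (-A)^(p.1+1) * TT p.2 A) = ((m:ℝ)+1) • TT (m+1) A := by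
  have hU : ∀ m : ℕ, ∑ p ∈ Finset.HasAntidiagonal.antidiagonal (m+1), trace ((-A)^p.1 * A) • TT p.2 A =
      ((m:ℝ)+2) • SS (m+2) A • (1 : Matrix (Fin n) (Fin n) ℝ) - (∑ p ∈ Finset.HasAntidiagonal.antidiagonal m, trace ((-A)^p.1 * A) • TT p.2 A) * A := by
    intro m
    have h1 := SS_succ (m+1) A
    rw [TT_expand A (m+1), Finset.sum_mul, trace_sum, Finset.Nat.sum_antidiagonal_succ'] at h1
    rw [Finset.Nat.sum_antidiagonal_succ']
    have h2 : ((m:ℝ)+2) • SS (m+2) A • (1 : Matrix (Fin n) (Fin n) ℝ) = (((m:ℝ)+2) * SS (m+2) A) • (1 : Matrix (Fin n) (Fin n) ℝ) := by rw [smul_smul]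
    have h3 : ((m:ℝ)+2) = ((m+1:ℕ):ℝ)+1 := by push_cast; ring
    rw [h2, h3, h1, Finset.sum_mul, add_smul, add_sub_assoc, Finset.sum_smul, ← Finset.sum_sub_distrib]
    congr 1
    · simp [SS, TT]
    · refine Finset.sum_congr rfl fun p _ => ?_
      simp only [TT_succ]
      rw [smul_sub, smul_smul]
      simp [mul_comm]
  induction m with
  | zero => simp [TT, SS, sub_eq_add_neg]
  | succ m ih =>
    rw [Finset.sum_add_distrib, hU, Finset.Nat.sum_antidiagonal_succ]
    rw [Finset.sum_add_distrib] at ih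
    have : ∑ p ∈ Finset.HasAntidiagonal.antidiagonal m, trace ((-A) ^ p.1 * A) • TT p.2 A = ((m:ℝ)+1) • TT (m+1) A - ∑ p ∈ Finset.HasAntidiagonal.antidiagonal m, (-A) ^ (p.1 + 1) * TT p.2 A := by
      rw [← ih]; abel
    rw [this, sub_mul]
    have h4 : ∑ p ∈ Finset.HasAntidiagonal.antidiagonal m, (-A) ^ (p.1 + 1 + 1) * TT p.2 A = - ((∑ p ∈ Finset.HasAntidiagonal.antidiagonal m, (-A) ^ (p.1 + 1) * TT p.2 A) * A) := by
      rw [Finset.sum_mul, ← Finset.sum_neg_distrib]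
      refine Finset.sum_congr rfl fun p _ => ?_
      rw [Matrix.mul_assoc, TT_comm, pow_succ, ← Matrix.mul_assoc, Matrix.mul_neg, Matrix.neg_mul]
    simp only [h4, zero_add, pow_one]
    rw [TT_succ (m+1), Matrix.smul_mul, Matrix.neg_mul, ← TT_comm]
    push_cast
    module

lemma trace_DTT (A B : Matrix (Fin n) (Fin n) ℝ) (m : ℕ) : trace (DTT m A B * A) = m * trace (TT m A * B) := by
  induction m using Nat.strong_induction_on with
  | _ m ihm =>
  have hDS : ∀ j < m, trace (DTT j A B * A + TT j A * B) / ((j:ℝ)+1) = trace (TT j A * B) := by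
    intro j hj
    have : (0:ℝ) < (j:ℝ)+1 := by positivity
    rw [trace_add, ihm j hj]; field_simp
  have hF : ∀ j, j < m → ∀ C, C * A = A * C → trace (DTT (j+1) A B * C) =
      ∑ p ∈ Finset.HasAntidiagonal.antidiagonal j, (trace (TT p.2 A * B) * trace ((-A)^p.1 * C) - trace ((-A)^p.1 * TT p.2 A * B * C)) := by
    intro j
    induction j with
    | zero =>
      intro hj C hC
      rw [DTT, hDS 0 hj]; simp [DTT, TT, sub_mul]
    | succ j ihj =>
      intro hj C hC
      rw [Finset.Nat.sum_antidiagonal_succ]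
      have e : DTT (j+1+1) A B * C = (trace (TT (j+1) A * B)) • C + DTT (j+1) A B * (-A * C) - TT (j+1) A * B * C := by
        rw [← hDS (j+1) hj, DTT]
        simp only [sub_mul, add_mul, Matrix.smul_mul, Matrix.one_mul, Matrix.mul_assoc, Matrix.neg_mul, Matrix.mul_neg]
        push_cast; abel
      rw [e, trace_sub, trace_add, trace_smul, ihj (by omega) (-A * C) (by simp [Matrix.mul_assoc, hC])]
      have e2 : ∀ p : ℕ × ℕ, trace ((-A)^p.1 * TT p.2 A * B * (-A * C)) = trace ((-A)^(p.1+1) * TT p.2 A * B * C) := by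
        intro p
        rw [Matrix.neg_mul, ← hC, ← Matrix.mul_neg, ← Matrix.mul_assoc, Matrix.trace_mul_comm, pow_succ']
        simp only [Matrix.mul_assoc]
      simp only [e2]
      have e3 : ∀ p : ℕ × ℕ, (-A)^p.1 * (-A * C) = (-A)^(p.1+1) * C := fun p => by rw [pow_succ, Matrix.mul_assoc]
      simp only [e3, pow_zero, Matrix.one_mul, smul_eq_mul]
      ring
  cases m with
  | zero => simp [DTT]
  | succ m =>
    rw [hF m (by omega) A rfl]
    have := congrArg (fun X => trace (X * B)) (UV A m)
    simp only [Matrix.smul_mul, trace_smul, smul_eq_mul, Finset.sum_mul, trace_sum] at this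
    push_cast
    rw [← this]
    refine Finset.sum_congr rfl fun p _ => ?_
    rw [Matrix.add_mul, trace_add, Matrix.smul_mul, trace_smul, pow_succ', smul_eq_mul,
      Matrix.neg_mul, Matrix.neg_mul, Matrix.neg_mul, trace_neg, Matrix.trace_mul_comm ((-A)^p.1 * TT p.2 A * B) A]
    simp only [Matrix.mul_assoc]
    ring

lemma DTT_succ (m : ℕ) (A B : Matrix (Fin n) (Fin n) ℝ) :
    DTT (m+1) A B = trace (TT m A * B) • (1 : Matrix (Fin n) (Fin n) ℝ) - (DTT m A B * A + TT m A * B) := by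
  have : (0:ℝ) < (m:ℝ)+1 := by positivity
  rw [DTT, trace_add, trace_DTT]
  congr 2
  field_simp

lemma TT_bound (n m : ℕ) : ∃ C : ℝ, 1 ≤ C ∧ ∀ (A : Matrix (Fin n) (Fin n) ℝ) (r : ℝ), 0 ≤ r → (∀ i j, |A i j| ≤ r) →
    (∀ i j, |TT m A i j| ≤ C * r^m) ∧ |SS m A| ≤ C * r^m := by
  induction m with
  | zero =>
    refine ⟨1, le_rfl, fun A r hr h => ⟨fun i j => ?_, by simp [SS]⟩⟩
    simp only [TT, Matrix.one_apply]; split_ifs <;> simp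
  | succ m ih =>
    obtain ⟨C, hC, ih⟩ := ih
    refine ⟨(1 + n + n * n) * C, ?_, fun A r hr h => ?_⟩
    · nlinarith [show (0:ℝ) ≤ n + n * n by positivity]
    have h1 : ∀ i j, |(TT m A * A) i j| ≤ n * C * r^(m+1) := by
      intro i j
      rw [Matrix.mul_apply]
      calc |∑ l, TT m A i l * A l j| ≤ ∑ l, |TT m A i l * A l j| := Finset.abs_sum_le_sum_abs _ _
        _ ≤ ∑ l : Fin n, C * r^m * r := Finset.sum_le_sum fun l _ => by
            rw [abs_mul]
            exact mul_le_mul ((ih A r hr h).1 i l) (h l j) (abs_nonneg _) (by positivity)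
        _ = _ := by simp; ring
    have h2 : |SS (m+1) A| ≤ n * n * C * r^(m+1) := by
      have hm : (1:ℝ) ≤ (m:ℝ)+1 := by simp
      simp only [SS]
      rw [abs_div, abs_of_pos (by linarith : (0:ℝ) < (m:ℝ)+1), div_le_iff₀ (by linarith)]
      calc |trace (TT m A * A)| ≤ ∑ i, |(TT m A * A) i i| := Finset.abs_sum_le_sum_abs _ _
        _ ≤ ∑ i : Fin n, n * C * r^(m+1) := Finset.sum_le_sum fun i _ => h1 i i
        _ = n * n * C * r^(m+1) * 1 := by simp; ring
        _ ≤ _ := by gcongr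
    have h0 : 0 ≤ C * r^(m+1) := by positivity
    have h0' : 0 ≤ n * C * r^(m+1) := by positivity
    refine ⟨fun i j => ?_, by nlinarith⟩
    rw [TT_succ, Matrix.sub_apply, Matrix.smul_apply]
    have h3 : |SS (m+1) A • (1 : Matrix (Fin n) (Fin n) ℝ) i j| ≤ |SS (m+1) A| := by
      rw [Matrix.one_apply]; split_ifs <;> simp
    have := abs_sub (SS (m+1) A • (1 : Matrix (Fin n) (Fin n) ℝ) i j) ((TT m A * A) i j)
    nlinarith [h1 i j]

lemma TT_contDiff {E : Type*} [NormedAddCommGroup E] [NormedSpace ℝ E] {r : WithTop ℕ∞} {A : E → Matrix (Fin n) (Fin n) ℝ}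
    {s : Set E} (hA : ∀ i j, ContDiffOn ℝ r (fun x => A x i j) s) (m : ℕ) :
    (∀ i j, ContDiffOn ℝ r (fun x => TT m (A x) i j) s) ∧ ContDiffOn ℝ r (fun x => SS m (A x)) s := by
  induction m with
  | zero => exact ⟨fun i j => by simp only [TT]; exact contDiffOn_const, by simp only [SS]; exact contDiffOn_const⟩
  | succ m ih =>
    have h1 : ∀ i j, ContDiffOn ℝ r (fun x => (TT m (A x) * A x) i j) s := by
      intro i j
      simp only [Matrix.mul_apply]
      exact ContDiffOn.sum fun l _ => (ih.1 i l).mul (hA l j)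
    have h2 : ContDiffOn ℝ r (fun x => SS (m+1) (A x)) s := by
      simp only [SS, trace, diag]
      exact (ContDiffOn.sum fun i _ => h1 i i).div_const _
    refine ⟨fun i j => ?_, h2⟩
    simp only [TT_succ, Matrix.sub_apply, Matrix.smul_apply, smul_eq_mul]
    exact (h2.mul contDiffOn_const).sub (h1 i j)

lemma TT_continuous (m : ℕ) : (Continuous fun A : Matrix (Fin n) (Fin n) ℝ => TT m A) ∧ Continuous fun A : Matrix (Fin n) (Fin n) ℝ => SS m A := by
  induction m with
  | zero => exact ⟨by simp only [TT]; exact continuous_const, by simp only [SS]; exact continuous_const⟩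
  | succ m ih =>
    have h1 := ih.1.matrix_mul continuous_id
    have h2 : Continuous fun A : Matrix (Fin n) (Fin n) ℝ => SS (m+1) A := by
      simp only [SS]; exact h1.matrix_trace.div_const _
    exact ⟨by simp only [TT_succ]; exact (h2.smul continuous_const).sub h1, h2⟩

end dd
end IHE

end

noncomputable section
set_option linter.unusedSectionVars false
set_option linter.style.longLine false
set_option linter.unusedSimpArgs false
namespace IHE
section pdc
variable {n : ℕ}

lemma pd_congr {i : Fin n} {w v : (Fin n → ℝ) → ℝ} {x : Fin n → ℝ} (h : w =ᶠ[nhds x] v) : pd i w x = pd i v x := by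
  unfold pd; rw [h.fderiv_eq]

lemma pd_const (i : Fin n) (c : ℝ) (x : Fin n → ℝ) : pd i (fun _ => c) x = 0 := by
  unfold pd; simp

lemma pd_add {i : Fin n} {w v : (Fin n → ℝ) → ℝ} {x : Fin n → ℝ} (hw : DifferentiableAt ℝ w x) (hv : DifferentiableAt ℝ v x) :
    pd i (fun y => w y + v y) x = pd i w x + pd i v x := by
  unfold pd; rw [fderiv_fun_add hw hv]; rfl

lemma pd_sub {i : Fin n} {w v : (Fin n → ℝ) → ℝ} {x : Fin n → ℝ} (hw : DifferentiableAt ℝ w x) (hv : DifferentiableAt ℝ v x) :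
    pd i (fun y => w y - v y) x = pd i w x - pd i v x := by
  unfold pd; rw [fderiv_fun_sub hw hv]; rfl

lemma pd_mul {i : Fin n} {w v : (Fin n → ℝ) → ℝ} {x : Fin n → ℝ} (hw : DifferentiableAt ℝ w x) (hv : DifferentiableAt ℝ v x) :
    pd i (fun y => w y * v y) x = pd i w x * v x + w x * pd i v x := by
  unfold pd; rw [fderiv_fun_mul hw hv]; simp; ring

lemma pd_const_mul {i : Fin n} {w : (Fin n → ℝ) → ℝ} {x : Fin n → ℝ} (c : ℝ) (hw : DifferentiableAt ℝ w x) :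
    pd i (fun y => c * w y) x = c * pd i w x := by
  rw [pd_mul (differentiableAt_const c) hw, pd_const]; ring

lemma pd_sum {ι : Type*} (s : Finset ι) {i : Fin n} {w : ι → (Fin n → ℝ) → ℝ} {x : Fin n → ℝ} (hw : ∀ a ∈ s, DifferentiableAt ℝ (w a) x) :
    pd i (fun y => ∑ a ∈ s, w a y) x = ∑ a ∈ s, pd i (w a) x := by
  unfold pd; rw [fderiv_fun_sum hw]; simp

lemma pd_comp {i : Fin n} {w : (Fin n → ℝ) → ℝ} {x : Fin n → ℝ} {φ : ℝ → ℝ} {φ' : ℝ} (hφ : HasDerivAt φ φ' (w x)) (hw : DifferentiableAt ℝ w x) :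
    pd i (fun y => φ (w y)) x = φ' * pd i w x := by
  unfold pd
  have := (hφ.comp_hasFDerivAt x hw.hasFDerivAt).fderiv
  rw [show (fun y => φ (w y)) = φ ∘ w from rfl, this]; simp

lemma pd_contDiffOn {i : Fin n} {w : (Fin n → ℝ) → ℝ} {r m : WithTop ℕ∞} {s : Set (Fin n → ℝ)} (hs : IsOpen s)
    (hw : ContDiffOn ℝ r w s) (hm : m + 1 ≤ r) : ContDiffOn ℝ m (pd i w) s := by
  have := hw.fderiv_of_isOpen hs hm
  exact this.clm_apply contDiffOn_const

lemma pd_contDiff {i : Fin n} {w : (Fin n → ℝ) → ℝ} {r m : WithTop ℕ∞}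
    (hw : ContDiff ℝ r w) (hm : m + 1 ≤ r) : ContDiff ℝ m (pd i w) := by
  have := hw.fderiv_right hm
  exact this.clm_apply contDiff_const

lemma pd_hcs {i : Fin n} {w : (Fin n → ℝ) → ℝ} (hw : HasCompactSupport w) : HasCompactSupport (pd i w) := by
  exact hw.fderiv_apply (𝕜 := ℝ) (v := Pi.single i 1)

lemma pd_comm {i j : Fin n} {w : (Fin n → ℝ) → ℝ} {x : Fin n → ℝ} (hw : ContDiffAt ℝ 2 w x) :
    pd i (pd j w) x = pd j (pd i w) x := by
  have hs := hw.isSymmSndFDerivAt (by simp)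
  have hd : DifferentiableAt ℝ (fderiv ℝ w) x :=
    (hw.fderiv_right (m := 1) (by norm_num)).differentiableAt one_ne_zero
  have key : ∀ a b : Fin n, pd a (pd b w) x = fderiv ℝ (fderiv ℝ w) x (Pi.single a 1) (Pi.single b 1) := by
    intro a b
    show fderiv ℝ (fun y => fderiv ℝ w y (Pi.single b 1)) x (Pi.single a 1) = _
    rw [fderiv_clm_apply hd (differentiableAt_const _)]
    simp
  rw [key, key]; exact hs _ _

lemma pd_TT {A : (Fin n → ℝ) → Matrix (Fin n) (Fin n) ℝ} {x : Fin n → ℝ} (hA : ∀ a b, DifferentiableAt ℝ (fun y => A y a b) x)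
    (i : Fin n) (m : ℕ) : (∀ a b, DifferentiableAt ℝ (fun y => TT m (A y) a b) x ∧
      pd i (fun y => TT m (A y) a b) x = DTT m (A x) (Matrix.of fun a b => pd i (fun y => A y a b) x) a b)
      ∧ DifferentiableAt ℝ (fun y => SS (m+1) (A y)) x ∧
      pd i (fun y => SS (m+1) (A y)) x = trace (TT m (A x) * (Matrix.of fun a b => pd i (fun y => A y a b) x)) := by
  set B : Matrix (Fin n) (Fin n) ℝ := Matrix.of fun a b => pd i (fun y => A y a b) x with hB
  have step : ∀ m, (∀ a b, DifferentiableAt ℝ (fun y => TT m (A y) a b) x ∧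
      pd i (fun y => TT m (A y) a b) x = DTT m (A x) B a b) →
      (∀ a b, DifferentiableAt ℝ (fun y => (TT m (A y) * A y) a b) x ∧
      pd i (fun y => (TT m (A y) * A y) a b) x = (DTT m (A x) B * A x + TT m (A x) * B) a b) ∧
      DifferentiableAt ℝ (fun y => SS (m+1) (A y)) x ∧
      pd i (fun y => SS (m+1) (A y)) x = trace (TT m (A x) * B) := by
    intro m ih
    have h1 : ∀ a b, DifferentiableAt ℝ (fun y => (TT m (A y) * A y) a b) x ∧
      pd i (fun y => (TT m (A y) * A y) a b) x = (DTT m (A x) B * A x + TT m (A x) * B) a b := by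
      intro a b
      simp only [Matrix.mul_apply, Matrix.add_apply]
      have hd : ∀ l ∈ Finset.univ, DifferentiableAt ℝ (fun y => TT m (A y) a l * A y l b) x := fun l _ => (ih a l).1.mul (hA l b)
      refine ⟨DifferentiableAt.fun_sum hd, ?_⟩
      rw [pd_sum _ hd, ← Finset.sum_add_distrib]
      refine Finset.sum_congr rfl fun l _ => ?_
      rw [pd_mul (ih a l).1 (hA l b), (ih a l).2]; rfl
    have hd : ∀ l ∈ Finset.univ, DifferentiableAt ℝ (fun y => (TT m (A y) * A y) l l) x := fun l _ => (h1 l l).1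
    have h2 : (fun y => SS (m+1) (A y)) = fun y => (1 / ((m:ℝ)+1)) * ∑ l, (TT m (A y) * A y) l l := by
      funext y; simp only [SS, trace, diag]; ring
    have h3 := DifferentiableAt.fun_sum hd
    refine ⟨h1, ?_, ?_⟩
    · rw [h2]; exact h3.const_mul _
    · rw [h2, pd_const_mul _ h3, pd_sum _ hd, Finset.sum_congr rfl fun l _ => (h1 l l).2]
      have : (0:ℝ) < (m:ℝ)+1 := by positivity
      have e := trace_DTT (A x) B m
      have : ∑ l, (DTT m (A x) B * A x + TT m (A x) * B) l l = trace (DTT m (A x) B * A x + TT m (A x) * B) := rfl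
      rw [this, trace_add, e]; field_simp
  have main : ∀ m, (∀ a b, DifferentiableAt ℝ (fun y => TT m (A y) a b) x ∧
      pd i (fun y => TT m (A y) a b) x = DTT m (A x) B a b) := by
    intro m
    induction m with
    | zero =>
      intro a b
      simp only [TT, DTT]
      exact ⟨differentiableAt_const _, by rw [pd_const]; rfl⟩
    | succ m ih =>
      intro a b
      obtain ⟨h1, h2, h3⟩ := step m ih
      simp only [TT_succ, Matrix.sub_apply, Matrix.smul_apply, smul_eq_mul, mul_comm _ ((1 : Matrix (Fin n) (Fin n) ℝ) a b)]
      refine ⟨(h2.const_mul _).sub (h1 a b).1, ?_⟩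
      rw [pd_sub (h2.const_mul _) (h1 a b).1, pd_const_mul _ h2, h3, (h1 a b).2, DTT_succ, Matrix.sub_apply, Matrix.smul_apply, smul_eq_mul, mul_comm]
  exact ⟨main m, (step m (main m)).2⟩

lemma div_TT {A : (Fin n → ℝ) → Matrix (Fin n) (Fin n) ℝ} {x : Fin n → ℝ} (hA : ∀ a b, DifferentiableAt ℝ (fun y => A y a b) x)
    (hs : ∀ y, (A y)ᵀ = A y) (g : Fin n → ℝ)
    (hc : ∀ i l j, pd i (fun y => A y l j) x - pd j (fun y => A y i l) x = - g i * (1 : Matrix (Fin n) (Fin n) ℝ) l j + g j * (1 : Matrix (Fin n) (Fin n) ℝ) i l) (m : ℕ) (j : Fin n) :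
    ∑ i, pd i (fun y => TT (m+1) (A y) i j) x = - ((n:ℝ) - m - 1) * ∑ l, TT m (A x) j l * g l := by
  have hsym : ∀ m i l, TT m (A x) i l = TT m (A x) l i := fun m i l => by
    conv_lhs => rw [← TT_symm m (hs x), transpose_apply]
  have hgen : ∀ m (j : Fin n), ∑ i, pd i (fun y => TT (m+1) (A y) i j) x =
      (∑ i, ∑ l, TT m (A x) i l * (pd j (fun y => A y i l) x - pd i (fun y => A y l j) x)) - ∑ l, (∑ i, pd i (fun y => TT m (A y) i l) x) * A x l j := by
    intro m j
    have hd := fun i => pd_TT hA i m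
    have : ∀ i, pd i (fun y => TT (m+1) (A y) i j) x = (1 : Matrix (Fin n) (Fin n) ℝ) i j * pd i (fun y => SS (m+1) (A y)) x
       - ∑ l, (pd i (fun y => TT m (A y) i l) x * A x l j + TT m (A x) i l * pd i (fun y => A y l j) x) := by
      intro i
      rw [((pd_TT hA i (m+1)).1 i j).2, DTT_succ, ← (hd i).2.2, Matrix.sub_apply, Matrix.smul_apply, smul_eq_mul, mul_comm,
        Matrix.add_apply, Matrix.mul_apply, Matrix.mul_apply, ← Finset.sum_add_distrib]
      congr 1
      refine Finset.sum_congr rfl fun l _ => ?_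
      rw [((hd i).1 i l).2]; rfl
    rw [Finset.sum_congr rfl fun i _ => this i, Finset.sum_sub_distrib]
    have h1 : ∑ i, (1 : Matrix (Fin n) (Fin n) ℝ) i j * pd i (fun y => SS (m+1) (A y)) x = ∑ i, ∑ l, TT m (A x) i l * pd j (fun y => A y i l) x := by
      rw [Finset.sum_eq_single j]
      · rw [Matrix.one_apply_eq, one_mul, (hd j).2.2]
        simp only [trace, diag, Matrix.mul_apply, Matrix.of_apply]
        rw [Finset.sum_comm]
        conv_rhs => rw [Finset.sum_comm]
        refine Finset.sum_congr rfl fun l _ => Finset.sum_congr rfl fun i _ => ?_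
        have e : (fun y => A y i l) = fun y => A y l i := by
          funext y; conv_lhs => rw [← hs y, transpose_apply]
        rw [e, hsym m i l]
      · intro i _ hi; rw [Matrix.one_apply_ne hi, zero_mul]
      · simp
    rw [h1]
    simp only [Finset.sum_add_distrib, mul_sub, Finset.sum_sub_distrib, Finset.sum_mul]
    rw [Finset.sum_comm (f := fun l i => pd i (fun y => TT m (A y) i l) x * A x l j)]
    ring
  have h2 : ∀ m j, ∑ i, ∑ l, TT m (A x) i l * (pd j (fun y => A y i l) x - pd i (fun y => A y l j) x) = - (((n:ℝ)-m) * SS m (A x)) * g j + ∑ i, TT m (A x) j i * g i := by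
    intro m j
    have : ∀ i l, TT m (A x) i l * (pd j (fun y => A y i l) x - pd i (fun y => A y l j) x) =
        (if l = j then TT m (A x) i l * g i else 0) - (if i = l then TT m (A x) i l * g j else 0) := by
      intro i l
      have := hc i l j
      rw [show pd j (fun y => A y i l) x - pd i (fun y => A y l j) x = - (- g i * (1 : Matrix (Fin n) (Fin n) ℝ) l j + g j * (1 : Matrix (Fin n) (Fin n) ℝ) i l) by linarith]
      simp only [Matrix.one_apply]; split_ifs <;> ring
    simp only [this, Finset.sum_sub_distrib]
    simp only [Finset.sum_ite_eq, Finset.sum_ite_eq', Finset.mem_univ, if_true, ← Finset.sum_mul]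
    have e : ∑ i, TT m (A x) i i = ((n:ℝ)-m) * SS m (A x) := trace_TT m (A x)
    rw [e, Finset.sum_congr rfl fun i _ => by rw [hsym m i j]]; ring
  induction m generalizing j with
  | zero =>
    rw [hgen, h2]
    simp only [TT, SS, pd_const]
    simp [Matrix.one_apply]; ring
  | succ m ih =>
    rw [hgen, h2]
    simp only [ih]
    have e : ∑ l, -((n:ℝ) - m - 1) * (∑ r, TT m (A x) l r * g r) * A x l j = -((n:ℝ) - m - 1) * ∑ r, (TT m (A x) * A x) j r * g r := by
      simp only [Finset.mul_sum, Finset.sum_mul]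
      rw [Finset.sum_comm]
      refine Finset.sum_congr rfl fun r _ => ?_
      rw [TT_comm, Matrix.mul_apply, Finset.sum_mul, Finset.mul_sum]
      refine Finset.sum_congr rfl fun l _ => ?_
      have : A x l j = A x j l := by conv_lhs => rw [← hs x, transpose_apply]
      rw [this]; ring
    have e2 : ∀ r, (TT m (A x) * A x) j r = SS (m+1) (A x) * (1 : Matrix (Fin n) (Fin n) ℝ) j r - TT (m+1) (A x) j r := by
      intro r; rw [TT_succ]; simp
    rw [e]
    simp only [e2, sub_mul, Finset.sum_sub_distrib]
    have e3 : ∑ r, SS (m+1) (A x) * (1 : Matrix (Fin n) (Fin n) ℝ) j r * g r = SS (m+1) (A x) * g j := by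
      simp [Matrix.one_apply]
    rw [e3]; push_cast; ring
end pdc
end IHE

end

noncomputable section
set_option linter.unusedSectionVars false
set_option linter.style.longLine false
set_option linter.unusedSimpArgs false
namespace IHE
section moll
variable {n : ℕ}
open scoped Convolution Topology ContDiff
open ContinuousLinearMap Filter

def mbump (n : ℕ) (δ : ℝ) (hδ : 0 < δ) : ContDiffBump (0 : Fin n → ℝ) := ⟨δ/2, δ, by linarith, by linarith⟩

def mol (δ : ℝ) (hδ : 0 < δ) (w : (Fin n → ℝ) → ℝ) : (Fin n → ℝ) → ℝ :=
  ((mbump n δ hδ).normed volume) ⋆[lsmul ℝ ℝ, volume] w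

lemma mol_contDiff {δ : ℝ} (hδ : 0 < δ) {w : (Fin n → ℝ) → ℝ} (hw : Continuous w) (r : ℕ∞) : ContDiff ℝ r (mol δ hδ w) :=
  (mbump n δ hδ).hasCompactSupport_normed.contDiff_convolution_left _ (mbump n δ hδ).contDiff_normed hw.locallyIntegrable

lemma pd_mol {δ : ℝ} (hδ : 0 < δ) {w : (Fin n → ℝ) → ℝ} (hw : ContDiff ℝ 1 w) (hc : HasCompactSupport w) (i : Fin n) :
    pd i (mol δ hδ w) = mol δ hδ (pd i w) := by
  funext x
  have hli : LocallyIntegrable ((mbump n δ hδ).normed volume) volume := (mbump n δ hδ).continuous_normed.locallyIntegrable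
  have h := hc.hasFDerivAt_convolution_right (lsmul ℝ ℝ) hli hw x
  have e : pd i (mol δ hδ w) x = ((((mbump n δ hδ).normed volume) ⋆[(lsmul ℝ ℝ).precompR (Fin n → ℝ), volume] fderiv ℝ w) x) (Pi.single i 1) := by
    unfold pd mol; rw [h.fderiv]
  rw [e, convolution_precompR_apply _ hli (hc.fderiv ℝ) (hw.continuous_fderiv one_ne_zero)]
  rfl

lemma mol_close {δ : ℝ} (hδ : 0 < δ) {w : (Fin n → ℝ) → ℝ} (hw : Continuous w) {x : Fin n → ℝ} {ε : ℝ}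
    (h : ∀ y ∈ ball x δ, |w y - w x| ≤ ε) : |mol δ hδ w x - w x| ≤ ε := by
  have := ContDiffBump.dist_normed_convolution_le (φ := mbump n δ hδ) (μ := volume) (g := w) (x₀ := x) (ε := ε) hw.aestronglyMeasurable
    (fun y hy => by rw [Real.dist_eq]; exact h y hy)
  rwa [Real.dist_eq] at this

lemma mol_bound {δ : ℝ} (hδ : 0 < δ) {w : (Fin n → ℝ) → ℝ} (hw : Continuous w) {B : ℝ} (hB : ∀ y, |w y| ≤ B) (x : Fin n → ℝ) :
    |mol δ hδ w x| ≤ 3 * B := by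
  have h1 := mol_close hδ hw (x := x) (ε := 2 * B) (fun y _ => by
    have := abs_sub (w y) (w x); linarith [hB x, hB y])
  have := abs_sub_abs_le_abs_sub (mol δ hδ w x) (w x)
  linarith [hB x]

lemma mol_tendsto {w : (Fin n → ℝ) → ℝ} (hw : Continuous w) (x : Fin n → ℝ) :
    Tendsto (fun k : ℕ => mol (1/((k:ℝ)+1)) Nat.one_div_pos_of_nat w x) atTop (𝓝 (w x)) := by
  refine ContDiffBump.convolution_tendsto_right_of_continuous (φ := fun k : ℕ => mbump n (1/((k:ℝ)+1)) Nat.one_div_pos_of_nat) ?_ hw x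
  exact tendsto_one_div_add_atTop_nhds_zero_nat

/-- augmented Hessian -/
def AA (u g : (Fin n → ℝ) → ℝ) (x : Fin n → ℝ) : Matrix (Fin n) (Fin n) ℝ := hess u x - g x • (1 : Matrix (Fin n) (Fin n) ℝ)

lemma AA_apply (u g : (Fin n → ℝ) → ℝ) (x : Fin n → ℝ) (i j : Fin n) :
    AA u g x i j = pd i (pd j u) x - g x * (1 : Matrix (Fin n) (Fin n) ℝ) i j := by
  simp [AA, hess]

lemma AA_symm {u : (Fin n → ℝ) → ℝ} (g : (Fin n → ℝ) → ℝ) {x : Fin n → ℝ} (hu : ContDiffAt ℝ 2 u x) : (AA u g x)ᵀ = AA u g x := by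
  ext i j
  rw [transpose_apply, AA_apply, AA_apply, pd_comm hu, ← Matrix.transpose_apply (1 : Matrix (Fin n) (Fin n) ℝ), transpose_one]

lemma AA_cont {u g : (Fin n → ℝ) → ℝ} (hu : ContDiff ℝ 2 u) (hg : Continuous g) (i j : Fin n) : Continuous fun x => AA u g x i j := by
  simp only [AA_apply]
  exact ((pd_contDiff (m := 0) (pd_contDiff (m := 1) hu (by norm_num)) (by norm_num)).continuous).sub (hg.mul continuous_const)

lemma AA_cont' {u g : (Fin n → ℝ) → ℝ} (hu : ContDiff ℝ 2 u) (hg : Continuous g) : Continuous fun x => AA u g x :=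
  continuous_matrix fun i j => AA_cont hu hg i j

lemma TT_AA_cont {u g : (Fin n → ℝ) → ℝ} (hu : ContDiff ℝ 2 u) (hg : Continuous g) (m : ℕ) (i j : Fin n) :
    Continuous fun x => TT m (AA u g x) i j := by
  exact ((TT_continuous m).1.comp (AA_cont' hu hg)).matrix_elem i j

lemma weakdiv_smooth {u g : (Fin n → ℝ) → ℝ} (hu : ContDiff ℝ 3 u) (hg : ContDiff ℝ 1 g)
    {V : Fin n → (Fin n → ℝ) → ℝ} (hV : ∀ j, ContDiff ℝ 1 (V j)) (hVc : ∀ j, HasCompactSupport (V j)) (m : ℕ) :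
    ∫ x, ∑ i, ∑ j, TT (m+1) (AA u g x) i j * pd i (V j) x = ((n:ℝ)-m-1) * ∫ x, ∑ j, ∑ l, TT m (AA u g x) j l * pd l g x * V j x := by
  have hu2 : ContDiff ℝ 2 u := hu.of_le (by norm_num)
  have hA : ∀ a b, ContDiff ℝ 1 (fun y => AA u g y a b) := by
    intro a b; simp only [AA_apply]
    exact (pd_contDiff (pd_contDiff (m := 2) hu (by norm_num)) (by norm_num)).sub (hg.mul contDiff_const)
  have hT : ∀ m i j, ContDiff ℝ 1 fun x => TT m (AA u g x) i j := fun m i j => by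
    rw [← contDiffOn_univ]; exact (TT_contDiff (fun a b => (hA a b).contDiffOn) m).1 i j
  have hpdV : ∀ i j, Continuous (pd i (V j)) := fun i j => (pd_contDiff (m := 0) (hV j) (by norm_num)).continuous
  have hIntg : ∀ (F G : (Fin n → ℝ) → ℝ), Continuous F → Continuous G → HasCompactSupport G → Integrable (fun x => F x * G x) :=
    fun F G hF hG hc => (hF.mul hG).integrable_of_hasCompactSupport hc.mul_left
  have ibp : ∀ i j, ∫ x, TT (m+1) (AA u g x) i j * pd i (V j) x = - ∫ x, pd i (fun y => TT (m+1) (AA u g y) i j) x * V j x := by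
    intro i j
    refine integral_mul_fderiv_eq_neg_fderiv_mul_of_integrable ?_ ?_ ?_ ?_ ?_
    · exact hIntg _ _ ((pd_contDiff (m := 0) (hT (m+1) i j) (by norm_num)).continuous) (hV j).continuous (hVc j)
    · exact hIntg _ _ (hT (m+1) i j).continuous (hpdV i j) (pd_hcs (hVc j))
    · exact hIntg _ _ (hT (m+1) i j).continuous (hV j).continuous (hVc j)
    · exact fun x _ => ((hT (m+1) i j).differentiable one_ne_zero) x
    · exact fun x _ => ((hV j).differentiable one_ne_zero) x
  have i1 : ∀ i j, Integrable fun x => TT (m+1) (AA u g x) i j * pd i (V j) x := fun i j =>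
    hIntg _ _ (hT (m+1) i j).continuous (hpdV i j) (pd_hcs (hVc j))
  have i2 : ∀ i j, Integrable fun x => pd i (fun y => TT (m+1) (AA u g y) i j) x * V j x := fun i j =>
    hIntg _ _ ((pd_contDiff (m := 0) (hT (m+1) i j) (by norm_num)).continuous) (hV j).continuous (hVc j)
  rw [integral_finsetSum _ fun i _ => integrable_finsetSum _ fun j _ => i1 i j]
  simp_rw [integral_finsetSum _ fun j _ => i1 _ j, ibp, Finset.sum_neg_distrib]
  rw [Finset.sum_comm]
  simp_rw [← integral_finsetSum _ fun i _ => i2 i _]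
  rw [← integral_finsetSum _ fun j _ => integrable_finsetSum _ fun i _ => i2 i j, ← integral_neg, ← integral_const_mul]
  congr 1; funext x
  have hdiv := div_TT (A := AA u g) (x := x) (fun a b => ((hA a b).differentiable one_ne_zero) x) (fun y => AA_symm g hu2.contDiffAt)
    (fun i => pd i g x) (by
      intro i l j
      have hd : ∀ a b, DifferentiableAt ℝ (pd a (pd b u)) x := fun a b =>
        ((pd_contDiff (m := 1) (pd_contDiff (m := 2) hu (by norm_num)) (by norm_num)).differentiable one_ne_zero) x
      have hgd : DifferentiableAt ℝ g x := (hg.differentiable one_ne_zero) x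
      simp only [AA_apply]
      rw [pd_sub (hd _ _) (hgd.mul_const _), pd_sub (hd _ _) (hgd.mul_const _), pd_mul hgd (differentiableAt_const _), pd_mul hgd (differentiableAt_const _), pd_const, pd_const]
      have h1 : pd i (pd l (pd j u)) x = pd j (pd i (pd l u)) x := by
        have e : pd l (pd j u) = pd j (pd l u) := by funext y; exact pd_comm hu2.contDiffAt
        rw [e]; exact pd_comm (pd_contDiff (m := 2) hu (by norm_num)).contDiffAt
      rw [h1]; ring) m
  rw [Finset.mul_sum, ← Finset.sum_neg_distrib]
  refine Finset.sum_congr rfl fun j _ => ?_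
  rw [← Finset.sum_mul, hdiv]
  simp only [← Finset.sum_mul]; ring

lemma weakdiv {u g : (Fin n → ℝ) → ℝ} (hu : ContDiff ℝ 2 u) (hg : ContDiff ℝ 1 g) (huc : HasCompactSupport u) (hgc : HasCompactSupport g)
    {V : Fin n → (Fin n → ℝ) → ℝ} (hV : ∀ j, ContDiff ℝ 1 (V j)) (hVc : ∀ j, HasCompactSupport (V j)) (m : ℕ) :
    ∫ x, ∑ i, ∑ j, TT (m+1) (AA u g x) i j * pd i (V j) x = ((n:ℝ)-m-1) * ∫ x, ∑ j, ∑ l, TT m (AA u g x) j l * pd l g x * V j x := by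
  have pu1 : ∀ i, ContDiff ℝ 1 (pd i u) := fun i => pd_contDiff hu (by norm_num)
  have pu2 : ∀ i j, Continuous (pd i (pd j u)) := fun i j => (pd_contDiff (m := 0) (pu1 j) (by norm_num)).continuous
  have pg1 : ∀ i, Continuous (pd i g) := fun i => (pd_contDiff (m := 0) hg (by norm_num)).continuous
  have hpdV : ∀ i j, Continuous (pd i (V j)) := fun i j => (pd_contDiff (m := 0) (hV j) (by norm_num)).continuous
  have bd : ∀ w : (Fin n → ℝ) → ℝ, Continuous w → HasCompactSupport w → ∃ B, ∀ x, |w x| ≤ B := fun w hw hc => by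
    obtain ⟨C, hC⟩ := hc.exists_bound_of_continuous hw; exact ⟨C, hC⟩
  choose B2 hB2 using fun i j => bd _ (pu2 i j) (pd_hcs (pd_hcs huc))
  choose B1 hB1 using fun i => bd _ (pg1 i) (pd_hcs hgc)
  obtain ⟨B0, hB0⟩ := bd _ hg.continuous hgc
  have B2n : ∀ i j, 0 ≤ B2 i j := fun i j => (abs_nonneg _).trans (hB2 i j 0)
  have B1n : ∀ i, 0 ≤ B1 i := fun i => (abs_nonneg _).trans (hB1 i 0)
  have B0n : 0 ≤ B0 := (abs_nonneg _).trans (hB0 0)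
  let dl : ℕ → ℝ := fun k => 1/((k:ℝ)+1)
  have hdl : ∀ k, 0 < dl k := fun k => Nat.one_div_pos_of_nat
  let uk : ℕ → (Fin n → ℝ) → ℝ := fun k => mol (dl k) (hdl k) u
  let gk : ℕ → (Fin n → ℝ) → ℝ := fun k => mol (dl k) (hdl k) g
  have huk : ∀ k, ContDiff ℝ 3 (uk k) := fun k => mol_contDiff (hdl k) hu.continuous 3
  have hgk : ∀ k, ContDiff ℝ 3 (gk k) := fun k => mol_contDiff (hdl k) hg.continuous 3
  have hA : ∀ k x i j, AA (uk k) (gk k) x i j = mol (dl k) (hdl k) (pd i (pd j u)) x - mol (dl k) (hdl k) g x * (1 : Matrix (Fin n) (Fin n) ℝ) i j := by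
    intro k x i j
    rw [AA_apply, pd_mol (hdl k) (hu.of_le (by norm_num)) huc, pd_mol (hdl k) (pu1 j) (pd_hcs huc)]
  have hAt : ∀ x, Tendsto (fun k => AA (uk k) (gk k) x) atTop (𝓝 (AA u g x)) := by
    intro x
    refine tendsto_pi_nhds.2 fun i => tendsto_pi_nhds.2 fun j => ?_
    simp only [hA, AA_apply]
    exact (mol_tendsto (pu2 i j) x).sub ((mol_tendsto hg.continuous x).mul_const _)
  have hTt : ∀ m x i j, Tendsto (fun k => TT m (AA (uk k) (gk k) x) i j) atTop (𝓝 (TT m (AA u g x) i j)) := by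
    intro m x i j
    exact ((((TT_continuous m).1.matrix_elem i j).tendsto _).comp (hAt x))
  set r : ℝ := 3 * (∑ i, ∑ j, B2 i j) + 3 * B0 with hr
  have hr0 : 0 ≤ r := by
    have : 0 ≤ ∑ i, ∑ j, B2 i j := Finset.sum_nonneg fun i _ => Finset.sum_nonneg fun j _ => B2n i j
    positivity
  have hAb : ∀ k x i j, |AA (uk k) (gk k) x i j| ≤ r := by
    intro k x i j
    rw [hA]
    have h1 := mol_bound (hdl k) (pu2 i j) (hB2 i j) x
    have h2 := mol_bound (hdl k) hg.continuous hB0 x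
    have h3 : |mol (dl k) (hdl k) g x * (1 : Matrix (Fin n) (Fin n) ℝ) i j| ≤ |mol (dl k) (hdl k) g x| := by
      rw [Matrix.one_apply]; split_ifs <;> simp
    have h4 := abs_sub (mol (dl k) (hdl k) (pd i (pd j u)) x) (mol (dl k) (hdl k) g x * (1 : Matrix (Fin n) (Fin n) ℝ) i j)
    have h5 : B2 i j ≤ ∑ i, ∑ j, B2 i j :=
      (Finset.single_le_sum (f := fun j => B2 i j) (fun j _ => B2n i j) (Finset.mem_univ j)).trans
      (Finset.single_le_sum (f := fun i => ∑ j, B2 i j) (fun i _ => Finset.sum_nonneg fun j _ => B2n i j) (Finset.mem_univ i))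
    linarith
  have hid := fun k => weakdiv_smooth (huk k) ((hgk k).of_le (by norm_num)) hV hVc m
  obtain ⟨C1, hC1, hb1⟩ := TT_bound n (m+1)
  obtain ⟨C0, hC0, hb0⟩ := TT_bound n m
  have huk2 : ∀ k, ContDiff ℝ 2 (uk k) := fun k => (huk k).of_le (by norm_num)
  have T1 : Tendsto (fun k => ∫ x, ∑ i, ∑ j, TT (m+1) (AA (uk k) (gk k) x) i j * pd i (V j) x) atTop (𝓝 (∫ x, ∑ i, ∑ j, TT (m+1) (AA u g x) i j * pd i (V j) x)) := by
    refine tendsto_integral_of_dominated_convergence (fun x => ∑ i, ∑ j, C1 * r^(m+1) * |pd i (V j) x|) ?_ ?_ ?_ ?_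
    · intro k
      refine Continuous.aestronglyMeasurable ?_
      exact continuous_finsetSum _ fun i _ => continuous_finsetSum _ fun j _ => (TT_AA_cont (huk2 k) (hgk k).continuous _ i j).mul (hpdV i j)
    · refine integrable_finsetSum _ fun i _ => integrable_finsetSum _ fun j _ => ?_
      exact (((hpdV i j).integrable_of_hasCompactSupport (pd_hcs (hVc j))).abs).const_mul _
    · intro k
      refine Eventually.of_forall fun x => ?_
      rw [Real.norm_eq_abs]
      refine (Finset.abs_sum_le_sum_abs _ _).trans (Finset.sum_le_sum fun i _ => (Finset.abs_sum_le_sum_abs _ _).trans (Finset.sum_le_sum fun j _ => ?_))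
      rw [abs_mul]
      exact mul_le_mul_of_nonneg_right ((hb1 _ r hr0 (hAb k x)).1 i j) (abs_nonneg _)
    · refine Eventually.of_forall fun x => ?_
      exact tendsto_finsetSum _ fun i _ => tendsto_finsetSum _ fun j _ => (hTt (m+1) x i j).mul_const _
  have T0 : Tendsto (fun k => ∫ x, ∑ j, ∑ l, TT m (AA (uk k) (gk k) x) j l * pd l (gk k) x * V j x) atTop (𝓝 (∫ x, ∑ j, ∑ l, TT m (AA u g x) j l * pd l g x * V j x)) := by
    refine tendsto_integral_of_dominated_convergence (fun x => ∑ j, ∑ l, C0 * r^m * (3 * B1 l) * |V j x|) ?_ ?_ ?_ ?_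
    · intro k
      refine Continuous.aestronglyMeasurable ?_
      exact continuous_finsetSum _ fun i _ => continuous_finsetSum _ fun j _ => ((TT_AA_cont (huk2 k) (hgk k).continuous _ i j).mul ((pd_contDiff (m := 0) (hgk k) (by norm_num)).continuous)).mul (hV i).continuous
    · refine integrable_finsetSum _ fun i _ => integrable_finsetSum _ fun j _ => ?_
      exact ((((hV i).continuous).integrable_of_hasCompactSupport (hVc i)).abs).const_mul _
    · intro k
      refine Eventually.of_forall fun x => ?_
      rw [Real.norm_eq_abs]
      refine (Finset.abs_sum_le_sum_abs _ _).trans (Finset.sum_le_sum fun i _ => (Finset.abs_sum_le_sum_abs _ _).trans (Finset.sum_le_sum fun j _ => ?_))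
      rw [abs_mul, abs_mul]
      refine mul_le_mul_of_nonneg_right (mul_le_mul ((hb0 _ r hr0 (hAb k x)).1 i j) ?_ (abs_nonneg _) (by positivity)) (abs_nonneg _)
      show |pd j (mol (dl k) (hdl k) g) x| ≤ _
      rw [pd_mol (hdl k) hg hgc]
      exact mol_bound (hdl k) (pg1 j) (hB1 j) x
    · refine Eventually.of_forall fun x => ?_
      refine tendsto_finsetSum _ fun i _ => tendsto_finsetSum _ fun j _ => ((hTt m x i j).mul ?_).mul_const _
      have : ∀ k, pd j (gk k) x = mol (dl k) (hdl k) (pd j g) x := fun k => by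
        show pd j (mol (dl k) (hdl k) g) x = _
        rw [pd_mol (hdl k) hg hgc]
      simp only [this]
      exact mol_tendsto (pg1 j) x
  simp only [hid] at T1
  exact tendsto_nhds_unique T1 (T0.const_mul _)

lemma weakdiv0 {V : Fin n → (Fin n → ℝ) → ℝ} (hV : ∀ j, ContDiff ℝ 1 (V j)) (hVc : ∀ j, HasCompactSupport (V j)) (u g : (Fin n → ℝ) → ℝ) :
    ∫ x, ∑ i, ∑ j, TT 0 (AA u g x) i j * pd i (V j) x = 0 := by
  have : ∀ x, ∑ i, ∑ j, TT 0 (AA u g x) i j * pd i (V j) x = ∑ i, pd i (V i) x := by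
    intro x; simp [TT, Matrix.one_apply]
  simp only [this]
  have hpdV : ∀ i j, Continuous (pd i (V j)) := fun i j => (pd_contDiff (m := 0) (hV j) (by norm_num)).continuous
  rw [integral_finsetSum _ fun i _ => (hpdV i i).integrable_of_hasCompactSupport (pd_hcs (hVc i))]
  refine Finset.sum_eq_zero fun i _ => ?_
  have h := integral_mul_fderiv_eq_neg_fderiv_mul_of_integrable (μ := (volume : Measure (Fin n → ℝ))) (f := fun _ : Fin n → ℝ => (1:ℝ)) (g := V i) (v := Pi.single i 1)
    (by simp) (by simp only [one_mul]; exact (hpdV i i).integrable_of_hasCompactSupport (pd_hcs (hVc i))) (by simpa using (hV i).continuous.integrable_of_hasCompactSupport (hVc i))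
    (fun x _ => differentiableAt_const _) (fun x _ => ((hV i).differentiable one_ne_zero) x)
  simpa [pd] using h
end moll
end IHE

end

noncomputable section
set_option linter.unusedSectionVars false
set_option linter.style.longLine false
set_option linter.unusedSimpArgs false
namespace IHE
section pt
variable {n : ℕ}

lemma bil_bound {M : Matrix (Fin n) (Fin n) ℝ} {B : ℝ} (hM : ∀ i j, |M i j| ≤ B) (a b : Fin n → ℝ) :
    |∑ i, ∑ j, M i j * a i * b j| ≤ B * ((∑ i, |a i|) * ∑ j, |b j|) := by
  rw [Finset.sum_mul_sum, Finset.mul_sum]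
  refine (Finset.abs_sum_le_sum_abs _ _).trans (Finset.sum_le_sum fun i _ => ?_)
  rw [Finset.mul_sum]
  refine (Finset.abs_sum_le_sum_abs _ _).trans (Finset.sum_le_sum fun j _ => ?_)
  rw [abs_mul, abs_mul, mul_assoc]
  exact mul_le_mul_of_nonneg_right (hM i j) (by positivity)

lemma sum_abs_sq (a : Fin n → ℝ) : (∑ i, |a i|)^2 ≤ n * ∑ i, a i ^2 := by
  have := sq_sum_le_card_mul_sum_sq (s := Finset.univ) (f := fun i => |a i|)
  simpa using this

lemma sum_abs_const {a : Fin n → ℝ} {B : ℝ} (h : ∀ i, |a i| ≤ B) : ∑ i, |a i| ≤ n * B := by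
  calc ∑ i, |a i| ≤ ∑ i : Fin n, B := Finset.sum_le_sum fun i _ => h i
    _ = _ := by simp

lemma psd_cs {T : Matrix (Fin n) (Fin n) ℝ} (hs : Tᵀ = T) (hpsd : ∀ v : Fin n → ℝ, 0 ≤ ∑ i, ∑ j, T i j * v i * v j) (a b : Fin n → ℝ) :
    -(1/4 * ∑ i, ∑ j, T i j * a i * a j + 4 * ∑ i, ∑ j, T i j * b i * b j) ≤ 2 * ∑ i, ∑ j, T i j * a i * b j := by
  have h := hpsd (fun i => a i / 2 + 2 * b i)
  have hsym : ∑ i, ∑ j, T i j * b i * a j = ∑ i, ∑ j, T i j * a i * b j := by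
    rw [Finset.sum_comm]
    refine Finset.sum_congr rfl fun i _ => Finset.sum_congr rfl fun j _ => ?_
    have : T j i = T i j := by conv_lhs => rw [← hs, transpose_apply]
    rw [this]; ring
  have e : ∑ i, ∑ j, T i j * (a i / 2 + 2 * b i) * (a j / 2 + 2 * b j) =
      1/4 * (∑ i, ∑ j, T i j * a i * a j) + (∑ i, ∑ j, T i j * b i * a j) + (∑ i, ∑ j, T i j * a i * b j) + 4 * ∑ i, ∑ j, T i j * b i * b j := by
    simp only [Finset.mul_sum, ← Finset.sum_add_distrib]
    refine Finset.sum_congr rfl fun i _ => Finset.sum_congr rfl fun j _ => ?_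
    ring
  rw [e, hsym] at h
  linarith

set_option maxHeartbeats 2000000 in
lemma scalar_pt (nn L : ℝ) (hnn : 1 ≤ nn) (hL : 1 ≤ L) : ∃ C, 0 ≤ C ∧ ∀ (κ : ℕ) (N N2 G w W q η ε D Z S E F TH GD K1 K2 K3 Y1 Yx P Qe Qp Se: ℝ),
    1 ≤ W → w ≤ 2*W → W ≤ 2*w → 1 ≤ q → 0 ≤ N → N ≤ L → 0 ≤ N2 → N2 ≤ L → |G| ≤ L → 0 ≤ D → 0 ≤ Z → 0 ≤ S → 0 ≤ ε → 
    S^2 ≤ nn * D → Se^2 ≤ nn * Z → 0 ≤ Se →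
    2*G*N*P - N*Yx - L*S - L*W^(κ+2) ≤ TH - N * GD →
    -(1/4 * (η^2*E) + 4 * (w^2*Qe)) ≤ 2 * (η*w*F) →
    -(1/4 * E + 4 * ((G*N*w)^2*Qp)) ≤ 2*(G*N*w*P) → 
    D/(L*W) ≤ E → Qe ≤ nn*L*W^(κ+1)*Z → Qp ≤ nn*L*W^(κ+1)*(nn*L^2) → 
    |K1| ≤ nn^2*L^2*W^(κ+1) → |Y1 - Yx| ≤ nn*L^2*ε*W^κ*S → |K2| ≤ nn*L^2*W^κ*Se → |K3| ≤ nn^2*L^3*W^(κ+1) → 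
    3/(16*L)/w^2*η^2*D - C*W^(κ+2)*(η^2+Z) - C*ε*η^2*W^κ*S ≤ 
      (q/w)*η^2*E + 2*η*F+η^2*TH - N*η^2*GD + N*(w*η^2/(q+1)*K1 + η^2*Y1+2*w*η/(q+1)*K2 - N2*(w*η^2/(q+1)*K3)) := by
  refine ⟨8*nn*L + 8*L^4*(nn^2*L^3) + 4*nn*L^3 + L + L*(2*nn^2*L^2) + L*(2*nn*L^2)*(nn+1) + L^2*(2*nn^2*L^3) + nn*L^3, by positivity, ?_⟩
  intro κ N N2 G w W q η ε D Z S E F TH GD K1 K2 K3 Y1 Yx P Qe Qp Se hW hw1 hw2 hq hN hNL hN2 hN2L hG hD hZ hS hε hSD hSe hSe0 hstar hF hP hE hQe hQp hK1 hY hK2 hK3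
  have hw : 0 < w := by linarith
  have hW0 : 0 < W := by linarith
  have hL0 : 0 < L := by linarith
  obtain ⟨a, ha⟩ : ∃ a, a = W^(κ+2) := ⟨_, rfl⟩
  rw [← ha] at hstar ⊢
  have ha1 : W^(κ+1)*w ≤ 2*a := by rw [ha, pow_succ W (κ+1)]; nlinarith [pow_pos hW0 (κ+1)]
  have hWa : W*w ≤ 2*a := by
    have : W^2 ≤ a := by rw [ha]; exact pow_le_pow_right₀ hW (by omega)
    nlinarith
  have haκ : W^κ*w ≤ 2*a := by
    have : W^κ ≤ W^(κ+1) := pow_le_pow_right₀ hW (by omega)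
    nlinarith
  have ha0 : 0 < a := by rw [ha]; positivity
  have hE0 : 0 ≤ E := le_trans (by positivity) hE
  have hη : 0 ≤ η^2 := sq_nonneg _
  have hq1 : 0 < q + 1 := by linarith
  have hq2 : 1/(q+1) ≤ 1 := by rw [div_le_one hq1]; linarith
  have hq3 : 0 < 1/(q+1) := by positivity
  -- (b)
  have hb : -(1/4*(η^2*E)/w) - 8*nn*L*a*Z ≤ 2*η*F := by
    have e : 2*η*F = 2*(η*w*F)/w := by field_simp
    have h1 : w*Qe ≤ nn*L*(2*a)*Z := by
      calc w*Qe ≤ w*(nn*L*W^(κ+1)*Z) := mul_le_mul_of_nonneg_left hQe hw.le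
        _ = nn*L*(W^(κ+1)*w)*Z := by ring
        _ ≤ _ := by gcongr
    have h2 : -(1/4 * (η^2*E) + 4 * (w^2*Qe))/w = -(1/4*(η^2*E)/w) - 4*(w*Qe) := by field_simp; ring
    have h3 := div_le_div_of_nonneg_right hF hw.le
    rw [h2] at h3; rw [e]; linarith
  -- (c)
  have hc : -(1/4*E/w) - 8*L^4*(nn^2*L^3)*a ≤ 2*G*N*P := by
    have e : 2*G*N*P = 2*(G*N*w*P)/w := by field_simp
    have hGN : (G*N)^2 ≤ L^4 := by
      have : |G*N| ≤ L*L := by rw [abs_mul, abs_of_nonneg hN]; exact mul_le_mul hG hNL hN hL0.le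
      calc (G*N)^2 = |G*N|^2 := (sq_abs _).symm
        _ ≤ (L*L)^2 := pow_le_pow_left₀ (abs_nonneg _) this 2
        _ = L^4 := by ring
    have h1 : (G*N)^2*(w*Qp) ≤ L^4*((nn^2*L^3)*(2*a)) := by
      calc (G*N)^2*(w*Qp) ≤ (G*N)^2*(w*(nn*L*W^(κ+1)*(nn*L^2))) := by gcongr
        _ = (G*N)^2*((nn^2*L^3)*(W^(κ+1)*w)) := by ring
        _ ≤ _ := by gcongr
    have h2 : -(1/4 * E + 4 * ((G*N*w)^2*Qp))/w = -(1/4*E/w) - 4*((G*N)^2*(w*Qp)) := by field_simp; ring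
    have h3 := div_le_div_of_nonneg_right hP hw.le
    rw [h2] at h3; rw [e]; linarith
  -- (d)
  have hd : L*S ≤ D/(8*L*W*w) + 4*nn*L^3*a := by
    have hx : S ≤ S^2/(8*nn*L^2*(W*w)) + 2*nn*L^2*(W*w) := by
      have hp : 0 < 8*nn*L^2*(W*w) := by positivity
      have : S^2/(8*nn*L^2*(W*w)) + 2*nn*L^2*(W*w) - S = (S - 4*nn*L^2*(W*w))^2/(8*nn*L^2*(W*w)) := by field_simp; ring
      have h2 : 0 ≤ (S - 4*nn*L^2*(W*w))^2/(8*nn*L^2*(W*w)) := by positivity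
      linarith
    have hy : S^2/(8*nn*L^2*(W*w)) ≤ D/(8*L^2*(W*w)) := by
      rw [div_le_div_iff₀ (by positivity) (by positivity)]
      have := mul_le_mul_of_nonneg_right hSD (show 0 ≤ 8*L^2*(W*w) by positivity)
      linarith
    calc L*S ≤ L*(D/(8*L^2*(W*w)) + 2*nn*L^2*(W*w)) := by gcongr; linarith
      _ = D/(8*L*W*w) + 2*nn*L^3*(W*w) := by field_simp
      _ ≤ D/(8*L*W*w) + 2*nn*L^3*(2*a) := by gcongr
      _ = _ := by ring
  -- K terms
  have k1 : -(L*(2*nn^2*L^2)*a) * η^2 ≤ N*(w*η^2/(q+1)*K1) := by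
    have h1 : |N*(w*(1/(q+1))*K1)| ≤ L*(2*nn^2*L^2)*a := by
      rw [abs_mul, abs_mul, abs_mul, abs_of_nonneg hN, abs_of_pos hw, abs_of_pos hq3]
      calc N*(w*(1/(q+1)) * |K1|) ≤ L*(w*1*(nn^2*L^2*W^(κ+1))) := by gcongr
        _ = L*(nn^2*L^2)*(W^(κ+1)*w) := by ring
        _ ≤ L*(nn^2*L^2)*(2*a) := by gcongr
        _ = _ := by ring
    have h2 := (abs_le.1 h1).1
    calc -(L*(2*nn^2*L^2)*a) * η^2 ≤ N*(w*(1/(q+1))*K1) * η^2 := by gcongr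
      _ = _ := by ring
  have k3 : -(L^2*(2*nn^2*L^3)*a) * η^2 ≤ -(N*(N2*(w*η^2/(q+1)*K3))) := by
    have h1 : |N*(N2*(w*(1/(q+1))*K3))| ≤ L^2*(2*nn^2*L^3)*a := by
      rw [abs_mul, abs_mul, abs_mul, abs_mul, abs_of_nonneg hN, abs_of_nonneg hN2, abs_of_pos hw, abs_of_pos hq3]
      calc N*(N2*(w*(1/(q+1)) * |K3|)) ≤ L*(L*(w*1*(nn^2*L^3*W^(κ+1)))) := by gcongr
        _ = L^2*(nn^2*L^3)*(W^(κ+1)*w) := by ring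
        _ ≤ L^2*(nn^2*L^3)*(2*a) := by gcongr
        _ = _ := by ring
    have h2 := (abs_le.1 h1).2
    calc -(L^2*(2*nn^2*L^3)*a) * η^2 = -((L^2*(2*nn^2*L^3)*a) * η^2) := by ring
      _ ≤ -((N*(N2*(w*(1/(q+1))*K3))) * η^2) := neg_le_neg (by gcongr)
      _ = _ := by ring
  have k2 : -(L*(2*nn*L^2)*(nn+1)*a*(η^2+Z)) ≤ N*(2*w*η/(q+1)*K2) := by
    have h0 : 2*|η| * Se ≤ (nn+1)*(η^2+Z) := by
      have : 2*|η| *Se ≤ η^2 + Se^2 := by nlinarith [sq_nonneg (|η| - Se), sq_abs η]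
      nlinarith
    have h1 : |N*(2*w*η/(q+1)*K2)| ≤ L*(2*nn*L^2)*(nn+1)*a*(η^2+Z) := by
      have : N*(2*w*η/(q+1)*K2) = N*(2*w*η*(1/(q+1))*K2) := by ring
      rw [this, abs_mul, abs_mul, abs_mul, abs_mul, abs_mul, abs_of_nonneg hN, abs_of_pos hw, abs_of_pos hq3, abs_two]
      calc N*(2*w*|η| *(1/(q+1)) * |K2|) ≤ L*(2*w*|η| *1*(nn*L^2*W^κ*Se)) := by gcongr
        _ = L*(nn*L^2)*(W^κ*w)*(2*|η| *Se) := by ring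
        _ ≤ L*(nn*L^2)*(2*a)*((nn+1)*(η^2+Z)) := by gcongr
        _ = _ := by ring
    exact (abs_le.1 h1).1
  have ky : -(nn*L^3*ε*η^2*W^κ*S) ≤ N*(η^2*Y1) - η^2*(N*Yx) := by
    have h1 := (abs_le.1 hY).1
    have h2 : -(L*(nn*L^2*ε*W^κ*S)) ≤ N*(Y1-Yx) := by
      have h3 : N*(-(nn*L^2*ε*W^κ*S)) ≤ N*(Y1-Yx) := by gcongr
      have h4 : N*(nn*L^2*ε*W^κ*S) ≤ L*(nn*L^2*ε*W^κ*S) := by gcongr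
      linarith
    calc -(nn*L^3*ε*η^2*W^κ*S) = η^2 * (-(L*(nn*L^2*ε*W^κ*S))) := by ring
      _ ≤ η^2*(N*(Y1-Yx)) := by gcongr
      _ = _ := by ring
  -- main
  have hEq : (1/w)*η^2*E ≤ (q/w)*η^2*E := by gcongr
  have hEE : 3/(16*L)/w^2*η^2*D ≤ η^2*(1/2*E/w - D/(8*L*W*w)) := by
    have h1 : 1/2*(D/(L*W))/w ≤ 1/2*E/w := by gcongr
    have h2 : 3/(16*L)/w^2*D ≤ 3/8*D/(L*W*w) := by
      have e1 : 3/(16*L)/w^2*D = 3*D/(16*L*w^2) := by field_simp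
      have e2 : 3/8*D/(L*W*w) = 3*D/(8*L*W*w) := by field_simp
      rw [e1, e2]
      apply div_le_div_of_nonneg_left (by positivity) (by positivity)
      calc 8*L*W*w = (8*L*w)*W := by ring
        _ ≤ (8*L*w)*(2*w) := by gcongr
        _ = _ := by ring
    have h3 : 1/2*(D/(L*W))/w - D/(8*L*W*w) = 3/8*D/(L*W*w) := by field_simp; ring
    calc 3/(16*L)/w^2*η^2*D = η^2 * (3/(16*L)/w^2*D) := by ring
      _ ≤ _ := by gcongr; linarith
  have hst := mul_le_mul_of_nonneg_left hstar hη
  have hc' := mul_le_mul_of_nonneg_left hc hη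
  have hd' := mul_le_mul_of_nonneg_left hd hη
  -- drop products
  have z1 : 0 ≤ 8*nn*L*(a*η^2) := by positivity
  have z2 : 0 ≤ (8*L^4*(nn^2*L^3) + 4*nn*L^3 + L + L*(2*nn^2*L^2) + L^2*(2*nn^2*L^3) + nn*L^3)*(a*Z) := by positivity
  have z3 : 0 ≤ nn*L^3*(a*η^2) := by positivity
  have z4 : 0 ≤ (8*nn*L + 8*L^4*(nn^2*L^3) + 4*nn*L^3 + L + L*(2*nn^2*L^2) + L*(2*nn*L^2)*(nn+1) + L^2*(2*nn^2*L^3))*(ε*η^2*W^κ*S) := by positivity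
  have i1 : 1/w*η^2*E = η^2*(1/4*E/w) + (1/4*(η^2*E)/w) + η^2*(1/2*E/w) := by field_simp; ring
  linarith
end pt
end IHE

end

noncomputable section
set_option linter.unusedSectionVars false
set_option linter.style.longLine false
set_option linter.unusedSimpArgs false
namespace IHE
section pt2
variable {n : ℕ}

lemma pt_sym {T : Matrix (Fin n) (Fin n) ℝ} (hs : Tᵀ = T) (i j : Fin n) : T j i = T i j := by
  conv_lhs => rw [← hs, transpose_apply]

set_option maxHeartbeats 1000000 in
lemma pt (hn : 1 ≤ n) (L : ℝ) (hL : 1 ≤ L) (hLn : (n:ℝ) ≤ L) : ∃ C, 0 ≤ C ∧ ∀ (κ : ℕ) (T T1 T2 A XD H V1d V2d : Matrix (Fin n) (Fin n) ℝ)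
    (σ N N2 G w W q η ε ω : ℝ) (p dw de gd X Y V1 V2 : Fin n → ℝ),
    1 ≤ W → w ≤ 2*W → W ≤ 2*w → 1 ≤ q → 0 ≤ N → N ≤ L → 0 ≤ N2 → N2 ≤ L → |G| ≤ L → 0 ≤ ε → 0 < ω →
    Tᵀ = T → T = σ • (1 : Matrix (Fin n) (Fin n) ℝ) - T1 * A →
    (∀ i j, |T i j| ≤ L * W^(κ+1)) → (∀ i j, |T1 i j| ≤ L * W^κ) → (∀ i j, |T2 i j| ≤ L * W^κ) →
    (∀ i, |p i| ≤ L) → (∀ i, |Y i| ≤ L) → (∀ i j, |XD i j| ≤ L*W) → (∀ i, |gd i| ≤ L*W) → (∀ i, |Y i - X i| ≤ L*ε) →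
    (∀ l, gd l = 2*G*∑ m, A l m * p m + X l) →
    (∀ v : Fin n → ℝ, (∑ i, v i^2)/(L*W) ≤ ∑ i, ∑ j, T i j * v i * v j) →
    (2*G*(N*σ)*(∑ m, p m * dw m) - L*(∑ m, |dw m|) - L*W^(κ+2) ≤ ∑ i, ∑ j, T i j * H i j) →
    (∀ i j, V1d i j = (q*ω/w*dw i*η^2 + 2*ω*η*de i)*dw j + ω*η^2*H i j) →
    (∀ j, V1 j = ω*η^2*dw j) →
    (∀ i j, V2d i j = (XD i j*(ω*w*η^2)+(q+1)*Y j*ω*dw i*η^2+2*Y j*ω*w*η*de i)/(q+1)) →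
    (∀ j, V2 j = Y j*(ω*w*η^2)/(q+1)) →
    3/(16*L)*(ω/w^2)*η^2*(∑ m, dw m^2) - C*(W^(κ+2)*ω*(η^2+∑ m, de m^2)) - C*ε*(ω*η^2*W^κ*∑ m, |dw m|) ≤
      (∑ i, ∑ j, T i j * V1d i j - N * ∑ j, ∑ l, T1 j l * gd l * V1 j) +
      N * (∑ i, ∑ j, T1 i j * V2d i j - N2 * ∑ j, ∑ l, T2 j l * gd l * V2 j) := by
  have hn1 : (1:ℝ) ≤ n := by exact_mod_cast hn
  obtain ⟨C, hC, H0⟩ := scalar_pt (n:ℝ) L hn1 hL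
  refine ⟨C, hC, ?_⟩
  intro κ T T1 T2 A XD H V1d V2d σ N N2 G w W q η ε ω p dw de gd X Y V1 V2 hW hw1 hw2 hq hN hNL hN2 hN2L hG hε hω hTs hT hTb hT1b hT2b hp hY hXD hgd hYX hgdX hell hstar hV1d hV1 hV2d hV2
  have hw : 0 < w := by linarith
  have hW0 : 0 < W := by linarith
  have hL0 : 0 < L := by linarith
  have hpsd : ∀ v : Fin n → ℝ, 0 ≤ ∑ i, ∑ j, T i j * v i * v j := fun v => le_trans (by positivity) (hell v)
  have hGD : ∑ j, ∑ l, T1 j l * gd l * dw j = 2*G*(σ*(∑ m, p m * dw m) - ∑ i, ∑ j, T i j * dw i * p j) + ∑ j, ∑ l, T1 j l * X l * dw j := by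
    have e1 : ∀ j, ∑ m, T j m * dw j * p m = σ * (p j * dw j) - ∑ l, ∑ m, T1 j l * A l m * p m * dw j := by
      intro j
      have : ∀ m, T j m * dw j * p m = (if j = m then σ * (p m * dw j) else 0) - ∑ l, T1 j l * A l m * p m * dw j := by
        intro m
        rw [hT, Matrix.sub_apply, Matrix.smul_apply, one_apply, mul_apply, sub_mul, sub_mul, Finset.sum_mul, Finset.sum_mul]
        congr 1
        · split_ifs <;> simp; ring
        · exact Finset.sum_congr rfl fun l _ => by ring
      simp_rw [this]
      rw [Finset.sum_sub_distrib, Finset.sum_comm (γ := Fin n)]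
      simp
    simp_rw [e1]
    rw [Finset.sum_sub_distrib, ← Finset.mul_sum, sub_sub_cancel]
    rw [Finset.mul_sum, ← Finset.sum_add_distrib]
    refine Finset.sum_congr rfl fun j _ => ?_
    rw [Finset.mul_sum, ← Finset.sum_add_distrib]
    refine Finset.sum_congr rfl fun l _ => ?_
    rw [hgdX l, mul_add, add_mul, Finset.mul_sum, Finset.mul_sum, Finset.mul_sum, Finset.sum_mul]
    congr 1
    exact Finset.sum_congr rfl fun m _ => by ring
  have key := H0 κ N N2 G w W q η ε (∑ m, dw m^2) (∑ m, de m^2) (∑ m, |dw m|)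
    (∑ i, ∑ j, T i j * dw i * dw j) (∑ i, ∑ j, T i j * de i * dw j) (∑ i, ∑ j, T i j * H i j)
    (∑ j, ∑ l, T1 j l * gd l * dw j) (∑ i, ∑ j, T1 i j * XD i j) (∑ i, ∑ j, T1 i j * de i * Y j)
    (∑ j, ∑ l, T2 j l * Y j * gd l) (∑ i, ∑ j, T1 i j * dw i * Y j) (∑ j, ∑ l, T1 j l * X l * dw j)
    (∑ i, ∑ j, T i j * dw i * p j) (∑ i, ∑ j, T i j * de i * de j) (∑ i, ∑ j, T i j * p i * p j) (∑ m, |de m|)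
    hW hw1 hw2 hq hN hNL hN2 hN2L hG (by positivity) (by positivity) (by positivity) hε (sum_abs_sq _) (sum_abs_sq _) (by positivity)
    (by rw [hGD]; linarith)
    (by
      have h := psd_cs hTs hpsd (fun i => η * dw i) (fun i => w * de i)
      have e1 : ∑ i, ∑ j, T i j * (η * dw i) * (η * dw j) = η^2 * ∑ i, ∑ j, T i j * dw i * dw j := by
        simp only [Finset.mul_sum]; exact Finset.sum_congr rfl fun i _ => Finset.sum_congr rfl fun j _ => by ring
      have e2 : ∑ i, ∑ j, T i j * (w * de i) * (w * de j) = w^2 * ∑ i, ∑ j, T i j * de i * de j := by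
        simp only [Finset.mul_sum]; exact Finset.sum_congr rfl fun i _ => Finset.sum_congr rfl fun j _ => by ring
      have e3 : ∑ i, ∑ j, T i j * (η * dw i) * (w * de j) = η*w * ∑ i, ∑ j, T i j * de i * dw j := by
        rw [Finset.sum_comm]
        simp only [Finset.mul_sum]; exact Finset.sum_congr rfl fun i _ => Finset.sum_congr rfl fun j _ => by
          rw [pt_sym hTs i j]; ring
      rw [e1, e2, e3] at h; exact h)
    (by
      have h := psd_cs hTs hpsd (fun i => dw i) (fun i => (G*N*w) * p i)
      have e2 : ∑ i, ∑ j, T i j * ((G*N*w) * p i) * ((G*N*w) * p j) = (G*N*w)^2 * ∑ i, ∑ j, T i j * p i * p j := by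
        simp only [Finset.mul_sum]; exact Finset.sum_congr rfl fun i _ => Finset.sum_congr rfl fun j _ => by ring
      have e3 : ∑ i, ∑ j, T i j * (dw i) * ((G*N*w) * p j) = G*N*w * ∑ i, ∑ j, T i j * dw i * p j := by
        simp only [Finset.mul_sum]; exact Finset.sum_congr rfl fun i _ => Finset.sum_congr rfl fun j _ => by ring
      rw [e2, e3] at h; exact h)
    (hell dw)
    (by
      have h := (le_abs_self _).trans (bil_bound hTb de de)
      have h2 := sum_abs_sq de
      calc _ ≤ _ := h
        _ = L * W^(κ+1) * (∑ i, |de i|)^2 := by ring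
        _ ≤ L * W^(κ+1) * (n * ∑ i, de i^2) := by gcongr
        _ = _ := by ring)
    (by
      have h := (le_abs_self _).trans (bil_bound hTb p p)
      have h2 := sum_abs_const hp
      calc _ ≤ _ := h
        _ ≤ L * W^(κ+1) * ((n*L)*(n*L)) := by gcongr
        _ = _ := by ring)
    (by
      refine (Finset.abs_sum_le_sum_abs _ _).trans ?_
      calc _ ≤ ∑ i : Fin n, ∑ j : Fin n, (L*W^κ)*(L*W) := by
            refine Finset.sum_le_sum fun i _ => (Finset.abs_sum_le_sum_abs _ _).trans (Finset.sum_le_sum fun j _ => ?_)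
            rw [abs_mul]; exact mul_le_mul (hT1b i j) (hXD i j) (abs_nonneg _) (by positivity)
        _ = _ := by simp; ring)
    (by
      have e : ∑ i, ∑ j, T1 i j * dw i * Y j - ∑ j, ∑ l, T1 j l * X l * dw j = ∑ i, ∑ j, T1 i j * dw i * (Y j - X j) := by
        rw [← Finset.sum_sub_distrib]
        refine Finset.sum_congr rfl fun i _ => ?_
        rw [← Finset.sum_sub_distrib]
        refine Finset.sum_congr rfl fun j _ => by ring
      rw [e]
      have h := bil_bound hT1b dw (fun j => Y j - X j)
      have h2 := sum_abs_const hYX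
      calc _ ≤ _ := h
        _ ≤ L * W^κ * ((∑ i, |dw i|)*(n*(L*ε))) := by gcongr
        _ = _ := by ring)
    (by
      have h := bil_bound hT1b de Y
      have h2 := sum_abs_const hY
      calc _ ≤ _ := h
        _ ≤ L * W^κ * ((∑ i, |de i|)*(n*L)) := by gcongr
        _ = _ := by ring)
    (by
      have h := bil_bound hT2b Y gd
      have h2 := sum_abs_const hY
      have h3 := sum_abs_const hgd
      calc _ ≤ _ := h
        _ ≤ L * W^κ * ((n*L)*(n*(L*W))) := by gcongr
        _ = _ := by ring)
  have fin := mul_le_mul_of_nonneg_left key hω.le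
  have E1 : ∑ i, ∑ j, T i j * V1d i j = ω * ((q/w)*η^2*(∑ i, ∑ j, T i j * dw i * dw j)) + ω*(2*η*(∑ i, ∑ j, T i j * de i * dw j)) + ω*(η^2*∑ i, ∑ j, T i j * H i j) := by
    simp only [Finset.mul_sum, ← Finset.sum_add_distrib]
    refine Finset.sum_congr rfl fun i _ => Finset.sum_congr rfl fun j _ => ?_
    rw [hV1d]; ring
  have E2 : ∑ j, ∑ l, T1 j l * gd l * V1 j = ω*η^2* ∑ j, ∑ l, T1 j l * gd l * dw j := by
    simp only [Finset.mul_sum]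
    refine Finset.sum_congr rfl fun i _ => Finset.sum_congr rfl fun j _ => ?_
    rw [hV1]; ring
  have hq1 : q + 1 ≠ 0 := by linarith
  have E3 : ∑ i, ∑ j, T1 i j * V2d i j = ω*(w*η^2/(q+1)*(∑ i, ∑ j, T1 i j * XD i j)) + ω*(η^2*(∑ i, ∑ j, T1 i j * dw i * Y j)) + ω*(2*w*η/(q+1)*∑ i, ∑ j, T1 i j * de i * Y j) := by
    simp only [Finset.mul_sum, ← Finset.sum_add_distrib]
    refine Finset.sum_congr rfl fun i _ => Finset.sum_congr rfl fun j _ => ?_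
    rw [hV2d]; field_simp
  have E4 : ∑ j, ∑ l, T2 j l * gd l * V2 j = ω*(w*η^2/(q+1)* ∑ j, ∑ l, T2 j l * Y j * gd l) := by
    simp only [Finset.mul_sum]
    refine Finset.sum_congr rfl fun i _ => Finset.sum_congr rfl fun j _ => ?_
    rw [hV2]; ring
  rw [E1, E2, E3, E4]
  calc _ = _ := ?_
    _ ≤ _ := fin
    _ = _ := ?_
  · ring
  · ring
end pt2
end IHE

end

noncomputable section
set_option linter.unusedSectionVars false
set_option linter.style.longLine false
set_option linter.unusedSimpArgs false
namespace IHE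
section en
variable {n : ℕ}

def gg (G u : (Fin n → ℝ) → ℝ) (x : Fin n → ℝ) : ℝ := G x * normSq (grad u x)

def YY (G u Γ : (Fin n → ℝ) → ℝ) (j : Fin n) (x : Fin n → ℝ) : ℝ := 2*G x*gg G u x*pd j u x + normSq (grad u x)*pd j Γ x

lemma nsq_cd {u : (Fin n → ℝ) → ℝ} (hu : ContDiff ℝ 2 u) : ContDiff ℝ 1 (fun x => normSq (grad u x)) := by
  unfold normSq grad
  exact ContDiff.sum fun i _ => (pd_contDiff (m := 1) hu (by norm_num)).pow 2

lemma pd_nsq {u : (Fin n → ℝ) → ℝ} (hu : ContDiff ℝ 2 u) (i : Fin n) (x : Fin n → ℝ) :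
    pd i (fun x => normSq (grad u x)) x = 2 * ∑ m, pd m u x * pd i (pd m u) x := by
  unfold normSq grad
  have hd : ∀ m, DifferentiableAt ℝ (pd m u) x := fun m => (pd_contDiff (m := 1) hu (by norm_num)).differentiable one_ne_zero x
  rw [pd_sum _ (fun m _ => (hd m).fun_pow 2), Finset.mul_sum]
  refine Finset.sum_congr rfl fun m _ => ?_
  have : (fun y => pd m u y ^ 2) = fun y => pd m u y * pd m u y := by funext y; ring
  rw [this, pd_mul (hd m) (hd m)]; ring

lemma gg_cd {G u : (Fin n → ℝ) → ℝ} (hG : ContDiff ℝ 1 G) (hu : ContDiff ℝ 2 u) : ContDiff ℝ 1 (gg G u) := hG.mul (nsq_cd hu)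

lemma pd_gg {G u : (Fin n → ℝ) → ℝ} (hG : ContDiff ℝ 1 G) (hu : ContDiff ℝ 2 u) (i : Fin n) (x : Fin n → ℝ) :
    pd i (gg G u) x = pd i G x * normSq (grad u x) + G x * (2 * ∑ m, pd m u x * pd i (pd m u) x) := by
  unfold gg
  rw [pd_mul (hG.differentiable one_ne_zero x) ((nsq_cd hu).differentiable one_ne_zero x), pd_nsq hu]

lemma pd_gg' {G u : (Fin n → ℝ) → ℝ} (hG : ContDiff ℝ 1 G) (hu : ContDiff ℝ 2 u) (l : Fin n) (x : Fin n → ℝ) :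
    pd l (gg G u) x = 2*G x*∑ m, AA u (gg G u) x l m * pd m u x + YY G u G l x := by
  rw [pd_gg hG hu]
  have : ∑ m, AA u (gg G u) x l m * pd m u x = (∑ m, pd m u x * pd l (pd m u) x) - gg G u x * pd l u x := by
    simp only [AA_apply, sub_mul, Finset.sum_sub_distrib]
    congr 1
    · exact Finset.sum_congr rfl fun m _ => by ring
    · simp [Matrix.one_apply]
  rw [this]; unfold YY; ring

lemma YY_cd {G u Γ : (Fin n → ℝ) → ℝ} (hG : ContDiff ℝ 1 G) (hu : ContDiff ℝ 2 u) (hΓ : ContDiff ℝ 2 Γ) (j : Fin n) : ContDiff ℝ 1 (YY G u Γ j) := by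
  unfold YY
  exact (((contDiff_const.mul hG).mul (gg_cd hG hu)).mul (pd_contDiff hu (by norm_num))).add ((nsq_cd hu).mul (pd_contDiff hΓ (by norm_num)))

lemma pd_YY {G u Γ : (Fin n → ℝ) → ℝ} (hG : ContDiff ℝ 1 G) (hu : ContDiff ℝ 2 u) (hΓ : ContDiff ℝ 2 Γ) (i j : Fin n) (x : Fin n → ℝ) :
    pd i (YY G u Γ j) x = 2 * pd i G x * gg G u x * pd j u x + 2 * G x * pd i (gg G u) x * pd j u x + 2 * G x * gg G u x * pd i (pd j u) x
      + (2 * ∑ m, pd m u x * pd i (pd m u) x) * pd j Γ x + normSq (grad u x) * pd i (pd j Γ) x := by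
  have dG := hG.differentiable one_ne_zero x
  have dg := (gg_cd hG hu).differentiable one_ne_zero x
  have dp := (pd_contDiff (i := j) (m := 1) hu (by norm_num)).differentiable one_ne_zero x
  have dΓ := (pd_contDiff (i := j) (m := 1) hΓ (by norm_num)).differentiable one_ne_zero x
  have dn := (nsq_cd hu).differentiable one_ne_zero x
  unfold YY
  rw [pd_add ((((dG.const_mul 2)).fun_mul dg).fun_mul dp) (dn.fun_mul dΓ), pd_mul (((dG.const_mul 2)).fun_mul dg) dp, pd_mul (dG.const_mul 2) dg,
    pd_const_mul 2 dG, pd_mul dn dΓ, pd_nsq hu]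
  ring

lemma nsq_bound {p : Fin n → ℝ} {Λ : ℝ} (h : ∀ i, |p i| ≤ Λ) : |normSq p| ≤ n * Λ^2 := by
  unfold normSq
  rw [abs_of_nonneg (by positivity)]
  calc ∑ i, p i^2 ≤ ∑ i : Fin n, Λ^2 := Finset.sum_le_sum fun i _ => by
        rw [← sq_abs]; exact pow_le_pow_left₀ (abs_nonneg _) (h i) 2
    _ = _ := by simp

lemma dot_bound {p b : Fin n → ℝ} {Λ B : ℝ} (hΛ : 0 ≤ Λ) (h : ∀ i, |p i| ≤ Λ) (hb : ∀ i, |b i| ≤ B) : |∑ m, p m * b m| ≤ n * (Λ * B) := by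
  refine (Finset.abs_sum_le_sum_abs _ _).trans ?_
  calc ∑ i, |p i * b i| ≤ ∑ i : Fin n, Λ*B := Finset.sum_le_sum fun i _ => by
        rw [abs_mul]; exact mul_le_mul (h i) (hb i) (abs_nonneg _) hΛ
    _ = _ := by simp

lemma amul {a b A B : ℝ} (ha : |a| ≤ A) (hb : |b| ≤ B) : |a*b| ≤ A*B := by
  rw [abs_mul]; exact mul_le_mul ha hb (abs_nonneg _) ((abs_nonneg _).trans ha)

lemma aadd {a b A B : ℝ} (ha : |a| ≤ A) (hb : |b| ≤ B) : |a+b| ≤ A+B := (abs_add_le _ _).trans (add_le_add ha hb)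

lemma a2 : |(2:ℝ)| ≤ 2 := by norm_num

lemma bounds (n : ℕ) (Λ : ℝ) (hΛ : 1 ≤ Λ) : ∃ L, 1 ≤ L ∧ ∀ (G u Γ : (Fin n → ℝ) → ℝ), ContDiff ℝ 1 G → ContDiff ℝ 2 u → ContDiff ℝ 2 Γ →
    ∀ (x : Fin n → ℝ) (W ε : ℝ), 1 ≤ W → 0 ≤ ε → ε ≤ 1 → (∀ i j, |pd i (pd j u) x| ≤ W) → (∀ i, |pd i u x| ≤ Λ) → |G x| ≤ Λ → (∀ i, |pd i G x| ≤ Λ) →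
    (∀ i, |pd i Γ x - pd i G x| ≤ ε) → (∀ i j, |pd i (pd j Γ) x| ≤ Λ * W) →
    (∀ i j, |AA u (gg G u) x i j| ≤ L * W) ∧ (∀ i, |YY G u Γ i x| ≤ L) ∧ (∀ i j, |pd i (YY G u Γ j) x| ≤ L*W) ∧
    (∀ i, |pd i (gg G u) x| ≤ L*W) ∧ (∀ i, |YY G u Γ i x - YY G u G i x| ≤ L*ε) := by
  have hΛ0 : 0 < Λ := by linarith
  set c1 := Λ * (n*Λ^2) with hc1
  set c2 := Λ*(n*Λ^2) + Λ*(2*(n*(Λ*1))) with hc2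
  set c3 := 2*Λ*c1*Λ + (n*Λ^2)*(Λ+1) with hc3
  set c4 := 2*Λ*c1*Λ + 2*Λ*c2*Λ + 2*Λ*c1*1 + (2*(n*(Λ*1)))*(Λ+1) + (n*Λ^2)*Λ with hc4
  have p1 : 0 ≤ c1 := by positivity
  have p2 : 0 ≤ c2 := by positivity
  have p3 : 0 ≤ c3 := by positivity
  have p4 : 0 ≤ c4 := by positivity
  have p5 : 0 ≤ n*Λ^2 := by positivity
  refine ⟨1 + c1 + c2 + c3 + c4 + n*Λ^2, by linarith, ?_⟩
  intro G u Γ hG hu hΓ x W ε hW hε hε1 hh hp hGx hdG hdΓ hddΓ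
  have hW0 : 0 < W := by linarith
  have hnsq := nsq_bound (p := grad u x) hp
  have hg : |gg G u x| ≤ c1 := amul hGx hnsq
  have hdΓ' : ∀ i, |pd i Γ x| ≤ Λ + 1 := fun i => by
    have := abs_sub_abs_le_abs_sub (pd i Γ x) (pd i G x)
    linarith [hdΓ i, hdG i]
  have hdot : ∀ i, |∑ m, pd m u x * pd i (pd m u) x| ≤ n*(Λ*W) := fun i => dot_bound hΛ0.le hp (hh i)
  have hdg : ∀ i, |pd i (gg G u) x| ≤ c2 * W := fun i => by
    rw [pd_gg hG hu]
    refine (aadd (amul (hdG i) hnsq) (amul hGx (amul a2 (hdot i)))).trans ?_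
    have : Λ*(n*Λ^2) ≤ Λ*(n*Λ^2)*W := le_mul_of_one_le_right (by positivity) hW
    rw [hc2]; linarith
  refine ⟨fun i j => ?_, fun i => ?_, fun i j => ?_, fun i => ?_, fun i => ?_⟩
  · rw [AA_apply]
    have h1 : |(1 : Matrix (Fin n) (Fin n) ℝ) i j| ≤ 1 := by rw [Matrix.one_apply]; split_ifs <;> simp
    have h2 := amul hg h1
    have h3 := abs_sub (pd i (pd j u) x) (gg G u x * (1 : Matrix (Fin n) (Fin n) ℝ) i j)
    have h4 : c1 ≤ c1 * W := le_mul_of_one_le_right p1 hW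
    have h5 : 0 ≤ (c2+c3+c4+n*Λ^2)*W := by positivity
    linarith [hh i j]
  · unfold YY
    refine (aadd (amul (amul (amul a2 hGx) hg) (hp i)) (amul hnsq (hdΓ' i))).trans ?_
    linarith
  · rw [pd_YY hG hu hΓ]
    refine (aadd (aadd (aadd (aadd (amul (amul (amul a2 (hdG i)) hg) (hp j)) (amul (amul (amul a2 hGx) (hdg i)) (hp j)))
      (amul (amul (amul a2 hGx) hg) (hh i j))) (amul (amul a2 (hdot i)) (hdΓ' j))) (amul hnsq (hddΓ i j))).trans ?_
    have h4 : 2*Λ*c1*Λ ≤ 2*Λ*c1*Λ * W := le_mul_of_one_le_right (by positivity) hW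
    have h5 : 0 ≤ (1+c1+c2+c3+n*Λ^2)*W := by positivity
    have h6 : 2*Λ*c1*Λ + 2*Λ*(c2*W)*Λ + 2*Λ*c1*W + 2*(n*(Λ*W))*(Λ+1) + n*Λ^2*(Λ*W) ≤ c4 * W := by
      rw [hc4]; linarith
    linarith
  · refine (hdg i).trans ?_
    gcongr; linarith
  · have : YY G u Γ i x - YY G u G i x = normSq (grad u x) * (pd i Γ x - pd i G x) := by unfold YY; ring
    rw [this]
    refine (amul hnsq (hdΓ i)).trans ?_
    gcongr; linarith
end en
end IHE

end

noncomputable section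
set_option linter.unusedSectionVars false
set_option linter.style.longLine false
set_option linter.unusedSimpArgs false
namespace IHE
section en
variable {n : ℕ}

def PW (Λ : ℝ) (κ : ℕ) (u G w : (Fin n → ℝ) → ℝ) (W : ℝ) (x : Fin n → ℝ) : Prop :=
  1 ≤ W ∧ w x ≤ 2*W ∧ W ≤ 2*w x ∧ (∀ i j, |pd i (pd j u) x| ≤ W) ∧ (∀ i, |pd i u x| ≤ Λ) ∧ |G x| ≤ Λ ∧ (∀ i, |pd i G x| ≤ Λ) ∧
  (∀ v : Fin n → ℝ, (∑ i, v i^2)/(Λ*W) ≤ ∑ i, ∑ j, TT (κ+1) (AA u (gg G u) x) i j * v i * v j) ∧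
  (2*G x*(((n:ℝ)-κ-1)*SS (κ+1) (AA u (gg G u) x))*(∑ m, pd m u x * pd m w x) - Λ*(∑ m, |pd m w x|) - Λ*W^(κ+2) ≤
    ∑ i, ∑ j, TT (κ+1) (AA u (gg G u) x) i j * pd i (pd j w) x)

lemma pd_V1 {w η : (Fin n → ℝ) → ℝ} (hw : ContDiff ℝ 2 w) (hw0 : ∀ x, 0 < w x) (hη : ContDiff ℝ 1 η) (q : ℝ) (i j : Fin n) (x : Fin n → ℝ) :
    pd i (fun y => w y ^ q * η y^2 * pd j w y) x = (q*(w x^q)/w x*pd i w x*η x^2 + 2*(w x^q)*η x*pd i η x)*pd j w x + w x^q*η x^2*pd i (pd j w) x := by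
  have dw := hw.differentiable two_ne_zero x
  have dη := hη.differentiable one_ne_zero x
  have dp := (pd_contDiff (i := j) (m := 1) hw (by norm_num)).differentiable one_ne_zero x
  have hd : HasDerivAt (fun t : ℝ => t ^ q) (q * w x ^ (q-1)) (w x) := Real.hasDerivAt_rpow_const (Or.inl (hw0 x).ne')
  have dwq : DifferentiableAt ℝ (fun y => w y ^ q) x := hd.differentiableAt.comp x dw
  have dη2 : DifferentiableAt ℝ (fun y => η y ^ 2) x := dη.fun_pow 2
  have e : pd i (fun y => η y ^2) x = 2 * η x * pd i η x := by
    have : (fun y => η y ^ 2) = fun y => η y * η y := by funext y; ring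
    rw [this, pd_mul dη dη]; ring
  rw [pd_mul (dwq.fun_mul dη2) dp, pd_mul dwq dη2, e, pd_comp hd dw, Real.rpow_sub_one (hw0 x).ne']
  ring

lemma pd_V2 {w η Y : (Fin n → ℝ) → ℝ} (hw : ContDiff ℝ 2 w) (hw0 : ∀ x, 0 < w x) (hη : ContDiff ℝ 1 η) (hY : ContDiff ℝ 1 Y) (q : ℝ) (i : Fin n) (x : Fin n → ℝ) :
    pd i (fun y => Y y * (w y ^ q * w y * η y^2) / (q+1)) x = (pd i Y x*(w x^q*w x*η x^2)+(q+1)*Y x*(w x^q)*pd i w x*η x^2+2*Y x*(w x^q)*w x*η x*pd i η x)/(q+1) := by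
  have dw := hw.differentiable two_ne_zero x
  have dη := hη.differentiable one_ne_zero x
  have dY := hY.differentiable one_ne_zero x
  have hd : HasDerivAt (fun t : ℝ => t ^ q) (q * w x ^ (q-1)) (w x) := Real.hasDerivAt_rpow_const (Or.inl (hw0 x).ne')
  have dwq : DifferentiableAt ℝ (fun y => w y ^ q) x := hd.differentiableAt.comp x dw
  have dη2 : DifferentiableAt ℝ (fun y => η y ^ 2) x := dη.fun_pow 2
  have e : pd i (fun y => η y ^2) x = 2 * η x * pd i η x := by
    have : (fun y => η y ^ 2) = fun y => η y * η y := by funext y; ring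
    rw [this, pd_mul dη dη]; ring
  have e0 : (fun y => Y y * (w y ^ q * w y * η y^2) / (q+1)) = fun y => (1/(q+1)) * (Y y * (w y ^ q * w y * η y^2)) := by
    funext y; ring
  rw [e0, pd_const_mul _ (dY.fun_mul ((dwq.fun_mul dw).fun_mul dη2)), pd_mul dY ((dwq.fun_mul dw).fun_mul dη2), pd_mul (dwq.fun_mul dw) dη2, pd_mul dwq dw, e, pd_comp hd dw, Real.rpow_sub_one (hw0 x).ne']
  have := (hw0 x).ne'
  field_simp
  ring

lemma int_comb {f1 f2 f3 a1 a2 a3 a4 : (Fin n → ℝ) → ℝ} (h1 : Integrable f1) (h2 : Integrable f2) (h3 : Integrable f3)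
    (k1 : Integrable a1) (k2 : Integrable a2) (k3 : Integrable a3) (k4 : Integrable a4) (c1 c2 c3 N M : ℝ)
    (h : ∀ x, c1 * f1 x - c2 * f2 x - c3 * f3 x ≤ (a1 x - N * a2 x) + N * (a3 x - M * a4 x)) :
    c1 * (∫ x, f1 x) - c2 * (∫ x, f2 x) - c3 * (∫ x, f3 x) ≤ ((∫ x, a1 x) - N * ∫ x, a2 x) + N * ((∫ x, a3 x) - M * ∫ x, a4 x) := by
  have j1 : Integrable fun x => c1 * f1 x - c2 * f2 x := (h1.const_mul c1).sub (h2.const_mul c2)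
  have j2 : Integrable fun x => c1 * f1 x - c2 * f2 x - c3 * f3 x := j1.sub (h3.const_mul c3)
  have j3 : Integrable fun x => a1 x - N * a2 x := k1.sub (k2.const_mul N)
  have j4 : Integrable fun x => a3 x - M * a4 x := k3.sub (k4.const_mul M)
  have j5 : Integrable fun x => (a1 x - N * a2 x) + N * (a3 x - M * a4 x) := j3.add (j4.const_mul N)
  have := integral_mono j2 j5 h
  rwa [integral_sub j1 (h3.const_mul c3), integral_sub (h1.const_mul c1) (h2.const_mul c2), integral_add j3 (j4.const_mul N),
    integral_sub k1 (k2.const_mul N), integral_const_mul N, integral_const_mul N, integral_sub k3 (k4.const_mul M),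
    integral_const_mul, integral_const_mul, integral_const_mul, integral_const_mul] at this

set_option maxHeartbeats 1000000 in
lemma energy (hn : 1 ≤ n) (κ : ℕ) (hκ : κ + 2 ≤ n) (Λ : ℝ) (hΛ : 1 ≤ Λ) : ∃ C0, 0 ≤ C0 ∧ ∀ (u G w W η : (Fin n → ℝ) → ℝ) (q : ℝ),
    ContDiff ℝ 2 u → HasCompactSupport u → ContDiff ℝ 1 G → HasCompactSupport G → ContDiff ℝ 2 w → (∀ x, 0 < w x) → Continuous W →
    ContDiff ℝ 1 η → HasCompactSupport η → 1 ≤ q →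
    (∀ x ∈ tsupport η, PW Λ κ u G w (W x) x) →
    (∀ ε > 0, ∃ Γ : (Fin n → ℝ) → ℝ, ContDiff ℝ 2 Γ ∧ ∀ x ∈ tsupport η, (∀ i, |pd i Γ x - pd i G x| ≤ ε) ∧ ∀ i j, |pd i (pd j Γ) x| ≤ Λ * W x) →
    ∫ x, (w x^q/w x^2)*η x^2*(∑ m, pd m w x^2) ≤ C0 * ∫ x, W x^(κ+2)*w x^q*(η x^2+∑ m, pd m η x^2) := by
  obtain ⟨L0, hL0, Hb⟩ := bounds n Λ hΛ
  obtain ⟨B1, hB1, Hb1⟩ := TT_bound n (κ+1)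
  obtain ⟨B2, hB2, Hb2⟩ := TT_bound n κ
  obtain ⟨B3, hB3, Hb3⟩ := TT_bound n (κ-1)
  set L := L0 + Λ + n + B1 * L0^(κ+1) + B2 * L0^κ + B3 * L0^(κ-1) with hLdef
  have q1 : 0 ≤ B1 * L0^(κ+1) := by positivity
  have q2 : 0 ≤ B2 * L0^κ := by positivity
  have q3 : 0 ≤ B3 * L0^(κ-1) := by positivity
  have q4 : (0:ℝ) ≤ n := by positivity
  have hL : 1 ≤ L := by linarith
  have hLn : (n:ℝ) ≤ L := by linarith
  have hLΛ : Λ ≤ L := by linarith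
  have hLL0 : L0 ≤ L := by linarith
  have hL0' : 0 < L := by linarith
  obtain ⟨C, hC, H0⟩ := pt (n := n) hn L hL hLn
  refine ⟨16*L/3*C, by positivity, ?_⟩
  intro u G w W η q hu huc hG hGc hw hw0 hWc hη hηc hq hPW hΓ
  have hκ' : (κ:ℝ) + 2 ≤ n := by exact_mod_cast hκ
  have hκ0 : (0:ℝ) ≤ κ := by positivity
  -- regularity
  have cw := hw.continuous
  have cη := hη.continuous
  have cwq : Continuous fun x => w x ^ q := cw.rpow_const fun x => Or.inl (hw0 x).ne'
  have wqcd : ContDiff ℝ 1 fun x => w x ^ q := (hw.of_le (by norm_num)).rpow_const_of_ne fun x => (hw0 x).ne'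
  have cdw : ∀ m, Continuous (pd m w) := fun m => (pd_contDiff (m := 0) (r := 1) (hw.of_le (by norm_num)) (by norm_num)).continuous
  have cdη : ∀ m, Continuous (pd m η) := fun m => (pd_contDiff (m := 0) (r := 1) hη (by norm_num)).continuous
  have hgc : HasCompactSupport (gg G u) := hGc.mul_right
  have hgcd := gg_cd hG hu
  have z_out : ∀ x, x ∉ tsupport η → η x = 0 := fun x hx => image_eq_zero_of_notMem_tsupport hx
  have zd_out : ∀ x, x ∉ tsupport η → ∀ m, pd m η x = 0 := fun x hx m => by
    unfold pd; rw [fderiv_of_notMem_tsupport (𝕜 := ℝ) hx]; simp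
  have hcs : ∀ F : (Fin n → ℝ) → ℝ, (∀ x, x ∉ tsupport η → F x = 0) → HasCompactSupport F := fun F hF =>
    HasCompactSupport.intro hηc (fun x hx => hF x hx)
  -- integrals
  set fI := fun x => (w x^q/w x^2)*η x^2*(∑ m, pd m w x^2) with hfI
  set fJ := fun x => W x^(κ+2)*w x^q*(η x^2+∑ m, pd m η x^2) with hfJ
  set fK := fun x => w x^q*η x^2*W x^κ*∑ m, |pd m w x| with hfK
  have cI : Integrable fI := by
    refine Continuous.integrable_of_hasCompactSupport ?_ (hcs _ fun x hx => ?_)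
    · exact ((cwq.div (cw.pow 2) fun x => pow_ne_zero 2 (hw0 x).ne').mul (cη.pow 2)).mul (continuous_finsetSum _ fun m _ => (cdw m).pow 2)
    · simp [hfI, z_out x hx]
  have cJ : Integrable fJ := by
    refine Continuous.integrable_of_hasCompactSupport ?_ (hcs _ fun x hx => ?_)
    · exact ((hWc.pow _).mul cwq).mul ((cη.pow 2).add (continuous_finsetSum _ fun m _ => (cdη m).pow 2))
    · simp [hfJ, z_out x hx, zd_out x hx]
  have cK : Integrable fK := by
    refine Continuous.integrable_of_hasCompactSupport ?_ (hcs _ fun x hx => ?_)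
    · exact ((cwq.mul (cη.pow 2)).mul (hWc.pow _)).mul (continuous_finsetSum _ fun m _ => (cdw m).abs)
    · simp [hfK, z_out x hx]
  have main : ∀ ε, 0 < ε → ε ≤ 1 → 3/(16*L)*(∫ x, fI x) - C*(∫ x, fJ x) - C*ε*(∫ x, fK x) ≤ 0 := by
    intro ε hε hε1
    obtain ⟨Γ, hΓcd, hΓb⟩ := hΓ ε hε
    set V1 : Fin n → (Fin n → ℝ) → ℝ := fun j y => w y ^ q * η y^2 * pd j w y with hV1
    set V2 : Fin n → (Fin n → ℝ) → ℝ := fun j y => YY G u Γ j y * (w y ^ q * w y * η y^2) / (q+1) with hV2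
    have V1cd : ∀ j, ContDiff ℝ 1 (V1 j) := fun j => (wqcd.mul (hη.pow 2)).mul (pd_contDiff hw (by norm_num))
    have V2cd : ∀ j, ContDiff ℝ 1 (V2 j) := fun j => ((YY_cd hG hu hΓcd j).mul ((wqcd.mul (hw.of_le (by norm_num))).mul (hη.pow 2))).div_const _
    have V1c : ∀ j, HasCompactSupport (V1 j) := fun j => hcs _ fun x hx => by simp [hV1, z_out x hx]
    have V2c : ∀ j, HasCompactSupport (V2 j) := fun j => hcs _ fun x hx => by simp [hV2, z_out x hx]
    set T2 : (Fin n → ℝ) → Matrix (Fin n) (Fin n) ℝ := fun x => if κ = 0 then 0 else TT (κ-1) (AA u (gg G u) x) with hT2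
    have W1 := weakdiv hu hgcd huc hgc V1cd V1c κ
    have W2 : ∫ x, ∑ i, ∑ j, TT κ (AA u (gg G u) x) i j * pd i (V2 j) x = ((n:ℝ)-κ) * ∫ x, ∑ j, ∑ l, T2 x j l * pd l (gg G u) x * V2 j x := by
      rcases κ with _ | κ
      · rw [weakdiv0 V2cd V2c]; simp [hT2]
      · rw [weakdiv hu hgcd huc hgc V2cd V2c κ]
        simp [hT2]
        left; ring
    have cT2 : ∀ i j, Continuous fun x => T2 x i j := by
      intro i j
      by_cases h : κ = 0
      · simp [hT2, h]; exact continuous_const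
      · simp [hT2, h]; exact TT_AA_cont hu hgcd.continuous _ i j
    have cg : ∀ l, Continuous (pd l (gg G u)) := fun l => (pd_contDiff (m := 0) hgcd (by norm_num)).continuous
    have cdV1 : ∀ i j, Continuous (pd i (V1 j)) := fun i j => (pd_contDiff (m := 0) (V1cd j) (by norm_num)).continuous
    have cdV2 : ∀ i j, Continuous (pd i (V2 j)) := fun i j => (pd_contDiff (m := 0) (V2cd j) (by norm_num)).continuous
    have i1 : Integrable fun x => ∑ i, ∑ j, TT (κ+1) (AA u (gg G u) x) i j * pd i (V1 j) x :=
      integrable_finsetSum _ fun i _ => integrable_finsetSum _ fun j _ =>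
        ((TT_AA_cont hu hgcd.continuous _ i j).mul (cdV1 i j)).integrable_of_hasCompactSupport (pd_hcs (V1c j)).mul_left
    have i2 : Integrable fun x => ∑ j, ∑ l, TT κ (AA u (gg G u) x) j l * pd l (gg G u) x * V1 j x :=
      integrable_finsetSum _ fun i _ => integrable_finsetSum _ fun j _ =>
        (((TT_AA_cont hu hgcd.continuous _ i j).mul (cg j)).mul (V1cd i).continuous).integrable_of_hasCompactSupport (V1c i).mul_left
    have i3 : Integrable fun x => ∑ i, ∑ j, TT κ (AA u (gg G u) x) i j * pd i (V2 j) x :=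
      integrable_finsetSum _ fun i _ => integrable_finsetSum _ fun j _ =>
        ((TT_AA_cont hu hgcd.continuous _ i j).mul (cdV2 i j)).integrable_of_hasCompactSupport (pd_hcs (V2c j)).mul_left
    have i4 : Integrable fun x => ∑ j, ∑ l, T2 x j l * pd l (gg G u) x * V2 j x :=
      integrable_finsetSum _ fun i _ => integrable_finsetSum _ fun j _ =>
        (((cT2 i j).mul (cg j)).mul (V2cd i).continuous).integrable_of_hasCompactSupport (V2c i).mul_left
    have hpt : ∀ x, 3/(16*L)*fI x - C*fJ x - C*ε*fK x ≤
        (∑ i, ∑ j, TT (κ+1) (AA u (gg G u) x) i j * pd i (V1 j) x - ((n:ℝ)-κ-1) * ∑ j, ∑ l, TT κ (AA u (gg G u) x) j l * pd l (gg G u) x * V1 j x) +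
        ((n:ℝ)-κ-1) * (∑ i, ∑ j, TT κ (AA u (gg G u) x) i j * pd i (V2 j) x - ((n:ℝ)-κ) * ∑ j, ∑ l, T2 x j l * pd l (gg G u) x * V2 j x) := by
      intro x
      by_cases hx : x ∈ tsupport η
      · obtain ⟨hW, hw1, hw2, hh, hp, hGx, hdG, hell, hstar⟩ := hPW x hx
        obtain ⟨hdΓ, hddΓ⟩ := hΓb x hx
        obtain ⟨bA, bY, bXD, bg, bYX⟩ := Hb G u Γ hG hu hΓcd x (W x) ε hW hε.le hε1 hh hp hGx hdG hdΓ hddΓ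
        have hW0 : 0 < W x := by linarith
        have hAs : (AA u (gg G u) x)ᵀ = AA u (gg G u) x := AA_symm _ hu.contDiffAt
        have r0 : 0 ≤ L0 * W x := by positivity
        have hT1 := (Hb1 _ _ r0 bA).1
        have hT2' := (Hb2 _ _ r0 bA).1
        have hT3 := (Hb3 _ _ r0 bA).1
        have key := H0 κ (TT (κ+1) (AA u (gg G u) x)) (TT κ (AA u (gg G u) x)) (T2 x) (AA u (gg G u) x)
          (Matrix.of fun i j => pd i (YY G u Γ j) x) (Matrix.of fun i j => pd i (pd j w) x)
          (Matrix.of fun i j => pd i (V1 j) x) (Matrix.of fun i j => pd i (V2 j) x)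
          (SS (κ+1) (AA u (gg G u) x)) ((n:ℝ)-κ-1) ((n:ℝ)-κ) (G x) (w x) (W x) q (η x) ε (w x ^ q)
          (fun i => pd i u x) (fun i => pd i w x) (fun i => pd i η x) (fun i => pd i (gg G u) x) (fun i => YY G u G i x) (fun i => YY G u Γ i x)
          (fun j => V1 j x) (fun j => V2 j x)
          hW hw1 hw2 hq (by linarith) (by linarith) (by linarith) (by linarith) (hGx.trans hLΛ) hε.le (Real.rpow_pos_of_pos (hw0 x) q)
          (TT_symm _ hAs) (TT_succ κ _)
          (fun i j => (hT1 i j).trans (by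
            rw [mul_pow, ← mul_assoc]; gcongr; linarith))
          (fun i j => (hT2' i j).trans (by
            rw [mul_pow, ← mul_assoc]; gcongr; linarith))
          (fun i j => by
            by_cases h : κ = 0
            · simp [hT2, h]; linarith
            · simp only [hT2, h, if_false]
              refine (hT3 i j).trans ?_
              rw [mul_pow, ← mul_assoc]
              have : W x ^ (κ-1) ≤ W x ^ κ := pow_le_pow_right₀ hW (by omega)
              gcongr; linarith)
          (fun i => (hp i).trans hLΛ) (fun i => (bY i).trans hLL0)
          (fun i j => (bXD i j).trans (by gcongr)) (fun i => (bg i).trans (by gcongr)) (fun i => (bYX i).trans (by gcongr))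
          (fun l => pd_gg' hG hu l x)
          (fun v => le_trans (by gcongr) (hell v))
          (by
            refine le_trans ?_ hstar
            have h1 : Λ * (∑ m, |pd m w x|) ≤ L * ∑ m, |pd m w x| := by gcongr
            have h2 : Λ * W x^(κ+2) ≤ L * W x^(κ+2) := by gcongr
            linarith)
          (fun i j => pd_V1 hw hw0 hη q i j x)
          (fun j => rfl)
          (fun i j => pd_V2 hw hw0 hη (YY_cd hG hu hΓcd j) q i x)
          (fun j => rfl)
        simp only [Matrix.of_apply] at key
        refine le_trans (le_of_eq ?_) key
        simp only [hfI, hfJ, hfK]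
        ring
      · have a1 : ∀ j, V1 j x = 0 := fun j => by simp [hV1, z_out x hx]
        have a2 : ∀ j, V2 j x = 0 := fun j => by simp [hV2, z_out x hx]
        have a3 : ∀ i j, pd i (V1 j) x = 0 := fun i j => by
          simp only [hV1]; rw [pd_V1 hw hw0 hη]; simp [z_out x hx]
        have a4 : ∀ i j, pd i (V2 j) x = 0 := fun i j => by
          simp only [hV2]; rw [pd_V2 hw hw0 hη (YY_cd hG hu hΓcd j)]; simp [z_out x hx]
        simp [a1, a2, a3, a4, hfI, hfJ, hfK, z_out x hx, zd_out x hx]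
    have hIntg := int_comb cI cJ cK i1 i2 i3 i4 (3/(16*L)) C (C*ε) ((n:ℝ)-κ-1) ((n:ℝ)-κ) hpt
    rw [W1, W2] at hIntg
    linarith
  have lim : 3/(16*L)*(∫ x, fI x) - C*(∫ x, fJ x) ≤ 0 := by
    by_contra hcon
    push Not at hcon
    set a := 3/(16*L)*(∫ x, fI x) - C*(∫ x, fJ x) with ha
    set b := C * |∫ x, fK x| with hb
    have hb0 : 0 ≤ b := by positivity
    have h := main (min 1 (a/(2*(b+1)))) (by positivity) (min_le_left _ _)
    have h2 : min 1 (a/(2*(b+1))) * b < a := by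
      calc min 1 (a/(2*(b+1))) * b ≤ a/(2*(b+1)) * b := by gcongr; exact min_le_right _ _
        _ = a * (b/(2*(b+1))) := by ring
        _ < a * 1 := by
          apply mul_lt_mul_of_pos_left _ hcon
          rw [div_lt_one (by positivity)]; linarith
        _ = a := mul_one a
    have h3 : C * min 1 (a/(2*(b+1))) * (∫ x, fK x) ≤ min 1 (a/(2*(b+1))) * b := by
      rw [hb]
      calc C * min 1 (a/(2*(b+1))) * (∫ x, fK x) ≤ C * min 1 (a/(2*(b+1))) * |∫ x, fK x| := by
            have : 0 ≤ min 1 (a/(2*(b+1))) := by positivity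
            gcongr; exact le_abs_self _
        _ = _ := by ring
    linarith
  have : (∫ x, fI x) = 16*L/3 * (3/(16*L)*(∫ x, fI x)) := by field_simp
  rw [this]
  calc _ ≤ 16*L/3 * (C*(∫ x, fJ x)) := mul_le_mul_of_nonneg_left (by linarith) (by positivity)
    _ = _ := by ring
end en
end IHE

end

noncomputable section
set_option linter.unusedSectionVars false
set_option linter.style.longLine false
set_option linter.unusedSimpArgs false
namespace IHE
section mo
variable {n : ℕ}

lemma moser_sup {χ δ B μ t : ℝ} (hχ : 1 < χ) (hδ : 0 < δ) (hμ : 0 < μ) (ht : 1 ≤ t) {P : ℕ → ℝ} (hP : ∀ j, χ^j * δ ≤ P j)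
    (h : ∀ j : ℕ, t^(P j) * μ ≤ Real.exp (χ^j * B)) : t ≤ Real.exp (B/δ) := by
  by_contra hc
  push Not at hc
  have ht0 : 0 < t := by linarith
  have hlog : B < δ * Real.log t := by
    have := (Real.lt_log_iff_exp_lt ht0).2 hc
    rw [div_lt_iff₀ hδ] at this; linarith
  set e := δ * Real.log t - B with he
  have he0 : 0 < e := by linarith
  have h2 : ∀ j : ℕ, Real.exp (χ^j*e) * μ ≤ 1 := by
    intro j
    have h3 : Real.exp (χ^j * (δ * Real.log t)) ≤ t^(P j) := by
      rw [Real.rpow_def_of_pos ht0]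
      apply Real.exp_le_exp.2
      have := mul_le_mul_of_nonneg_right (hP j) (Real.log_nonneg ht)
      linarith
    have h4 : Real.exp (χ^j*e) = Real.exp (χ^j * (δ * Real.log t)) / Real.exp (χ^j * B) := by
      rw [← Real.exp_sub]; congr 1; rw [he]; ring
    rw [h4, div_mul_eq_mul_div, div_le_one (Real.exp_pos _)]
    exact le_trans (by gcongr) (h j)
  have h5 : Filter.Tendsto (fun j : ℕ => χ^j * e) Filter.atTop Filter.atTop :=
    (tendsto_pow_atTop_atTop_of_one_lt hχ).atTop_mul_const he0
  obtain ⟨j, hj⟩ := (h5.eventually (Filter.eventually_ge_atTop (1/μ))).exists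
  have h6 := Real.add_one_le_exp (χ^j*e)
  have h7 : 1/μ + 1 ≤ Real.exp (χ^j*e) := by linarith
  have h8 := mul_le_mul_of_nonneg_right h7 hμ.le
  have h9 : (1/μ+1)*μ = 1 + μ := by field_simp
  linarith [h2 j]

lemma moser_iter {χ : ℝ} (hχ : 1 < χ) (K M2 : ℝ) (hK : 1 ≤ K) (hM2 : 1 ≤ M2) : ∃ B, ∀ I : ℕ → ℝ, (∀ j, 0 ≤ I j) → I 0 ≤ M2 →
    (∀ j, I (j+1) ≤ (K * K^j * I j)^χ) → ∀ j, I j ≤ Real.exp (χ^j * B) := by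
  have hχ0 : 0 < χ := by linarith
  have hs : Summable fun i : ℕ => ((i:ℝ)+1) * (χ⁻¹)^i := by
    have h1 : Summable fun i : ℕ => ((i:ℝ)^1) * (χ⁻¹)^i := summable_pow_mul_geometric_of_norm_lt_one 1 (by
      rw [Real.norm_eq_abs, abs_of_pos (by positivity)]; exact inv_lt_one_of_one_lt₀ hχ)
    have h2 : Summable fun i : ℕ => (χ⁻¹)^i := summable_geometric_of_lt_one (by positivity) (inv_lt_one_of_one_lt₀ hχ)
    refine (h1.add h2).congr fun i => by ring
  refine ⟨Real.log M2 + Real.log K * ∑' i : ℕ, ((i:ℝ)+1) * (χ⁻¹)^i, ?_⟩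
  intro I hI0 h0 hI
  have hlK : 0 ≤ Real.log K := Real.log_nonneg hK
  have key : ∀ j, I j ≤ Real.exp (χ^j * (Real.log M2 + Real.log K * ∑ i ∈ Finset.range j, ((i:ℝ)+1) * (χ⁻¹)^i)) := by
    intro j
    induction j with
    | zero => simpa [Real.exp_log (show 0 < M2 by linarith)] using h0
    | succ j ih =>
      refine (hI j).trans ?_
      have hKK : K * K^j = Real.exp ((j+1) * Real.log K) := by
        rw [show ((j:ℝ)+1) * Real.log K = ((j+1:ℕ):ℝ) * Real.log K by push_cast; ring, Real.exp_nat_mul, Real.exp_log (by linarith)]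
        ring
      calc (K * K^j * I j)^χ ≤ (Real.exp ((j+1) * Real.log K) * Real.exp (χ^j * (Real.log M2 + Real.log K * ∑ i ∈ Finset.range j, ((i:ℝ)+1) * (χ⁻¹)^i)))^χ := by
            rw [← hKK]
            have := hI0 j
            gcongr
        _ = _ := by
          rw [← Real.exp_add, ← Real.exp_mul, Finset.sum_range_succ]
          congr 1
          have : χ^(j+1) * (Real.log K * (((j:ℝ)+1) * (χ⁻¹)^j)) = χ * ((j+1) * Real.log K) := by
            rw [inv_pow, pow_succ]; field_simp
          rw [mul_add (Real.log K), ← add_assoc, mul_add (χ^(j+1)), this, pow_succ]; ring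
  intro j
  refine (key j).trans (Real.exp_le_exp.2 ?_)
  gcongr
  exact hs.sum_le_tsum _ (fun i _ => by positivity)

set_option maxHeartbeats 1000000 in
lemma moser (hn : 3 ≤ n) (k : ℕ) (hk : 2 ≤ k) (p : ℝ) (hp : (k * n : ℝ)/2 < p) (ζ : (Fin n → ℝ) → ℝ) (hζ : ContDiff ℝ 1 ζ)
    (hζc : HasCompactSupport ζ) (hζ0 : ∀ x, 0 ≤ ζ x) (hζ1 : ∀ x, ζ x ≤ 1) (C2 M2 : ℝ) (hC2 : 0 ≤ C2) : ∃ C, ∀ W : (Fin n → ℝ) → ℝ, Continuous W → (∀ x ∈ tsupport ζ, 1 ≤ W x) →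
    (∀ q : ℝ, 1 ≤ q → ∀ a : ℕ, 1 ≤ a → ∫ x, ((ζ x^a)^2 * W x^q)^((n:ℝ)/(n-2)) ≤
      (C2*q^2*∫ x, W x^k * W x^q * ((ζ x^a)^2 + ∑ m, (pd m (fun y => ζ y^a) x)^2))^((n:ℝ)/(n-2))) →
    ∫ x, W x^p * ζ x^2 ≤ M2 → ∀ x ∈ interior {x | ζ x = 1}, W x ≤ C := by
  have hn3 : (3:ℝ) ≤ n := by exact_mod_cast hn
  have hk2 : (2:ℝ) ≤ k := by exact_mod_cast hk
  have hn2 : (0:ℝ) < n - 2 := by linarith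
  obtain ⟨χ, hχdef⟩ : ∃ χ : ℝ, χ = (n:ℝ)/(n-2) := ⟨_, rfl⟩
  rw [← hχdef]
  have hχ1 : 1 < χ := by rw [hχdef, lt_div_iff₀ hn2]; linarith
  have hχ3 : χ ≤ 3 := by rw [hχdef, div_le_iff₀ hn2]; linarith
  have hχ0 : 0 < χ := by linarith
  set s := (k*n:ℝ)/2 with hs
  have hfix : χ * (s - k) = s := by rw [hχdef, hs]; field_simp
  have hsk : 1 ≤ s - k := by
    have : s - k = k*(n-2)/2 := by rw [hs]; ring
    rw [this]; nlinarith
  set δ := p - s with hδ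
  have hδ0 : 0 < δ := by linarith
  -- gradient bound
  obtain ⟨b, hb0, hb⟩ : ∃ b : ℝ, 0 ≤ b ∧ ∀ x, ∑ m, (pd m ζ x)^2 ≤ b := by
    have hc : Continuous fun x => ∑ m, (pd m ζ x)^2 := continuous_finsetSum _ fun m _ => ((pd_contDiff (m := 0) hζ (by norm_num)).continuous).pow 2
    have hcs : HasCompactSupport fun x => ∑ m, (pd m ζ x)^2 := HasCompactSupport.intro hζc (fun x hx => by
      have : ∀ m, pd m ζ x = 0 := fun m => by unfold pd; rw [fderiv_of_notMem_tsupport (𝕜 := ℝ) hx]; simp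
      simp [this])
    obtain ⟨b, hb⟩ := hc.bounded_above_of_compact_support hcs
    refine ⟨b, (norm_nonneg _).trans (hb 0), fun x => (le_abs_self _).trans (hb x)⟩
  set P : ℕ → ℝ := fun j => s + χ^j * δ with hPdef
  set a : ℕ → ℕ := fun j => 2 * 4^j with hadef
  have hP1 : ∀ j, P (j+1) = χ * (P j - k) := fun j => by
    simp only [hPdef]; rw [pow_succ]; linear_combination (-1)*hfix
  have hPk : ∀ j, 1 ≤ P j - k := fun j => by
    have : 0 ≤ χ^j * δ := by positivity
    simp only [hPdef]; linarith
  set D := s + δ + 1 with hD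
  have hD1 : 1 ≤ D := by linarith
  have hPD : ∀ j, P j - k ≤ D * 3^j := fun j => by
    have h1 : χ^j ≤ 3^j := pow_le_pow_left₀ hχ0.le hχ3 j
    have h2 : (1:ℝ) ≤ 3^j := one_le_pow₀ (by norm_num)
    simp only [hPdef]
    have h3 : χ^j*δ ≤ 3^j*δ := by gcongr
    have h4 : s ≤ s * 3^j := le_mul_of_one_le_right (by linarith) h2
    have : 0 ≤ (3:ℝ)^j := by positivity
    rw [hD]; linarith
  set K := max (C2 * D^2 * (4 * (1+b))) 144 with hK
  have hK1 : 1 ≤ K := le_trans (by norm_num) (le_max_right _ _)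
  obtain ⟨B, hB⟩ := moser_iter hχ1 K (max M2 1) hK1 (le_max_right _ _)
  refine ⟨Real.exp (B/δ), ?_⟩
  intro W hWc hW1 hRH hM x hx
  have z_out : ∀ x, x ∉ tsupport ζ → ζ x = 0 := fun x hx => image_eq_zero_of_notMem_tsupport hx
  have ha1 : ∀ j, 1 ≤ a j := fun j => by simp only [hadef]; have := Nat.one_le_pow j 4 (by norm_num); omega
  set I : ℕ → ℝ := fun j => ∫ x, W x^(P j) * ζ x^(2 * a j - 2) with hI
  have hexp : ∀ j, 2 * a j - 2 ≠ 0 := fun j => by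
    simp only [hadef]; have := Nat.one_le_pow j 4 (by norm_num); omega
  have hP0 : ∀ j, 0 ≤ P j := fun j => by linarith [hPk j]
  have nn : ∀ j x, 0 ≤ W x^(P j) * ζ x^(2 * a j - 2) := fun j x => by
    by_cases h : x ∈ tsupport ζ
    · have := hW1 x h; have := hζ0 x; positivity
    · rw [z_out x h, zero_pow (hexp j)]; simp
  have intI : ∀ j, Integrable fun x => W x^(P j) * ζ x^(2 * a j - 2) := fun j => by
    refine Continuous.integrable_of_hasCompactSupport ?_ (HasCompactSupport.intro hζc fun x hx => by rw [z_out x hx, zero_pow (hexp j)]; simp)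
    exact (hWc.rpow_const fun x => Or.inr (hP0 j)).mul (hζ.continuous.pow _)
  have hI0 : ∀ j, 0 ≤ I j := fun j => integral_nonneg (nn j)
  have hstep : ∀ j, I (j+1) ≤ (K * K^j * I j)^χ := by
    intro j
    have hq := hPk j
    have R1 := hRH (P j - k) hq (a j) (ha1 j)
    have L1 : I (j+1) ≤ ∫ x, ((ζ x^(a j))^2 * W x^(P j - k))^χ := by
      refine integral_mono (intI (j+1)) ?_ ?_
      · refine Continuous.integrable_of_hasCompactSupport ?_ (HasCompactSupport.intro hζc fun x hx => by
          rw [z_out x hx, zero_pow (by have := ha1 j; omega)]; simp [Real.zero_rpow hχ0.ne'])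
        exact (((hζ.continuous.pow _).pow 2).mul (hWc.rpow_const fun x => Or.inr (by linarith))).rpow_const fun x => Or.inr hχ0.le
      · intro x
        by_cases h : x ∈ tsupport ζ
        · have hW := hW1 x h
          have hW0 : 0 < W x := by linarith
          have hz := hζ0 x
          show W x^(P (j+1)) * ζ x^(2 * a (j+1) - 2) ≤ ((ζ x^(a j))^2 * W x^(P j - k))^χ
          rw [Real.mul_rpow (by positivity) (by positivity), ← Real.rpow_mul hW0.le, mul_comm (P j - k) χ, ← hP1, mul_comm]
          gcongr
          rw [← pow_mul, ← Real.rpow_natCast, ← Real.rpow_natCast, ← Real.rpow_mul hz]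
          apply Real.rpow_le_rpow_of_exponent_ge' hz (hζ1 x) (by positivity)
          have e1 : 2 * a (j+1) - 2 = 8 * a j - 2 := by simp only [hadef]; rw [pow_succ]; omega
          have e2 : 2 ≤ 8 * a j := by have := ha1 j; omega
          have e3 : (1:ℝ) ≤ a j := by exact_mod_cast ha1 j
          rw [e1, Nat.cast_sub e2]; push_cast
          nlinarith
        · show W x^(P (j+1)) * ζ x^(2 * a (j+1) - 2) ≤ ((ζ x^(a j))^2 * W x^(P j - k))^χ
          rw [z_out x h, zero_pow (hexp _), zero_pow (by have := ha1 j; omega)]; simp [Real.zero_rpow hχ0.ne']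
    refine L1.trans (R1.trans ?_)
    have hpdz : ∀ m x, pd m (fun y => ζ y^(a j)) x = a j * ζ x^(a j - 1) * pd m ζ x := fun m x =>
      pd_comp (φ := fun t => t^(a j)) (hasDerivAt_pow (a j) (ζ x)) (hζ.differentiable one_ne_zero x)
    have pz : ∀ x, (ζ x^(a j))^2 + ∑ m, (pd m (fun y => ζ y^(a j)) x)^2 ≤ (1+b) * (a j)^2 * ζ x^(2*a j - 2) := by
      intro x
      have hz := hζ0 x
      have e3 : (1:ℝ) ≤ a j := by exact_mod_cast ha1 j
      have h1 : (ζ x^(a j))^2 ≤ ζ x^(2*a j - 2) := by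
        rw [← pow_mul]; exact pow_le_pow_of_le_one hz (hζ1 x) (by omega)
      have h2 : ∑ m, (pd m (fun y => ζ y^(a j)) x)^2 = (a j)^2 * ζ x^(2*a j - 2) * ∑ m, (pd m ζ x)^2 := by
        rw [Finset.mul_sum]
        refine Finset.sum_congr rfl fun m _ => ?_
        rw [hpdz, mul_pow, mul_pow, ← pow_mul]
        congr 3
        have := ha1 j; omega
      rw [h2]
      have h3 : (a j:ℝ)^2 * ζ x^(2*a j - 2) * ∑ m, (pd m ζ x)^2 ≤ (a j:ℝ)^2 * ζ x^(2*a j - 2) * b := by gcongr; exact hb x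
      have h4 : ζ x^(2*a j - 2) ≤ (a j:ℝ)^2 * ζ x^(2*a j - 2) := le_mul_of_one_le_left (by positivity) (by nlinarith)
      linarith
    have nnr : ∀ x, 0 ≤ W x^k * W x^(P j - k) * ((ζ x^(a j))^2 + ∑ m, (pd m (fun y => ζ y^(a j)) x)^2) := by
      intro x
      by_cases h : x ∈ tsupport ζ
      · have hW := hW1 x h
        positivity
      · have hz : ζ x^(2*a j - 2) = 0 := by rw [z_out x h, zero_pow (hexp j)]
        have h1 := pz x
        rw [hz, mul_zero] at h1
        have h2 : 0 ≤ (ζ x^(a j))^2 + ∑ m, (pd m (fun y => ζ y^(a j)) x)^2 := by positivity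
        rw [le_antisymm h1 h2]; simp
    have R2 : ∫ x, W x^k * W x^(P j - k) * ((ζ x^(a j))^2 + ∑ m, (pd m (fun y => ζ y^(a j)) x)^2) ≤ (1+b) * (a j)^2 * I j := by
      rw [hI, ← integral_const_mul]
      refine integral_mono_of_nonneg (Filter.Eventually.of_forall nnr) ((intI j).const_mul _) (Filter.Eventually.of_forall fun x => ?_)
      by_cases h : x ∈ tsupport ζ
      · have hW := hW1 x h
        have hW0 : 0 < W x := by linarith
        have e : W x^k * W x^(P j - k) = W x^(P j) := by
          rw [← Real.rpow_natCast, ← Real.rpow_add hW0]; congr 1; ring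
        show W x^k * W x^(P j - k) * ((ζ x^(a j))^2 + ∑ m, (pd m (fun y => ζ y^(a j)) x)^2) ≤ _
        rw [e]
        calc _ ≤ W x^(P j) * ((1+b) * (a j)^2 * ζ x^(2*a j - 2)) := by gcongr; exact pz x
          _ = _ := by ring
      · have hz : ζ x^(2*a j - 2) = 0 := by rw [z_out x h, zero_pow (hexp j)]
        have h1 := pz x
        rw [hz, mul_zero] at h1
        have h2 : 0 ≤ (ζ x^(a j))^2 + ∑ m, (pd m (fun y => ζ y^(a j)) x)^2 := by positivity
        show W x^k * W x^(P j - k) * ((ζ x^(a j))^2 + ∑ m, (pd m (fun y => ζ y^(a j)) x)^2) ≤ (1+b) * (a j)^2 * (W x^(P j) * ζ x^(2*a j - 2))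
        rw [le_antisymm h1 h2, hz]; simp
    have nni : 0 ≤ ∫ x, W x^k * W x^(P j - k) * ((ζ x^(a j))^2 + ∑ m, (pd m (fun y => ζ y^(a j)) x)^2) := integral_nonneg nnr
    refine Real.rpow_le_rpow (by positivity) ?_ hχ0.le
    have h0 := hI0 j
    have hq0 : 0 ≤ P j - k := by linarith
    calc C2*(P j - k)^2*(∫ x, W x^k * W x^(P j - k) * ((ζ x^(a j))^2 + ∑ m, (pd m (fun y => ζ y^(a j)) x)^2))
        ≤ C2*(D*3^j)^2*((1+b) * (a j)^2 * I j) := by gcongr; exact hPD j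
      _ = (C2 * D^2 * (4 * (1+b))) * 144^j * I j := by
          simp only [hadef]; push_cast
          have : (144:ℝ)^j = (3^j)^2 * (4^j)^2 := by rw [← pow_mul, ← pow_mul, mul_comm j 2, pow_mul, pow_mul, ← mul_pow]; norm_num
          rw [this]; ring
      _ ≤ K * K^j * I j := by
          gcongr
          · exact le_max_left _ _
          · exact le_max_right _ _
  have hfin := hB I hI0 (by
    have : I 0 = ∫ x, W x^p * ζ x^2 := by
      simp only [hI, hPdef, hadef, hδ]; norm_num
    rw [this]; exact hM.trans (le_max_left _ _)) hstep
  -- sup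
  by_contra hc
  push Not at hc
  obtain ⟨t, ht1, ht2⟩ : ∃ t, Real.exp (B/δ) < t ∧ 1 ≤ t ∧ t ≤ W x ∧ (t < W x ∨ t = 1) := by
    by_cases h1 : 1 ≤ Real.exp (B/δ)
    · obtain ⟨t, h2, h3⟩ := exists_between hc
      exact ⟨t, h2, by linarith, h3.le, Or.inl h3⟩
    · have hxs : x ∈ tsupport ζ := by
        apply subset_tsupport; rw [Function.mem_support]
        have : ζ x = 1 := interior_subset (s := {x | ζ x = 1}) hx
        rw [this]; norm_num
      exact ⟨1, by linarith, le_refl _, hW1 x hxs, Or.inr rfl⟩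
  obtain ⟨ht1', -, htW⟩ := ht2
  set U := interior {x | ζ x = 1} ∩ {y | t ≤ W y} with hU
  have hUnhds : U ∈ nhds x := by
    refine Filter.inter_mem (isOpen_interior.mem_nhds hx) ?_
    rcases htW with h | h
    · filter_upwards [hWc.continuousAt.eventually_const_lt h] with y hy using hy.le
    · filter_upwards [isOpen_interior.mem_nhds hx] with y hy
      have hxs : y ∈ tsupport ζ := by
        apply subset_tsupport; rw [Function.mem_support]
        have : ζ y = 1 := interior_subset (s := {x | ζ x = 1}) hy
        rw [this]; norm_num
      show t ≤ W y
      rw [h]; exact hW1 y hxs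
  obtain ⟨r, hr, hrU⟩ := Metric.mem_nhds_iff.1 hUnhds
  have hμ : 0 < volume.real (ball x r) := by
    rw [Measure.real, ENNReal.toReal_pos_iff]
    exact ⟨measure_ball_pos _ _ hr, measure_ball_lt_top⟩
  have := moser_sup (B := B) hχ1 hδ0 hμ ht1' (P := P) (fun j => by simp only [hPdef]; linarith) (fun j => by
    refine le_trans ?_ (hfin j)
    have h1 : ∫ y in ball x r, t^(P j) ≤ ∫ y in ball x r, W y^(P j) * ζ y^(2 * a j - 2) := by
      refine setIntegral_mono_on ?_ ((intI j).integrableOn) measurableSet_ball ?_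
      · exact (integrableOn_const (by exact measure_ball_lt_top.ne))
      · intro y hy
        have hy' := hrU hy
        have : ζ y = 1 := interior_subset (s := {x | ζ x = 1}) hy'.1
        rw [this, one_pow, mul_one]
        exact Real.rpow_le_rpow (by linarith) hy'.2 (hP0 j)
    rw [setIntegral_const, smul_eq_mul] at h1
    calc _ = volume.real (ball x r) * t^(P j) := mul_comm _ _
      _ ≤ _ := h1
      _ ≤ _ := setIntegral_le_integral (intI j) (Filter.Eventually.of_forall (nn j)))
  linarith
end mo
end IHE

end

noncomputable section
set_option linter.unusedSectionVars false
set_option linter.style.longLine false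
set_option linter.unusedSimpArgs false
namespace IHE
section rh
variable {n : ℕ}

lemma fd_apply (L : (Fin n → ℝ) →L[ℝ] ℝ) (v : Fin n → ℝ) : L v = ∑ i, v i * L (Pi.single i 1) := by
  conv_lhs => rw [← Finset.univ_sum_single v]
  rw [map_sum]
  refine Finset.sum_congr rfl fun i _ => ?_
  have : (Pi.single i (v i) : Fin n → ℝ) = v i • Pi.single i 1 := by
    rw [← Pi.single_smul]; simp
  rw [this, map_smul, smul_eq_mul]

lemma fd_norm (w : (Fin n → ℝ) → ℝ) (x : Fin n → ℝ) : ‖fderiv ℝ w x‖ ≤ ∑ i, |pd i w x| := by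
  refine ContinuousLinearMap.opNorm_le_bound _ (by positivity) fun v => ?_
  rw [fd_apply, Finset.sum_mul]
  refine (Finset.abs_sum_le_sum_abs _ _).trans (Finset.sum_le_sum fun i _ => ?_)
  rw [abs_mul, mul_comm]
  have := norm_le_pi_norm v i
  rw [Real.norm_eq_abs] at this
  unfold pd
  gcongr

lemma sob (hn : 3 ≤ n) : ∃ C : ℝ, 0 ≤ C ∧ ∀ ψ : (Fin n → ℝ) → ℝ, ContDiff ℝ 1 ψ → HasCompactSupport ψ →
    ∫ x, (ψ x^2)^((n:ℝ)/(n-2)) ≤ (C * ∫ x, ∑ m, (pd m ψ x)^2)^((n:ℝ)/(n-2)) := by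
  have hn3 : (3:ℝ) ≤ n := by exact_mod_cast hn
  set χ : ℝ := (n:ℝ)/(n-2) with hχ
  have hχ0 : 0 < χ := by apply div_pos <;> linarith
  let K : NNReal := SNormLESNormFDerivOfEqConst ℝ (volume : Measure (Fin n → ℝ)) 2
  refine ⟨(K:ℝ)^2 * n, by positivity, fun ψ hψ hc => ?_⟩
  obtain ⟨r, hr⟩ : ∃ r : NNReal, (r:ℝ) = 2*χ := ⟨⟨2*χ, by positivity⟩, rfl⟩
  have hp' : (r : ℝ)⁻¹ = ((2:NNReal):ℝ)⁻¹ - (Module.finrank ℝ (Fin n → ℝ) : ℝ)⁻¹ := by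
    have : (n:ℝ) - 2 ≠ 0 := by linarith
    have : (n:ℝ) ≠ 0 := by linarith
    rw [hr]
    simp only [Module.finrank_fin_fun, hχ]
    push_cast
    field_simp
  have key := eLpNorm_le_eLpNorm_fderiv_of_eq (μ := (volume : Measure (Fin n → ℝ))) hψ hc (p := 2) (by norm_num) (by simp; omega) hp'
  have m1 : MemLp ψ (r : ENNReal) volume := hψ.continuous.memLp_of_hasCompactSupport hc
  have m2 : MemLp (fderiv ℝ ψ) ((2 : NNReal) : ENNReal) volume :=
    (hψ.continuous_fderiv (by norm_num)).memLp_of_hasCompactSupport (hc.fderiv (𝕜 := ℝ))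
  rw [m1.eLpNorm_eq_integral_rpow_norm (by
      have : r ≠ 0 := by
        intro h; rw [h] at hr; simp at hr; linarith
      simpa using this) (by simp),
    m2.eLpNorm_eq_integral_rpow_norm (by simp) (by simp)] at key
  simp only [ENNReal.coe_toReal, hr] at key
  have i1 : 0 ≤ ∫ x, ‖ψ x‖^(2*χ) := integral_nonneg fun x => by positivity
  have i2 : 0 ≤ ∫ x, ‖fderiv ℝ ψ x‖^((2:NNReal):ℝ) := integral_nonneg fun x => by positivity
  have key2 : (∫ x, ‖ψ x‖^(2*χ))^((2*χ)⁻¹) ≤ K * (∫ x, ‖fderiv ℝ ψ x‖^((2:NNReal):ℝ))^(((2:NNReal):ℝ)⁻¹) := by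
    rw [show (SNormLESNormFDerivOfEqConst ℝ (volume : Measure (Fin n → ℝ)) ((2:NNReal):ℝ) : ENNReal) = ENNReal.ofReal (K:ℝ) from (ENNReal.ofReal_coe_nnreal).symm,
      ← ENNReal.ofReal_mul (by positivity)] at key
    exact (ENNReal.ofReal_le_ofReal_iff (by positivity)).1 key
  have e1 : ∫ x, (ψ x^2)^χ = ∫ x, ‖ψ x‖^(2*χ) := by
    refine integral_congr_ae (Filter.Eventually.of_forall fun x => ?_)
    show (ψ x^2)^χ = ‖ψ x‖^(2*χ)
    rw [Real.rpow_mul (norm_nonneg _)]; simp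
  have key3 := Real.rpow_le_rpow (by positivity) key2 (show 0 ≤ 2*χ by positivity)
  rw [← Real.rpow_mul i1, inv_mul_cancel₀ (by positivity), Real.rpow_one] at key3
  rw [e1]
  refine key3.trans ?_
  rw [Real.rpow_mul (by positivity)]
  refine Real.rpow_le_rpow (by positivity) ?_ hχ0.le
  rw [Real.mul_rpow (by positivity) (by positivity), ← Real.rpow_mul i2]
  norm_num
  rw [mul_assoc]
  refine mul_le_mul_of_nonneg_left ?_ (by positivity)
  rw [← integral_const_mul]
  refine integral_mono_of_nonneg (Filter.Eventually.of_forall fun x => by positivity) ?_ (Filter.Eventually.of_forall fun x => ?_)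
  · refine Integrable.const_mul (Continuous.integrable_of_hasCompactSupport ?_ ?_) _
    · refine continuous_finsetSum _ fun i _ => ?_
      exact ((pd_contDiff (m := 0) hψ (by norm_num)).continuous).pow 2
    · refine HasCompactSupport.of_support_subset_isCompact hc.isCompact fun x hx => ?_
      by_contra h
      apply hx
      simp [pd, fderiv_of_notMem_tsupport (𝕜 := ℝ) h]
  · have h1 := fd_norm ψ x
    have h2 := sum_abs_sq (n := n) (fun m => pd m ψ x)
    calc ‖fderiv ℝ ψ x‖^2 ≤ (∑ i, |pd i ψ x|)^2 := by gcongr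
      _ ≤ _ := h2

lemma psi_pt {η w : (Fin n → ℝ) → ℝ} (hη : ContDiff ℝ 1 η) (hw : ContDiff ℝ 1 w) (hw0 : ∀ x, 0 < w x) (q : ℝ) (m : Fin n) (x : Fin n → ℝ) :
    (pd m (fun y => η y * w y^(q/2)) x)^2 ≤ 2 * (pd m η x)^2 * w x^q + q^2/2 * ((w x^q/w x^2) * η x^2 * (pd m w x)^2) := by
  have hd : DifferentiableAt ℝ w x := hw.differentiable (by norm_num) x
  have hp : HasDerivAt (fun t : ℝ => t^(q/2)) (q/2 * w x^(q/2-1)) (w x) := Real.hasDerivAt_rpow_const (Or.inl (hw0 x).ne')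
  have h1 : pd m (fun y => w y^(q/2)) x = q/2 * w x^(q/2-1) * pd m w x := pd_comp hp hd
  have h2 : DifferentiableAt ℝ (fun y => w y^(q/2)) x := hd.rpow_const (Or.inl (hw0 x).ne')
  have h3 : pd m (fun y => η y * w y^(q/2)) x = η x * (q/2 * w x^(q/2-1) * pd m w x) + pd m η x * w x^(q/2) := by
    rw [pd_mul (hη.differentiable (by norm_num) x) h2, h1]; ring
  have e0 : (w x^(q/2))^2 = w x^q := by
    rw [← Real.rpow_natCast, ← Real.rpow_mul (hw0 x).le]; congr 1; push_cast; ring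
  have e1 : (w x^(q/2-1)) = w x^(q/2) / w x := Real.rpow_sub_one (hw0 x).ne' _
  have e2 : w x^q / w x^2 = (w x^(q/2) / w x)^2 := by rw [div_pow, e0]
  rw [h3, e1, e2, ← e0]
  nlinarith [sq_nonneg (η x * (q/2 * (w x^(q/2)/w x) * pd m w x) - pd m η x * w x^(q/2))]

theorem rh (hn : 3 ≤ n) (κ : ℕ) (hκ : κ + 2 ≤ n) (Λ : ℝ) (hΛ : 1 ≤ Λ) : ∃ C2 : ℝ, 0 ≤ C2 ∧ ∀ (u G w W η : (Fin n → ℝ) → ℝ) (q : ℝ),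
    ContDiff ℝ 2 u → HasCompactSupport u → ContDiff ℝ 1 G → HasCompactSupport G → ContDiff ℝ 2 w → (∀ x, 0 < w x) → Continuous W →
    ContDiff ℝ 1 η → HasCompactSupport η → 1 ≤ q → (∀ x ∈ tsupport η, PW Λ κ u G w (W x) x) →
    (∀ ε > 0, ∃ Γ : (Fin n → ℝ) → ℝ, ContDiff ℝ 2 Γ ∧ ∀ x ∈ tsupport η, (∀ i, |pd i Γ x - pd i G x| ≤ ε) ∧ ∀ i j, |pd i (pd j Γ) x| ≤ Λ * W x) →
    (∀ x ∈ tsupport η, W x^q ≤ 2 * w x^q ∧ w x^q ≤ 2 * W x^q) →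
    ∫ x, (η x^2 * W x^q)^((n:ℝ)/(n-2)) ≤ (C2 * q^2 * ∫ x, W x^(κ+2) * W x^q * (η x^2 + ∑ m, (pd m η x)^2))^((n:ℝ)/(n-2)) := by
  have hn3 : (3:ℝ) ≤ n := by exact_mod_cast hn
  set χ : ℝ := (n:ℝ)/(n-2) with hχ
  have hχ0 : 0 < χ := by apply div_pos <;> linarith
  obtain ⟨S, hS0, hS⟩ := sob hn
  obtain ⟨C0, hC0, hE⟩ := energy (n := n) (by omega) κ hκ Λ hΛ
  refine ⟨4 * (S * (2 + C0/2)), by positivity, fun u G w W η q hu huc hG hGc hw hw0 hW hη hηc hq hPW hΓ hWw => ?_⟩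
  have E := hE u G w W η q hu huc hG hGc hw hw0 hW hη hηc hq hPW hΓ
  have hw1 : ContDiff ℝ 1 w := hw.of_le (by norm_num)
  have hψ : ContDiff ℝ 1 (fun y => η y * w y^(q/2)) := hη.mul (hw1.rpow_const_of_ne fun x => (hw0 x).ne')
  have hψc : HasCompactSupport (fun y => η y * w y^(q/2)) := hηc.mul_right
  have F := hS _ hψ hψc
  have hWt : ∀ x ∈ tsupport η, 1 ≤ W x := fun x hx => (hPW x hx).1
  have cη : ∀ m, Continuous (pd m η) := fun m => (pd_contDiff (m := 0) hη (by norm_num)).continuous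
  have cw : ∀ m, Continuous (pd m w) := fun m => (pd_contDiff (m := 0) hw1 (by norm_num)).continuous
  have η0 : ∀ x, x ∉ tsupport η → η x = 0 := fun x hx => image_eq_zero_of_notMem_tsupport hx
  have dη0 : ∀ x, x ∉ tsupport η → ∀ m, pd m η x = 0 := fun x hx m => by
    simp [pd, fderiv_of_notMem_tsupport (𝕜 := ℝ) hx]
  have cpt : ∀ g : (Fin n → ℝ) → ℝ, Continuous g → (∀ x, x ∉ tsupport η → g x = 0) → Integrable g := fun g hg h0 =>
    hg.integrable_of_hasCompactSupport (HasCompactSupport.of_support_subset_isCompact hηc.isCompact fun x hx => by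
      by_contra h; exact hx (h0 x h))
  have cwq : Continuous fun x => w x^q := hw.continuous.rpow_const fun x => Or.inl (hw0 x).ne'
  set J : ℝ := ∫ x, W x^(κ+2) * w x^q * (η x^2 + ∑ m, (pd m η x)^2) with hJ
  have iJ : Integrable fun x => W x^(κ+2) * w x^q * (η x^2 + ∑ m, (pd m η x)^2) := by
    refine cpt _ (by fun_prop) fun x hx => ?_
    simp [η0 x hx, dη0 x hx]
  have i1 : Integrable fun x => (w x^q/w x^2) * η x^2 * (∑ m, (pd m w x)^2) := by
    refine cpt _ ?_ fun x hx => ?_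
    · have : Continuous fun x => w x^q/w x^2 := cwq.div (hw.continuous.pow 2) fun x => (pow_pos (hw0 x) 2).ne'
      have h2 := hη.continuous
      fun_prop
    · simp [η0 x hx]
  have B1 : ∫ x, ∑ m, (pd m (fun y => η y * w y^(q/2)) x)^2 ≤ (2 + C0/2) * q^2 * J := by
    have s1 : ∫ x, ∑ m, (pd m (fun y => η y * w y^(q/2)) x)^2 ≤ ∫ x, (2 * (W x^(κ+2) * w x^q * (η x^2 + ∑ m, (pd m η x)^2)) + q^2/2 * ((w x^q/w x^2) * η x^2 * (∑ m, (pd m w x)^2))) := by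
      refine integral_mono_of_nonneg (Filter.Eventually.of_forall fun x => by positivity) ((iJ.const_mul _).add (i1.const_mul _)) (Filter.Eventually.of_forall fun x => ?_)
      have hsum : ∑ m, (pd m (fun y => η y * w y^(q/2)) x)^2 ≤ 2 * (w x^q * ∑ m, (pd m η x)^2) + q^2/2 * ((w x^q/w x^2) * η x^2 * (∑ m, (pd m w x)^2)) := by
        refine (Finset.sum_le_sum fun m _ => psi_pt hη hw1 hw0 q m x).trans (le_of_eq ?_)
        rw [Finset.sum_add_distrib, Finset.mul_sum, Finset.mul_sum, Finset.mul_sum, Finset.mul_sum]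
        congr 1
        exact Finset.sum_congr rfl fun m _ => by ring
      refine hsum.trans ?_
      have hwq : 0 < w x^q := Real.rpow_pos_of_pos (hw0 x) q
      have : w x^q * ∑ m, (pd m η x)^2 ≤ W x^(κ+2) * w x^q * (η x^2 + ∑ m, (pd m η x)^2) := by
        by_cases h : x ∈ tsupport η
        · have h1 : 1 ≤ W x^(κ+2) := one_le_pow₀ (hWt x h)
          have h2 : 0 ≤ ∑ m, (pd m η x)^2 := by positivity
          calc w x^q * ∑ m, (pd m η x)^2 = 1 * w x^q * (0 + ∑ m, (pd m η x)^2) := by ring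
            _ ≤ _ := by gcongr; positivity
        · simp [η0 x h, dη0 x h]
      show _ ≤ 2 * (W x^(κ+2) * w x^q * (η x^2 + ∑ m, (pd m η x)^2)) + q^2/2 * ((w x^q/w x^2) * η x^2 * (∑ m, (pd m w x)^2))
      linarith
    rw [integral_add (iJ.const_mul _) (i1.const_mul _), integral_const_mul, integral_const_mul] at s1
    have hJ0 : 0 ≤ J := integral_nonneg fun x => by
      by_cases h : x ∈ tsupport η
      · have := hWt x h
        have := (hw0 x).le
        show 0 ≤ W x^(κ+2) * w x^q * (η x^2 + ∑ m, (pd m η x)^2)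
        positivity
      · simp [η0 x h, dη0 x h]
    have hq2 : 1 ≤ q^2 := one_le_pow₀ hq
    have s2 : q^2/2 * (∫ x, (w x^q/w x^2) * η x^2 * (∑ m, (pd m w x)^2)) ≤ q^2/2 * (C0 * J) := by gcongr
    have s3 : 2 * J ≤ 2 * (q^2 * J) := by nlinarith
    nlinarith
  -- replacing `w` by `W`
  have B2 : J ≤ 2 * ∫ x, W x^(κ+2) * W x^q * (η x^2 + ∑ m, (pd m η x)^2) := by
    rw [← integral_const_mul]
    have hWm : Continuous fun x => max (W x) 1 := hW.max continuous_const
    have iW : Integrable fun x => 2 * (W x^(κ+2) * W x^q * (η x^2 + ∑ m, (pd m η x)^2)) := by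
      refine Integrable.const_mul ?_ _
      have hc : Continuous fun x => (max (W x) 1)^(κ+2) * (max (W x) 1)^q * (η x^2 + ∑ m, (pd m η x)^2) := by
        have : Continuous fun x => (max (W x) 1)^q := hWm.rpow_const fun x => Or.inl (by positivity)
        have h2 := hη.continuous
        fun_prop
      refine (cpt _ hc fun x hx => by simp [η0 x hx, dη0 x hx]).congr (Filter.Eventually.of_forall fun x => ?_)
      by_cases h : x ∈ tsupport η
      · simp only [max_eq_left (hWt x h)]
      · simp [η0 x h, dη0 x h]
    refine integral_mono iJ iW fun x => ?_
    show W x^(κ+2) * w x^q * (η x^2 + ∑ m, (pd m η x)^2) ≤ 2 * (W x^(κ+2) * W x^q * (η x^2 + ∑ m, (pd m η x)^2))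
    by_cases h : x ∈ tsupport η
    · have := hWt x h
      have h0 : 0 ≤ W x := by linarith
      calc _ ≤ W x^(κ+2) * (2 * W x^q) * (η x^2 + ∑ m, (pd m η x)^2) := by gcongr; exact (hWw x h).2
        _ = _ := by ring
    · simp [η0 x h, dη0 x h]
  have B3 : ∫ x, (η x^2 * W x^q)^χ ≤ 2^χ * ∫ x, ((η x * w x^(q/2))^2)^χ := by
    rw [← integral_const_mul]
    refine integral_mono_of_nonneg (Filter.Eventually.of_forall fun x => ?_) ?_ (Filter.Eventually.of_forall fun x => ?_)
    · show 0 ≤ (η x^2 * W x^q)^χ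
      by_cases h : x ∈ tsupport η
      · have := hWt x h
        have h0 : 0 ≤ W x := by linarith
        positivity
      · rw [η0 x h]; simp [hχ0.ne']
    · refine (cpt _ ((hψ.continuous.pow 2).rpow_const fun x => Or.inr hχ0.le) fun x hx => ?_).const_mul _
      simp [η0 x hx, hχ0.ne']
    · show (η x^2 * W x^q)^χ ≤ 2^χ * ((η x * w x^(q/2))^2)^χ
      by_cases h : x ∈ tsupport η
      · have := hWt x h
        have h0 : 0 ≤ W x := by linarith
        rw [← Real.mul_rpow (by norm_num) (by positivity)]
        refine Real.rpow_le_rpow (by positivity) ?_ hχ0.le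
        have e0 : (w x^(q/2))^2 = w x^q := by
          rw [← Real.rpow_natCast, ← Real.rpow_mul (hw0 x).le]; congr 1; push_cast; ring
        rw [mul_pow, e0]
        have := mul_le_mul_of_nonneg_left (hWw x h).1 (sq_nonneg (η x))
        linarith
      · rw [η0 x h]; simp [hχ0.ne']
  have hD0 : 0 ≤ ∫ x, ∑ m, (pd m (fun y => η y * w y^(q/2)) x)^2 := integral_nonneg fun x => by positivity
  have hA0 : 0 ≤ 2 * (S * ∫ x, ∑ m, (pd m (fun y => η y * w y^(q/2)) x)^2) := mul_nonneg zero_le_two (mul_nonneg hS0 hD0)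
  have hf : 2 * (S * ∫ x, ∑ m, (pd m (fun y => η y * w y^(q/2)) x)^2) ≤ 4 * (S * (2 + C0/2)) * q^2 * ∫ x, W x^(κ+2) * W x^q * (η x^2 + ∑ m, (pd m η x)^2) := by
    have t1 := mul_le_mul_of_nonneg_left B1 hS0
    have t2 := mul_le_mul_of_nonneg_left B2 (show 0 ≤ S * ((2 + C0/2) * q^2) from mul_nonneg hS0 (by positivity))
    nlinarith
  have hF2 : 2^χ * ∫ x, ((η x * w x^(q/2))^2)^χ ≤ 2^χ * (S * ∫ x, ∑ m, (pd m (fun y => η y * w y^(q/2)) x)^2)^χ :=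
    mul_le_mul_of_nonneg_left F (by positivity)
  rw [← Real.mul_rpow (by norm_num) (mul_nonneg hS0 hD0)] at hF2
  exact (B3.trans hF2).trans (Real.rpow_le_rpow hA0 hf hχ0.le)

end rh
end IHE

end

noncomputable section
set_option linter.unusedSectionVars false
set_option linter.style.longLine false
set_option linter.unusedSimpArgs false
namespace IHE
section mor
variable {n : ℕ}

lemma young1 {p β s a : ℝ} (hp : 1 < p) (hs : 0 < s) (ha : 0 ≤ a) : a ≤ s^β * a^p + s^(-(β/(p-1))) := by
  have h1 : 0 < p - 1 := by linarith
  by_cases h : a ≤ s^(-(β/(p-1)))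
  · have : 0 ≤ s^β * a^p := by positivity
    linarith
  · push Not at h
    have ha0 : 0 < a := lt_trans (by positivity) h
    have h2 : s^(-β) ≤ a^(p-1) := by
      have := Real.rpow_le_rpow (by positivity) h.le h1.le
      rw [← Real.rpow_mul hs.le] at this
      convert this using 2
      field_simp
    have h3 : 1 ≤ s^β * a^(p-1) := by
      calc 1 = s^β * s^(-β) := by rw [← Real.rpow_add hs]; simp
        _ ≤ _ := by gcongr
    have h4 : a^p = a^(p-1) * a := by rw [← Real.rpow_add_one ha0.ne']; congr 1; ring
    have h5 : 0 < s^(-(β/(p-1))) := by positivity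
    rw [h4, ← mul_assoc]
    nlinarith

lemma swapI (F : ℝ × (Fin n → ℝ) → ℝ) (hF : Continuous F) (r : ℝ) :
    ∫ y in closedBall (0 : Fin n → ℝ) r, ∫ s in Ioc (0:ℝ) 1, F (s,y) = ∫ s in Ioc (0:ℝ) 1, ∫ y in closedBall (0 : Fin n → ℝ) r, F (s,y) := by
  refine integral_integral_swap (f := fun y s => F (s,y)) ?_
  rw [Measure.prod_restrict]
  have h : Continuous (Function.uncurry fun (y : Fin n → ℝ) (s : ℝ) => F (s,y)) := by
    have : (Function.uncurry fun (y : Fin n → ℝ) (s : ℝ) => F (s,y)) = F ∘ Prod.swap := rfl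
    rw [this]; exact hF.comp continuous_swap
  refine IntegrableOn.mono_set (h.continuousOn.integrableOn_compact ((isCompact_closedBall 0 r).prod (isCompact_Icc (a := (0:ℝ)) (b := 1)))) ?_
  exact prod_mono le_rfl Ioc_subset_Icc_self

lemma morrey0 (hn : 1 ≤ n) {p : ℝ} (hp : (n:ℝ) < p) {r : ℝ} (hr : 0 < r) : ∃ C : ℝ, 0 ≤ C ∧ ∀ g : (Fin n → ℝ) → ℝ, ContDiff ℝ 1 g →
    |g 0| ≤ C * (1 + (∫ y in closedBall (0 : Fin n → ℝ) r, |g y|^p) + ∫ y in closedBall (0 : Fin n → ℝ) r, ‖fderiv ℝ g y‖^p) := by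
  have hn1 : (1:ℝ) ≤ n := by exact_mod_cast hn
  obtain ⟨β, hβ1, hβ2⟩ : ∃ β : ℝ, n - 1 < β ∧ β < p - 1 := exists_between (by linarith)
  set B := closedBall (0 : Fin n → ℝ) r with hB
  have hBc : IsCompact B := isCompact_closedBall 0 r
  set V : ℝ := (volume.real B) with hV
  have hV0 : 0 < V := by
    rw [hV, measureReal_def]
    refine ENNReal.toReal_pos (measure_closedBall_pos _ _ hr).ne' hBc.measure_lt_top.ne
  set c1 : ℝ := ∫ s in Ioc (0:ℝ) 1, s^(β - n) with hc1
  set c2 : ℝ := ∫ s in Ioc (0:ℝ) 1, s^(-(β/(p-1))) with hc2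
  have c10 : 0 ≤ c1 := setIntegral_nonneg measurableSet_Ioc fun s hs => Real.rpow_nonneg hs.1.le _
  have c20 : 0 ≤ c2 := setIntegral_nonneg measurableSet_Ioc fun s hs => Real.rpow_nonneg hs.1.le _
  refine ⟨(1 + V + r * c1 + r * c2 * V)/V, by positivity, fun g hg => ?_⟩
  have hgc := hg.continuous
  have hD : Continuous (fun y => ‖fderiv ℝ g y‖) := (hg.continuous_fderiv (by norm_num)).norm
  set N0 := ∫ y in B, |g y|^p with hN0
  set N1 := ∫ y in B, ‖fderiv ℝ g y‖^p with hN1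
  have N00 : 0 ≤ N0 := integral_nonneg fun y => by positivity
  have N10 : 0 ≤ N1 := integral_nonneg fun y => by positivity
  have hp0 : 0 < p := by linarith
  have cD : Continuous fun y => ‖fderiv ℝ g y‖^p := hD.rpow_const fun y => Or.inr hp0.le
  have cF : Continuous fun z : ℝ × (Fin n → ℝ) => ‖fderiv ℝ g (z.1 • z.2)‖ := hD.comp (continuous_fst.smul continuous_snd)
  -- pointwise
  have pt : ∀ y ∈ B, |g 0| ≤ |g y| + r * ∫ s in Ioc (0:ℝ) 1, ‖fderiv ℝ g (s • y)‖ := by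
    intro y hy
    have hd : ∀ s : ℝ, HasDerivAt (fun s : ℝ => g (s • y)) (fderiv ℝ g (s • y) y) s := by
      intro s
      have h1 : HasFDerivAt g (fderiv ℝ g (s • y)) (s • y) := (hg.differentiable (by norm_num) _).hasFDerivAt
      have h2 : HasDerivAt (fun s : ℝ => s • y) y s := by simpa using (hasDerivAt_id s).smul_const y
      exact h1.comp_hasDerivAt s h2
    have cd : Continuous fun s : ℝ => fderiv ℝ g (s • y) y :=
      ((hg.continuous_fderiv (by norm_num)).comp (continuous_id.smul continuous_const)).clm_apply continuous_const
    have ftc := intervalIntegral.integral_eq_sub_of_hasDerivAt (a := 0) (b := 1) (fun s _ => hd s) (cd.intervalIntegrable _ _)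
    simp only [one_smul, zero_smul] at ftc
    have hle : |∫ s in (0:ℝ)..1, fderiv ℝ g (s • y) y| ≤ r * ∫ s in Ioc (0:ℝ) 1, ‖fderiv ℝ g (s • y)‖ := by
      rw [intervalIntegral.integral_of_le zero_le_one, ← integral_const_mul]
      refine (norm_integral_le_integral_norm (f := fun s : ℝ => fderiv ℝ g (s • y) y)).trans ?_
      have c3 : Continuous fun s : ℝ => r * ‖fderiv ℝ g (s • y)‖ := continuous_const.mul (hD.comp (continuous_id.smul continuous_const))
      refine integral_mono_of_nonneg (Filter.Eventually.of_forall fun s => norm_nonneg _) ?_ (Filter.Eventually.of_forall fun s => ?_)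
      · exact (c3.integrableOn_Icc (a := 0) (b := 1)).mono_set Ioc_subset_Icc_self
      · have hyr : ‖y‖ ≤ r := by simpa [hB] using hy
        calc ‖fderiv ℝ g (s • y) y‖ ≤ ‖fderiv ℝ g (s • y)‖ * ‖y‖ := ContinuousLinearMap.le_opNorm _ _
          _ ≤ ‖fderiv ℝ g (s • y)‖ * r := by gcongr
          _ = _ := mul_comm _ _
    rw [ftc] at hle
    have := abs_sub_abs_le_abs_sub (g 0) (g y)
    rw [abs_sub_comm] at this
    linarith
  -- integrate over `B`
  have int1 : ∀ φ : (Fin n → ℝ) → ℝ, Continuous φ → IntegrableOn φ B := fun φ h => h.continuousOn.integrableOn_compact hBc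
  have cI : Continuous fun y : Fin n → ℝ => ∫ s in Ioc (0:ℝ) 1, ‖fderiv ℝ g (s • y)‖ := by
    simp_rw [← intervalIntegral.integral_of_le (zero_le_one' ℝ)]
    refine intervalIntegral.continuous_parametric_intervalIntegral_of_continuous' ?_ 0 1
    exact hD.comp (continuous_snd.smul continuous_fst)
  have I1 : V * |g 0| ≤ (∫ y in B, |g y|) + r * ∫ y in B, ∫ s in Ioc (0:ℝ) 1, ‖fderiv ℝ g (s • y)‖ := by
    have h := setIntegral_mono_on (int1 (fun _ => |g 0|) continuous_const) (int1 (fun y => |g y| + r * ∫ s in Ioc (0:ℝ) 1, ‖fderiv ℝ g (s • y)‖) (hgc.abs.add (continuous_const.mul cI))) hBc.measurableSet pt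
    rw [setIntegral_const, integral_add (int1 _ hgc.abs) (int1 (fun y => r * ∫ s in Ioc (0:ℝ) 1, ‖fderiv ℝ g (s • y)‖) (continuous_const.mul cI)), integral_const_mul] at h
    simpa using h
  have I2 : ∫ y in B, |g y| ≤ N0 + V := by
    have h := setIntegral_mono_on (int1 (fun y => |g y|) hgc.abs) (int1 (fun y => |g y|^p + 1) ((hgc.abs.rpow_const fun y => Or.inr hp0.le).add continuous_const)) hBc.measurableSet (fun y _ => by
      rcases le_total (|g y|) 1 with h1 | h1
      · have : 0 ≤ |g y|^p := by positivity
        linarith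
      · have := Real.self_le_rpow_of_one_le h1 (by linarith : 1 ≤ p)
        linarith)
    rw [integral_add (int1 _ (hgc.abs.rpow_const fun y => Or.inr hp0.le)) (int1 _ continuous_const), setIntegral_const] at h
    simpa using h
  have I3 : ∫ y in B, ∫ s in Ioc (0:ℝ) 1, ‖fderiv ℝ g (s • y)‖ ≤ c1 * N1 + c2 * V := by
    rw [hB, swapI (fun z => ‖fderiv ℝ g (z.1 • z.2)‖) cF r, ← hB]
    have t1 : IntegrableOn (fun s : ℝ => s^(β - n)) (Ioc 0 1) := by
      have := intervalIntegral.intervalIntegrable_rpow' (a := 0) (b := 1) (r := β - n) (by linarith)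
      rwa [intervalIntegrable_iff_integrableOn_Ioc_of_le zero_le_one] at this
    have t2 : IntegrableOn (fun s : ℝ => s^(-(β/(p-1)))) (Ioc 0 1) := by
      have hh : β/(p-1) < 1 := by rw [div_lt_one (by linarith)]; exact hβ2
      have := intervalIntegral.intervalIntegrable_rpow' (a := 0) (b := 1) (r := -(β/(p-1))) (by linarith)
      rwa [intervalIntegrable_iff_integrableOn_Ioc_of_le zero_le_one] at this
    calc ∫ s in Ioc (0:ℝ) 1, ∫ y in B, ‖fderiv ℝ g (s • y)‖ ≤ ∫ s in Ioc (0:ℝ) 1, (s^(β - n) * N1 + s^(-(β/(p-1))) * V) := by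
          refine integral_mono_of_nonneg (Filter.Eventually.of_forall fun s => integral_nonneg fun y => norm_nonneg _) ((t1.mul_const _).add (t2.mul_const _)) ?_
          rw [Filter.EventuallyLE, ae_restrict_iff' measurableSet_Ioc]
          refine Filter.Eventually.of_forall fun s hs => ?_
          have cs : Continuous fun y : Fin n → ℝ => ‖fderiv ℝ g (s • y)‖^p := cD.comp (continuous_const_smul s)
          have h1 : ∫ y in B, ‖fderiv ℝ g (s • y)‖ ≤ s^β * (∫ y in B, ‖fderiv ℝ g (s • y)‖^p) + s^(-(β/(p-1))) * V := by
            have h := setIntegral_mono_on (int1 (fun y => ‖fderiv ℝ g (s • y)‖) (hD.comp (continuous_const_smul s))) (int1 (fun y => s^β * ‖fderiv ℝ g (s • y)‖^p + s^(-(β/(p-1)))) ((continuous_const.mul cs).add continuous_const)) hBc.measurableSet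
              (fun y _ => young1 (β := β) (by linarith : 1 < p) hs.1 (norm_nonneg _))
            rw [integral_add (int1 (fun y => s^β * ‖fderiv ℝ g (s • y)‖^p) (continuous_const.mul cs)) (int1 (fun _ => s^(-(β/(p-1)))) continuous_const), setIntegral_const, integral_const_mul] at h
            refine h.trans (le_of_eq ?_)
            simp [hV, mul_comm]
          have h2 : ∫ y in B, ‖fderiv ℝ g (s • y)‖^p ≤ s^(-(n:ℝ)) * N1 := by
            rw [Measure.setIntegral_comp_smul volume (fun y => ‖fderiv ℝ g y‖^p) B hs.1.ne']
            rw [Module.finrank_fin_fun, abs_of_pos (by have := hs.1; positivity), smul_eq_mul, Real.rpow_neg hs.1.le, Real.rpow_natCast]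
            refine mul_le_mul_of_nonneg_left ?_ (by have := hs.1; positivity)
            refine setIntegral_mono_set (int1 _ cD) (Filter.Eventually.of_forall fun y => by positivity) (HasSubset.Subset.eventuallyLE ?_)
            rintro _ ⟨y, hy, rfl⟩
            simp only [hB, mem_closedBall, dist_zero_right] at hy ⊢
            show ‖s • y‖ ≤ r
            rw [norm_smul, Real.norm_of_nonneg hs.1.le]
            nlinarith [hs.2, hs.1, norm_nonneg y]
          have h3 : s^(β - n) = s^β * s^(-(n:ℝ)) := by rw [← Real.rpow_add hs.1]; rfl
          have h4 := mul_le_mul_of_nonneg_left h2 (Real.rpow_nonneg hs.1.le β)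
          show ∫ y in B, ‖fderiv ℝ g (s • y)‖ ≤ s^(β - n) * N1 + s^(-(β/(p-1))) * V
          rw [h3]; nlinarith
      _ = c1 * N1 + c2 * V := by
          rw [integral_add (t1.mul_const _) (t2.mul_const _), integral_mul_const, integral_mul_const]
  have I4 : V * |g 0| ≤ (1 + V + r * c1 + r * c2 * V) * (1 + N0 + N1) := by
    have := mul_le_mul_of_nonneg_left I3 hr.le
    have a1 : 0 ≤ r * c1 := by positivity
    have a2 : 0 ≤ r * c2 * V := by positivity
    have a3 : 0 ≤ r * c1 * N0 := by positivity
    have a4 : 0 ≤ r * c2 * V * (N0 + N1) := by positivity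
    have a5 : 0 ≤ V * (N0 + N1) := by positivity
    nlinarith
  rw [div_mul_eq_mul_div, le_div_iff₀ hV0]
  linarith

lemma setint_shift (f : (Fin n → ℝ) → ℝ) (x : Fin n → ℝ) (r : ℝ) :
    ∫ y in closedBall (0 : Fin n → ℝ) r, f (x + y) = ∫ y in closedBall x r, f y := by
  have h := (measurePreserving_add_left (volume : Measure (Fin n → ℝ)) x).setIntegral_preimage_emb (measurableEmbedding_addLeft x) f (closedBall x r)
  rw [← h]
  congr 2
  ext y; simp [dist_eq_norm]

theorem morrey (hn : 1 ≤ n) {p : ℝ} (hp : (n:ℝ) < p) {r : ℝ} (hr : 0 < r) : ∃ C : ℝ, 0 ≤ C ∧ ∀ g : (Fin n → ℝ) → ℝ, ContDiff ℝ 1 g → ∀ x,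
    |g x| ≤ C * (1 + (∫ y in closedBall x r, |g y|^p) + ∫ y in closedBall x r, ‖fderiv ℝ g y‖^p) := by
  obtain ⟨C, hC, h⟩ := morrey0 hn hp hr
  refine ⟨C, hC, fun g hg x => ?_⟩
  have := h (fun y => g (x + y)) (hg.comp (contDiff_const.add contDiff_id))
  simp only [fderiv_comp_add_left, add_zero] at this
  rwa [setint_shift (fun y => |g y|^p), setint_shift (fun y => ‖fderiv ℝ g y‖^p)] at this

end mor
end IHE

end

noncomputable section
set_option linter.unusedSectionVars false
set_option linter.style.longLine false
set_option linter.unusedSimpArgs false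
namespace IHE
section star
variable {n : ℕ}

def w0 (h : ℝ) (v : (Fin n → ℝ) → ℝ) (x : Fin n → ℝ) : ℝ := ∑ l, ddq l h v x

lemma ddq_contDiff {r : WithTop ℕ∞} {v : (Fin n → ℝ) → ℝ} (hv : ContDiff ℝ r v) (l : Fin n) (h : ℝ) : ContDiff ℝ r (ddq l h v) := by
  unfold ddq
  have h1 : ContDiff ℝ r fun x => v (x + h • (Pi.single l 1 : Fin n → ℝ)) := hv.comp (contDiff_id.add contDiff_const)
  have h2 : ContDiff ℝ r fun x => v (x - h • (Pi.single l 1 : Fin n → ℝ)) := hv.comp (contDiff_id.sub contDiff_const)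
  exact ((h1.sub (contDiff_const.mul hv)).add h2).div_const _

lemma w0_contDiff {r : WithTop ℕ∞} {v : (Fin n → ℝ) → ℝ} (hv : ContDiff ℝ r v) (h : ℝ) : ContDiff ℝ r (w0 h v) := by
  unfold w0
  exact ContDiff.sum fun l _ => ddq_contDiff hv l h

lemma pd_shift (v : (Fin n → ℝ) → ℝ) (a x : Fin n → ℝ) (i : Fin n) : pd i (fun y => v (y + a)) x = pd i v (x + a) := by
  unfold pd; rw [fderiv_comp_add_right]

lemma pd_ddq {v : (Fin n → ℝ) → ℝ} (hv : Differentiable ℝ v) (l : Fin n) (h : ℝ) (i : Fin n) : pd i (ddq l h v) = ddq l h (pd i v) := by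
  funext x
  have h1 : Differentiable ℝ fun x => v (x + h • (Pi.single l 1 : Fin n → ℝ)) := hv.comp (differentiable_id.add_const _)
  have h2 : Differentiable ℝ fun x => v (x + (-(h • (Pi.single l 1 : Fin n → ℝ)))) := hv.comp (differentiable_id.add_const _)
  have e : ddq l h v = fun x => (1/h^2) * ((v (x + h • (Pi.single l 1 : Fin n → ℝ)) - 2 * v x) + v (x + (-(h • (Pi.single l 1 : Fin n → ℝ))))) := by
    funext x; unfold ddq; rw [sub_eq_add_neg x]; ring
  rw [e, pd_const_mul _ ((((h1 x).fun_sub ((hv x).const_mul 2))).fun_add (h2 x)), pd_add ((h1 x).fun_sub ((hv x).const_mul 2)) (h2 x),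
    pd_sub (h1 x) ((hv x).const_mul 2), pd_const_mul _ (hv x), pd_shift, pd_shift]
  unfold ddq; rw [sub_eq_add_neg x]; ring

lemma pd_w0 {v : (Fin n → ℝ) → ℝ} (hv : Differentiable ℝ v) (h : ℝ) (i : Fin n) : pd i (w0 h v) = w0 h (pd i v) := by
  funext x
  have hd : ∀ l ∈ Finset.univ, DifferentiableAt ℝ (ddq l h v) x := fun l _ => by
    have h1 : Differentiable ℝ fun x => v (x + h • (Pi.single l 1 : Fin n → ℝ)) := hv.comp (differentiable_id.add_const _)
    have h2 : Differentiable ℝ fun x => v (x - h • (Pi.single l 1 : Fin n → ℝ)) := hv.comp (differentiable_id.sub_const _)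
    unfold ddq
    have h3 : DifferentiableAt ℝ (fun x => v (x + h • (Pi.single l 1 : Fin n → ℝ)) - 2 * v x + v (x - h • (Pi.single l 1 : Fin n → ℝ))) x :=
      ((h1 x).fun_sub ((hv x).const_mul 2)).fun_add (h2 x)
    simp only [div_eq_mul_inv]
    exact h3.mul_const _
  unfold w0
  rw [pd_sum _ hd]
  exact Finset.sum_congr rfl fun l _ => by rw [pd_ddq hv]

lemma gdir1 {Λ h W G Gp Gm p pp pm : ℝ} (hΛ : 1 ≤ Λ) (hh : 0 < h) (hW : 1 ≤ W) (hG : 0 ≤ G) (h1 : |p| ≤ Λ) (h2 : |pp| ≤ Λ) (h3 : |pm| ≤ Λ)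
    (h4 : |pp - p| ≤ Λ*h*W) (h5 : |pm - p| ≤ Λ*h*W) (h6 : |Gp - G| ≤ Λ*h) (h7 : |Gm - G| ≤ Λ*h) (h8 : |Gp+Gm-2*G| ≤ 3*Λ^2*h^2*W) :
    2*G*(p*(pp+pm-2*p)) - 7*Λ^4*h^2*W ≤ Gp*pp^2+Gm*pm^2-2*(G*p^2) := by
  have hΛ34 : Λ^3 ≤ Λ^4 := pow_le_pow_right₀ hΛ (by norm_num)
  have k1 : |(Gp+Gm-2*G)*p^2| ≤ 3*Λ^4*h^2*W := by
    rw [abs_mul, abs_pow]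
    calc _ ≤ (3*Λ^2*h^2*W) * Λ^2 := by gcongr
      _ = _ := by ring
  have k : ∀ q g : ℝ, |q| ≤ Λ → |q - p| ≤ Λ*h*W → |g - G| ≤ Λ*h → |(g-G)*(q^2-p^2)| ≤ 2*Λ^4*h^2*W := by
    intro q g a1 a2 a3
    have a4 : |q + p| ≤ 2*Λ := (abs_add_le _ _).trans (by linarith)
    have e : (g-G)*(q^2-p^2) = (g-G)*((q-p)*(q+p)) := by ring
    rw [e, abs_mul, abs_mul]
    calc |g-G| * (|q-p| * |q+p|) ≤ (Λ*h)*((Λ*h*W)*(2*Λ)) := by gcongr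
      _ = 2*Λ^3*h^2*W := by ring
      _ ≤ _ := by gcongr
  have k2 := abs_le.1 (k pp Gp h2 h4 h6)
  have k3 := abs_le.1 (k pm Gm h3 h5 h7)
  have k1 := abs_le.1 k1
  have e : Gp*pp^2+Gm*pm^2-2*(G*p^2) = 2*G*(p*(pp+pm-2*p)) + G*((pp-p)^2+(pm-p)^2) + (Gp+Gm-2*G)*p^2 + (Gp-G)*(pp^2-p^2) + (Gm-G)*(pm^2-p^2) := by ring
  have : 0 ≤ G*((pp-p)^2+(pm-p)^2) := by positivity
  rw [e]; linarith [k2.1, k3.1, k1.1]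

lemma trTB {T : Matrix (Fin n) (Fin n) ℝ} {v : (Fin n → ℝ) → ℝ} (hv : ContDiff ℝ 2 v) (g : (Fin n → ℝ) → ℝ) (y : Fin n → ℝ) :
    trace (T * AA v g y) = (∑ i, ∑ j, T i j * pd i (pd j v) y) - g y * trace T := by
  have h : trace (T * AA v g y) = ∑ i, ∑ j, T i j * AA v g y i j := by
    conv_lhs => rw [← AA_symm g hv.contDiffAt]
    simp only [trace, diag, Matrix.mul_apply, transpose_apply]
  rw [h]
  simp only [AA_apply, mul_sub, Finset.sum_sub_distrib]
  congr 1
  simp only [trace, diag, Matrix.one_apply, mul_ite, mul_one, mul_zero, Finset.sum_ite_eq, Finset.mem_univ, if_true, Finset.mul_sum]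
  exact Finset.sum_congr rfl fun i _ => mul_comm _ _

/-- hypotheses at a point for the difference inequality -/
def StarH (Λ : ℝ) (κ : ℕ) (v G F : (Fin n → ℝ) → ℝ) (W h : ℝ) (x : Fin n → ℝ) : Prop :=
  1 ≤ W ∧ 0 ≤ G x ∧ G x ≤ Λ ∧ F x ≤ Λ ∧ (∀ i j, |pd i (pd j v) x| ≤ W) ∧
  (∀ y ∈ closedBall x h, GS (κ+2) (AA v (gg G v) y) ∧ SS (κ+2) (AA v (gg G v) y) = F y^(κ+2) ∧ 0 < F y ∧ (∀ m, |pd m v y| ≤ Λ) ∧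
    (∀ m, |pd m v y - pd m v x| ≤ Λ*h*W) ∧ |G y - G x| ≤ Λ*h) ∧
  (∀ l, |ddq l h v x| ≤ Λ*W) ∧
  (∃ (L : (Fin n → ℝ) →L[ℝ] ℝ) (b : ℝ), |b| ≤ Λ ∧ ∀ y ∈ closedBall x h, |G y - G x - (L (y - x) + b * (v y - v x))| ≤ Λ*h^2) ∧
  (∃ (L : (Fin n → ℝ) →L[ℝ] ℝ) (b : ℝ) (c : Fin n → ℝ), |b| ≤ Λ ∧ (∀ m, |c m| ≤ Λ) ∧
    ∀ y ∈ closedBall x h, |F y - F x - (L (y - x) + b * (v y - v x) + ∑ m, c m * (pd m v y - pd m v x))| ≤ Λ*h^2*W^2)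

set_option maxHeartbeats 2000000 in
theorem star (κ : ℕ) (hκ : κ + 2 ≤ n) (Λ : ℝ) (hΛ : 1 ≤ Λ) : ∃ C : ℝ, 0 ≤ C ∧ ∀ (v G F : (Fin n → ℝ) → ℝ) (W h : ℝ) (x : Fin n → ℝ),
    ContDiff ℝ 2 v → 0 < h → StarH Λ κ v G F W h x →
    2*G x*(((n:ℝ)-κ-1)*SS (κ+1) (AA v (gg G v) x))*(∑ m, pd m v x * pd m (w0 h v) x) - C*(∑ m, |pd m (w0 h v) x|) - C*W^(κ+2) ≤
    ∑ i, ∑ j, TT (κ+1) (AA v (gg G v) x) i j * pd i (pd j (w0 h v)) x := by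
  obtain ⟨B, hB, Hb⟩ := TT_bound n (κ+1)
  set L0 : ℝ := 1 + n * Λ^3 with hL0
  set C1 : ℝ := n * (7 * n * Λ^4) * (n * (B * L0^(κ+1))) with hC1
  set C2 : ℝ := (κ+2) * Λ^(κ+1) * (3 * n * Λ^2) with hC2
  set C3 : ℝ := (κ+2) * Λ^(κ+1) * Λ with hC3
  have C10 : 0 ≤ C1 := by positivity
  have C20 : 0 ≤ C2 := by positivity
  have C30 : 0 ≤ C3 := by positivity
  refine ⟨C1 + C2 + C3, by positivity, fun v G F W h x hv hh H => ?_⟩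
  obtain ⟨hW, hG0, hG1, hF1, hD2, hy, hdd, ⟨LG, bG, hbG, hTG⟩, ⟨LF, bF, c, hbF, hcF, hTF⟩⟩ := H
  set A := AA v (gg G v) x with hA
  set T := TT (κ+1) A with hT
  have hAs : Aᵀ = A := AA_symm _ hv.contDiffAt
  have hxx : x ∈ closedBall x h := mem_closedBall_self hh.le
  obtain ⟨hGS, hSS, hF0, hp, -, -⟩ := hy x hxx
  have htr : trace T = ((n:ℝ)-κ-1)*SS (κ+1) A := by rw [hT, trace_TT]; push_cast; ring
  have htr0 : 0 ≤ trace T := by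
    rw [htr]
    have : (κ:ℝ)+2 ≤ n := by exact_mod_cast hκ
    exact mul_nonneg (by linarith) (hGS (κ+1) (by omega)).le
  have hW0 : 0 < W := by linarith
  have htrb : trace T ≤ n * (B * (L0*W)^(κ+1)) := by
    have hAb : ∀ i j, |A i j| ≤ L0 * W := by
      intro i j
      rw [hA, AA_apply]
      have g1 : |gg G v x| ≤ n * Λ^3 := by
        unfold gg normSq grad
        rw [abs_mul, abs_of_nonneg hG0, abs_of_nonneg (by positivity)]
        calc G x * ∑ i, pd i v x^2 ≤ Λ * ∑ i : Fin n, Λ^2 := by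
              refine mul_le_mul hG1 (Finset.sum_le_sum fun i _ => ?_) (by positivity) (by linarith)
              have := (sq_abs (pd i v x)).symm
              rw [this]
              exact pow_le_pow_left₀ (abs_nonneg _) (hp i) 2
          _ = _ := by simp; ring
      have g2 : |gg G v x * (1 : Matrix (Fin n) (Fin n) ℝ) i j| ≤ n * Λ^3 := by
        rw [Matrix.one_apply]; split_ifs
        · simpa using g1
        · simp; positivity
      have g3 := abs_sub (pd i (pd j v) x) (gg G v x * (1 : Matrix (Fin n) (Fin n) ℝ) i j)
      have g4 := hD2 i j
      have g5 : n * Λ^3 ≤ n * Λ^3 * W := le_mul_of_one_le_right (by positivity) hW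
      have g6 : L0 * W = W + n * Λ^3 * W := by rw [hL0]; ring
      linarith
    have := (Hb A (L0*W) (by positivity) hAb).1
    calc trace T = ∑ i, T i i := rfl
      _ ≤ ∑ i : Fin n, B * (L0*W)^(κ+1) := Finset.sum_le_sum fun i _ => (le_abs_self _).trans (this i i)
      _ = _ := by simp
  -- direction `l`
  set Hf : (Fin n → ℝ) → ℝ := fun y => ∑ i, ∑ j, T i j * pd i (pd j v) y with hHf
  have hTA : trace (T * A) = ((κ:ℝ)+2) * F x^(κ+2) := by
    have := SS_succ (κ+1) A
    rw [← hT] at this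
    rw [← this, hA, hSS]; push_cast; ring
  set kF : ℝ := ((κ:ℝ)+2) * F x^(κ+1) with hkF
  have hkF0 : 0 ≤ kF := by positivity
  have hmem : ∀ l, x + h • (Pi.single l 1 : Fin n → ℝ) ∈ closedBall x h ∧ x - h • (Pi.single l 1 : Fin n → ℝ) ∈ closedBall x h := by
    intro l
    have e1 : ‖(Pi.single l 1 : Fin n → ℝ)‖ = 1 := by rw [Pi.norm_single]; simp
    constructor <;> rw [mem_closedBall, dist_eq_norm] <;> simp [norm_smul, abs_of_pos hh, e1]
  have dir : ∀ l, trace T * (2 * G x * (∑ m, pd m v x * ddq l h (pd m v) x) - 7*n*Λ^4*W) + kF * ((∑ m, c m * ddq l h (pd m v) x) - 3*Λ^2*W^2) ≤ ddq l h Hf x := by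
    intro l
    obtain ⟨mp, mm⟩ := hmem l
    set xp := x + h • (Pi.single l 1 : Fin n → ℝ) with hxp
    set xm := x - h • (Pi.single l 1 : Fin n → ℝ) with hxm
    obtain ⟨p1, p2, p3, p4, p5, p6⟩ := hy xp mp
    obtain ⟨m1, m2, m3, m4, m5, m6⟩ := hy xm mm
    have sp : xp - x = h • (Pi.single l 1 : Fin n → ℝ) := by rw [hxp]; simp
    have sm : xm - x = -(h • (Pi.single l 1 : Fin n → ℝ)) := by rw [hxm]; simp
    have g4p := G4 hAs (AA_symm (gg G v) (hv.contDiffAt (x := xp))) (κ+1) hGS p1 (F x) (F xp) hF0 p3 hSS p2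
    have g4m := G4 hAs (AA_symm (gg G v) (hv.contDiffAt (x := xm))) (κ+1) hGS m1 (F x) (F xm) hF0 m3 hSS m2
    rw [← hT, trTB hv] at g4p g4m
    have g40 := hTA
    rw [hA, trTB hv] at g40
    have hF2 : ((∑ m, c m * (pd m v xp + pd m v xm - 2 * pd m v x)) - 3*Λ^2*h^2*W^2) ≤ F xp + F xm - 2 * F x := by
      have t1 := hTF xp mp
      have t2 := hTF xm mm
      rw [sp] at t1
      rw [sm, map_neg] at t2
      have t3 : |bF * (v xp + v xm - 2 * v x)| ≤ Λ * (Λ * W * h^2) := by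
        rw [abs_mul]
        refine mul_le_mul hbF ?_ (abs_nonneg _) (by linarith)
        have := hdd l
        rw [ddq, ← hxp, ← hxm, abs_div, abs_of_pos (show 0 < h^2 by positivity), div_le_iff₀ (by positivity)] at this
        convert this using 2; ring
      have t4 : ∑ m, c m * (pd m v xp + pd m v xm - 2 * pd m v x) = (∑ m, c m * (pd m v xp - pd m v x)) + ∑ m, c m * (pd m v xm - pd m v x) := by
        rw [← Finset.sum_add_distrib]; exact Finset.sum_congr rfl fun m _ => by ring
      have t5 : Λ * (Λ * W * h^2) ≤ Λ^2*h^2*W^2 := by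
        have : Λ^2*h^2*W*1 ≤ Λ^2*h^2*W*W := by gcongr
        linarith
      have t6 : Λ*h^2*W^2 ≤ Λ^2*h^2*W^2 := by
        have : Λ ≤ Λ^2 := by nlinarith
        gcongr
      have a1 := (abs_le.1 t1).1
      have a2 := (abs_le.1 t2).1
      have a3 := (abs_le.1 t3).1
      rw [t4]; linarith
    have hG2 : |G xp + G xm - 2 * G x| ≤ 3*Λ^2*h^2*W := by
      have t1 := abs_le.1 (hTG xp mp)
      have t2 := abs_le.1 (hTG xm mm)
      rw [sp] at t1
      rw [sm, map_neg] at t2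
      have t3 : |bG * (v xp + v xm - 2 * v x)| ≤ Λ * (Λ * W * h^2) := by
        rw [abs_mul]
        refine mul_le_mul hbG ?_ (abs_nonneg _) (by linarith)
        have := hdd l
        rw [ddq, ← hxp, ← hxm, abs_div, abs_of_pos (show 0 < h^2 by positivity), div_le_iff₀ (by positivity)] at this
        convert this using 2; ring
      have t6 : Λ*h^2 ≤ Λ^2*h^2*W := by
        have : Λ*h^2*1 ≤ Λ*h^2*(Λ*W) := by
          gcongr; nlinarith
        linarith
      have t3 := abs_le.1 t3
      rw [abs_le]; constructor <;> linarith [t1.1, t1.2, t2.1, t2.2, t3.1, t3.2]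
    have hg2 : 2 * G x * (∑ m, pd m v x * (pd m v xp + pd m v xm - 2 * pd m v x)) - 7*n*Λ^4*h^2*W ≤ gg G v xp + gg G v xm - 2 * gg G v x := by
      have := Finset.sum_le_sum fun m (_ : m ∈ Finset.univ) => gdir1 hΛ hh hW hG0 (hp m) (p4 m) (m4 m) (p5 m) (m5 m) p6 m6 hG2
      simp only [Finset.sum_sub_distrib, Finset.sum_add_distrib, ← Finset.mul_sum] at this
      simp only [gg, normSq, grad]
      refine le_trans (le_of_eq ?_) this
      simp; ring
    have q1 := mul_le_mul_of_nonneg_left hg2 htr0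
    have q2 := mul_le_mul_of_nonneg_left hF2 hkF0
    have e1 : ∑ m, pd m v x * ddq l h (pd m v) x = (∑ m, pd m v x * (pd m v xp + pd m v xm - 2 * pd m v x))/h^2 := by
      rw [Finset.sum_div]; exact Finset.sum_congr rfl fun m _ => by unfold ddq; rw [← hxp, ← hxm]; ring
    have e2 : ∑ m, c m * ddq l h (pd m v) x = (∑ m, c m * (pd m v xp + pd m v xm - 2 * pd m v x))/h^2 := by
      rw [Finset.sum_div]; exact Finset.sum_congr rfl fun m _ => by unfold ddq; rw [← hxp, ← hxm]; ring
    have hh2 : 0 < h^2 := by positivity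
    rw [e1, e2, show ddq l h Hf x = (Hf xp - 2 * Hf x + Hf xm)/h^2 from rfl, le_div_iff₀ hh2]
    have e3 : (trace T * (2 * G x * ((∑ m, pd m v x * (pd m v xp + pd m v xm - 2 * pd m v x))/h^2) - 7*n*Λ^4*W) + kF * ((∑ m, c m * (pd m v xp + pd m v xm - 2 * pd m v x))/h^2 - 3*Λ^2*W^2)) * h^2
      = trace T * (2 * G x * (∑ m, pd m v x * (pd m v xp + pd m v xm - 2 * pd m v x)) - 7*n*Λ^4*h^2*W) + kF * ((∑ m, c m * (pd m v xp + pd m v xm - 2 * pd m v x)) - 3*Λ^2*h^2*W^2) := by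
      field_simp
    rw [e3]
    have g4p' : kF * F xp ≤ Hf xp - gg G v xp * trace T := by
      rw [hkF]; push_cast at g4p; convert g4p using 1; ring
    have g4m' : kF * F xm ≤ Hf xm - gg G v xm * trace T := by
      rw [hkF]; push_cast at g4m; convert g4m using 1; ring
    have g40' : Hf x - gg G v x * trace T = kF * F x := by
      rw [hkF, g40]; ring
    linarith
  have dsum := Finset.sum_le_sum fun l (_ : l ∈ Finset.univ) => dir l
  have d1 : ∑ l, ddq l h Hf x = ∑ i, ∑ j, T i j * pd i (pd j (w0 h v)) x := by
    have hd1 : Differentiable ℝ v := hv.differentiable (by norm_num)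
    have hd2 : ∀ j, Differentiable ℝ (pd j v) := fun j => (pd_contDiff (m := 1) hv (by norm_num)).differentiable (by norm_num)
    have : ∀ l, ddq l h Hf x = ∑ i, ∑ j, T i j * ddq l h (pd i (pd j v)) x := by
      intro l
      simp only [ddq, hHf]
      simp only [Finset.mul_sum, ← Finset.sum_sub_distrib, ← Finset.sum_add_distrib, Finset.sum_div]
      exact Finset.sum_congr rfl fun i _ => Finset.sum_congr rfl fun j _ => by ring
    simp_rw [this]
    rw [Finset.sum_comm]
    refine Finset.sum_congr rfl fun i _ => ?_
    rw [Finset.sum_comm]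
    refine Finset.sum_congr rfl fun j _ => ?_
    rw [← Finset.mul_sum, pd_w0 hd1, pd_w0 (hd2 j)]; rfl
  have d2 : ∀ a : Fin n → ℝ, ∑ l, ∑ m, a m * ddq l h (pd m v) x = ∑ m, a m * pd m (w0 h v) x := by
    intro a
    rw [Finset.sum_comm]
    refine Finset.sum_congr rfl fun m _ => ?_
    rw [← Finset.mul_sum, pd_w0 (hv.differentiable (by norm_num))]; rfl
  simp only [Finset.sum_add_distrib, ← Finset.mul_sum, Finset.sum_sub_distrib] at dsum
  rw [d1, d2, d2 c] at dsum
  simp only [Finset.sum_const, Finset.card_univ, Fintype.card_fin, nsmul_eq_mul] at dsum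
  rw [← htr]
  refine le_trans ?_ dsum
  have hkFb : kF ≤ (κ+2) * Λ^(κ+1) := by rw [hkF]; gcongr
  have s1 : trace T * (n * (7*n*Λ^4*W)) ≤ C1 * W^(κ+2) := by
    calc trace T * (n * (7*n*Λ^4*W)) ≤ (n * (B * (L0*W)^(κ+1))) * (n * (7*n*Λ^4*W)) := by gcongr
      _ = _ := by rw [hC1]; ring_nf
  have s2 : kF * (n * (3*Λ^2*W^2)) ≤ C2 * W^(κ+2) := by
    calc kF * (n * (3*Λ^2*W^2)) ≤ ((κ+2) * Λ^(κ+1)) * (n * (3*Λ^2*W^(κ+2))) := by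
          gcongr
          omega
      _ = _ := by rw [hC2]; ring
  have s3 : -(C3 * ∑ m, |pd m (w0 h v) x|) ≤ kF * ∑ m, c m * pd m (w0 h v) x := by
    have : |∑ m, c m * pd m (w0 h v) x| ≤ Λ * ∑ m, |pd m (w0 h v) x| := by
      rw [Finset.mul_sum]
      refine (Finset.abs_sum_le_sum_abs _ _).trans (Finset.sum_le_sum fun m _ => ?_)
      rw [abs_mul]; gcongr; exact hcF m
    have h1 := (abs_le.1 this).1
    have h2 := mul_le_mul_of_nonneg_left h1 hkF0
    have h3 : kF * (Λ * ∑ m, |pd m (w0 h v) x|) ≤ ((κ+2) * Λ^(κ+1)) * (Λ * ∑ m, |pd m (w0 h v) x|) := by gcongr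
    rw [hC3]; linarith
  have s4 : 0 ≤ (C1 + C2) * ∑ m, |pd m (w0 h v) x| := by positivity
  have s5 : 0 ≤ C3 * W^(κ+2) := by positivity
  linarith

end star
end IHE

end

noncomputable section
set_option linter.unusedSectionVars false
set_option linter.style.longLine false
set_option linter.unusedSimpArgs false
namespace IHE
section aux
variable {n : ℕ}

lemma c11_const {E : Type*} [NormedAddCommGroup E] [NormedSpace ℝ E] {f : E → ℝ} {s K : Set E} (hs : IsOpen s) (hf : C11On f s)
    (hK : IsCompact K) (hKc : Convex ℝ K) (hKs : K ⊆ s) : ∃ L : ℝ, 1 ≤ L ∧ (∀ y ∈ K, |f y| ≤ L ∧ ‖fderiv ℝ f y‖ ≤ L) ∧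
      (∀ y ∈ K, ∀ z ∈ K, ‖fderiv ℝ f z - fderiv ℝ f y‖ ≤ L * ‖z - y‖ ∧ |f z - f y - fderiv ℝ f y (z - y)| ≤ L * ‖z - y‖^2) := by
  obtain ⟨hf1, hf2⟩ := hf
  have hfd : ∀ y ∈ s, fderivWithin ℝ f s y = fderiv ℝ f y := fun y hy => fderivWithin_of_isOpen hs hy
  have hll : LocallyLipschitzOn K (fderiv ℝ f) := by
    intro x hx
    obtain ⟨C, t, ht, hL⟩ := hf2 x (hKs hx)
    rw [hs.nhdsWithin_eq (hKs hx)] at ht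
    refine ⟨C, t ∩ s, mem_nhdsWithin_of_mem_nhds (Filter.inter_mem ht (hs.mem_nhds (hKs hx))), ?_⟩
    intro a ha b hb
    rw [← hfd a ha.2, ← hfd b hb.2]
    exact hL ha.1 hb.1
  obtain ⟨C, hC⟩ := hll.exists_lipschitzOnWith_of_compact hK
  obtain ⟨B1, hB1⟩ := hK.exists_bound_of_continuousOn (hf1.continuousOn.mono hKs)
  obtain ⟨B2, hB2⟩ := hK.exists_bound_of_continuousOn hC.continuousOn
  refine ⟨max (max 1 C) (max B1 B2), by simp, fun y hy => ⟨?_, ?_⟩, fun y hy z hz => ⟨?_, ?_⟩⟩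
  · exact (hB1 y hy).trans (by simp)
  · exact (hB2 y hy).trans (by simp)
  · refine (hC.norm_sub_le hz hy).trans ?_
    gcongr; simp
  · have hseg : segment ℝ y z ⊆ K := hKc.segment_subset hy hz
    have := (convex_segment y z).norm_image_sub_le_of_norm_hasFDerivWithin_le' (f := f) (f' := fderiv ℝ f) (φ := fderiv ℝ f y) (C := C * ‖z - y‖)
      (fun w hw => ((hf1.differentiableOn one_ne_zero).differentiableAt (hs.mem_nhds (hKs (hseg hw)))).hasFDerivAt.hasFDerivWithinAt)
      (fun w hw => by
        refine (hC.norm_sub_le (hseg hw) hy).trans ?_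
        gcongr
        rw [← dist_eq_norm, ← dist_eq_norm, dist_comm w y, dist_comm z y]
        obtain ⟨t, ht, rfl⟩ := (segment_eq_image' ℝ y z ▸ hw)
        rw [dist_self_add_right, norm_smul, dist_eq_norm', Real.norm_eq_abs, abs_of_nonneg ht.1]
        exact mul_le_of_le_one_left (norm_nonneg _) ht.2) (left_mem_segment ℝ y z) (right_mem_segment ℝ y z)
    rw [Real.norm_eq_abs] at this
    refine this.trans ?_
    rw [mul_assoc, ← pow_two]
    gcongr; simp

/-- Lipschitz bound from bounds on the partial derivatives on a convex set. -/
lemma lip_of_pd {g : (Fin n → ℝ) → ℝ} (hg : Differentiable ℝ g) {s : Set (Fin n → ℝ)} (hs : Convex ℝ s) {B : ℝ}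
    (hB : ∀ y ∈ s, ∀ i, |pd i g y| ≤ B) {x y : Fin n → ℝ} (hx : x ∈ s) (hy : y ∈ s) : |g y - g x| ≤ n * B * ‖y - x‖ := by
  have := hs.norm_image_sub_le_of_norm_fderiv_le (f := g) (𝕜 := ℝ) (C := n * B) (fun z _ => hg z) (fun z hz => by
    refine (fd_norm _ _).trans ?_
    refine (Finset.sum_le_sum fun i _ => hB z hz i).trans ?_
    simp) hx hy
  simpa using this

lemma ddq_close {v : (Fin n → ℝ) → ℝ} (hv : ContDiff ℝ 2 v) {l : Fin n} {h : ℝ} (hh : 0 < h) {x : Fin n → ℝ} {ε : ℝ}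
    (H : ∀ y ∈ closedBall x h, |pd l (pd l v) y - pd l (pd l v) x| ≤ ε) : |ddq l h v x - pd l (pd l v) x| ≤ 2 * ε := by
  set e : Fin n → ℝ := Pi.single l 1 with he
  have hen : ‖e‖ = 1 := by rw [he, Pi.norm_single]; simp
  set a := pd l (pd l v) x with ha
  have hv1 : Differentiable ℝ v := hv.differentiable two_ne_zero
  have hp1 : Differentiable ℝ (pd l v) := (pd_contDiff (m := 1) hv (by norm_num)).differentiable one_ne_zero
  have lineD : ∀ (g : (Fin n → ℝ) → ℝ), Differentiable ℝ g → ∀ c t : ℝ, HasDerivAt (fun t : ℝ => g (x + (c * t) • e)) (c * pd l g (x + (c*t) • e)) t := by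
    intro g hg c t
    have h1 : HasDerivAt (fun t : ℝ => x + (c * t) • e) (c • e) t := by
      have := (((hasDerivAt_id t).const_mul c).smul_const e).const_add x
      simpa using this
    have := (hg (x + (c*t) • e)).hasFDerivAt.comp_hasDerivAt t h1
    rwa [ContinuousLinearMap.map_smul, smul_eq_mul] at this
  have hb : ∀ t : ℝ, |t| ≤ h → x + t • e ∈ closedBall x h := by
    intro t ht
    rw [mem_closedBall, dist_eq_norm, add_sub_cancel_left, norm_smul, hen, mul_one]; exact ht
  -- first derivative difference
  have h1 : ∀ t ∈ Icc (0:ℝ) h, |pd l v (x + t • e) - pd l v (x + (-t) • e) - 2 * t * a| ≤ 2 * ε * t := by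
    intro t ht
    have := (convex_Icc (-t) t).norm_image_sub_le_of_norm_hasDerivWithin_le (f := fun s : ℝ => pd l v (x + (1*s) • e) - s * a)
      (f' := fun s => 1 * pd l (pd l v) (x + (1*s) • e) - a) (C := ε) (x := -t) (y := t)
      (fun s _ => by
        have := (lineD _ hp1 1 s).sub ((hasDerivAt_id s).mul_const a)
        simp only [one_mul] at this ⊢
        exact this.hasDerivWithinAt)
      (fun s hs => by
        rw [one_mul, Real.norm_eq_abs, one_mul]
        exact H _ (hb s (abs_le.2 ⟨by linarith [hs.1, ht.2], hs.2.trans ht.2⟩)))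
      (by constructor <;> linarith [ht.1]) (by constructor <;> linarith [ht.1])
    simp only [one_mul, Real.norm_eq_abs] at this
    have e1 : |t - -t| = 2 * t := by rw [sub_neg_eq_add, ← two_mul, abs_of_nonneg]; linarith [ht.1]
    rw [e1] at this
    calc _ = |pd l v (x + t • e) - t * a - (pd l v (x + (-t) • e) - -t * a)| := by congr 1; ring
      _ ≤ _ := this
      _ = _ := by ring
  have hε : 0 ≤ ε := (abs_nonneg _).trans (H x (mem_closedBall_self hh.le))
  have h2 := (convex_Icc (0:ℝ) h).norm_image_sub_le_of_norm_hasDerivWithin_le (f := fun s : ℝ => v (x + (1*s) • e) + v (x + ((-1)*s) • e) - s^2 * a)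
      (f' := fun s => 1 * pd l v (x + (1*s) • e) + (-1) * pd l v (x + ((-1)*s) • e) - (2 * s) * a) (C := 2 * ε * h) (x := 0) (y := h)
      (fun s _ => by
        have := ((lineD _ hv1 1 s).fun_add (lineD _ hv1 (-1) s)).fun_sub ((hasDerivAt_pow 2 s).mul_const a)
        convert this.hasDerivWithinAt using 1
        norm_num)
      (fun s hs => by
        have := h1 s hs
        rw [Real.norm_eq_abs]
        simp only [one_mul, neg_one_mul] 
        rw [← sub_eq_add_neg]
        refine this.trans ?_
        have := hs.2
        gcongr)
      (by constructor <;> linarith) (by constructor <;> linarith)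
  simp only [one_mul, neg_one_mul, Real.norm_eq_abs, sub_zero, abs_of_pos hh, zero_smul, neg_zero, add_zero] at h2
  have e2 : ddq l h v x - a = (v (x + h • e) + v (x + (-h) • e) - h^2 * a - (v x + v x - 0^2 * a)) / h^2 := by
    unfold ddq; rw [neg_smul, ← sub_eq_add_neg]; field_simp; ring
  rw [e2, abs_div, abs_of_pos (by positivity : 0 < h^2), div_le_iff₀ (by positivity)]
  calc _ ≤ _ := h2
    _ = _ := by ring

lemma mol_shift {δ : ℝ} (hδ : 0 < δ) (w : (Fin n → ℝ) → ℝ) (a x : Fin n → ℝ) :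
    mol δ hδ w (x + a) = mol δ hδ (fun y => w (y + a)) x := by
  unfold mol
  rw [convolution_def, convolution_def]
  congr 1; funext t
  rw [sub_add_eq_add_sub]

lemma mol_sub {δ : ℝ} (hδ : 0 < δ) {w w' : (Fin n → ℝ) → ℝ} (hw : Continuous w) (hw' : Continuous w') (x : Fin n → ℝ) :
    mol δ hδ (fun y => w y - w' y) x = mol δ hδ w x - mol δ hδ w' x := by
  have h := fun (g : (Fin n → ℝ) → ℝ) (hg : Continuous g) => (mbump n δ hδ).hasCompactSupport_normed (μ := volume) |>.convolutionExists_left (μ := volume)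
    (ContinuousLinearMap.lsmul ℝ ℝ) ((mbump n δ hδ).continuous_normed (μ := volume)) hg.locallyIntegrable x
  unfold mol
  rw [convolution_def, convolution_def, convolution_def, ← integral_sub (h w hw) (h w' hw')]
  congr 1; funext t; simp [mul_sub]

lemma mol_lip {δ : ℝ} (hδ : 0 < δ) {w : (Fin n → ℝ) → ℝ} (hw : Continuous w) {x : Fin n → ℝ} {B ρ : ℝ} (hB : 0 ≤ B) (hρ : 0 < ρ)
    (H : ∀ y ∈ ball x δ, ∀ a : Fin n → ℝ, ‖a‖ < ρ → |w (y + a) - w y| ≤ B * ‖a‖) (i : Fin n) : |pd i (mol δ hδ w) x| ≤ 3 * B := by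
  have : ‖fderiv ℝ (mol δ hδ w) x‖ ≤ 3 * B := by
    refine norm_fderiv_le_of_lip' ℝ (by positivity) ?_
    filter_upwards [ball_mem_nhds x hρ] with y hy
    obtain ⟨a, rfl⟩ : ∃ a, y = x + a := ⟨y - x, by simp⟩
    have ha : ‖a‖ < ρ := by simpa [mem_ball, dist_eq_norm] using hy
    have hc : Continuous fun y => w (y + a) := hw.comp (continuous_id.add continuous_const)
    rw [mol_shift, ← mol_sub hδ hc hw, add_sub_cancel_left, Real.norm_eq_abs]
    have hx := H x (mem_ball_self hδ) a ha
    have h1 := mol_close hδ (w := fun y => w (y + a) - w y) (hc.sub hw) (x := x) (ε := 2 * (B * ‖a‖)) (fun y hy => by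
      have h2 := H y hy a ha
      refine (abs_sub _ _).trans ?_
      linarith)
    have h3 := abs_sub_abs_le_abs_sub (mol δ hδ (fun y => w (y + a) - w y) x) (w (x + a) - w x)
    have h4 : |mol δ hδ (fun y => w (y + a) - w y) x - (w (x + a) - w x)| ≤ 2 * (B * ‖a‖) := h1
    linarith
  unfold pd
  have h5 := (fderiv ℝ (mol δ hδ w) x).le_opNorm (Pi.single i 1)
  rw [Pi.norm_single] at h5
  simpa using h5.trans (by simpa using this)

end aux
end IHE

end

noncomputable section
set_option linter.unusedSectionVars false
set_option linter.style.longLine false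
set_option linter.unusedSimpArgs false
namespace IHE
section loc
variable {n : ℕ}

structure Loc (Λ : ℝ) (κ : ℕ) (K : Set (Fin n → ℝ)) (v G F : (Fin n → ℝ) → ℝ) : Prop where
  hv : ContDiff ℝ 2 v
  hvc : HasCompactSupport v
  hG : ContDiff ℝ 1 G
  hGc : HasCompactSupport G
  gs : ∀ x ∈ K, GS (κ+2) (AA v (gg G v) x)
  ss : ∀ x ∈ K, SS (κ+2) (AA v (gg G v) x) = F x^(κ+2)
  F0 : ∀ x ∈ K, 1/Λ ≤ F x
  F1 : ∀ x ∈ K, F x ≤ Λ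
  G0 : ∀ x ∈ K, 0 ≤ G x
  G1 : ∀ x ∈ K, G x ≤ Λ
  dv : ∀ x ∈ K, ∀ m, |pd m v x| ≤ Λ
  dG : ∀ x ∈ K, ∀ m, |pd m G x| ≤ Λ
  tG : ∀ x ∈ K, ∃ (L : (Fin n → ℝ) →L[ℝ] ℝ) (b : ℝ), |b| ≤ Λ ∧ ∀ y ∈ K, |G y - G x - (L (y - x) + b * (v y - v x))| ≤ Λ*‖y-x‖^2
  tF : ∀ x ∈ K, ∃ (L : (Fin n → ℝ) →L[ℝ] ℝ) (b : ℝ) (c : Fin n → ℝ), |b| ≤ Λ ∧ (∀ m, |c m| ≤ Λ) ∧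
    ∀ y ∈ K, |F y - F x - (L (y - x) + b * (v y - v x) + ∑ m, c m * (pd m v y - pd m v x))| ≤ Λ*(‖y-x‖^2 + ∑ m, (pd m v y - pd m v x)^2)
  lG : ∀ x ∈ K, ∀ y ∈ K, ∀ i, |pd i G y - pd i G x| ≤ Λ * (‖y-x‖ + ∑ m, |pd m v y - pd m v x|)

def WW (Λ : ℝ) (v : (Fin n → ℝ) → ℝ) (x : Fin n → ℝ) : ℝ := lapl v x + (1 + n*Λ^3)

lemma unif_fin {ι : Type*} [Finite ι] {g : ι → (Fin n → ℝ) → ℝ} (hg : ∀ i, Continuous (g i)) (hc : ∀ i, HasCompactSupport (g i)) {ε : ℝ} (hε : 0 < ε) :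
    ∃ δ > 0, ∀ i x y, dist y x ≤ δ → |g i y - g i x| ≤ ε := by
  have h : ∀ i, ∀ᶠ δ in nhdsWithin (0:ℝ) (Ioi 0), ∀ x y, dist y x ≤ δ → |g i y - g i x| ≤ ε := by
    intro i
    obtain ⟨δ, hδ, H⟩ := Metric.uniformContinuous_iff.1 ((hc i).uniformContinuous_of_continuous (hg i)) ε hε
    filter_upwards [Ioo_mem_nhdsGT hδ] with d hd x y hxy
    exact (H (hxy.trans_lt hd.2)).le
  have h2 := (Filter.eventually_all.2 h).and self_mem_nhdsWithin
  obtain ⟨δ, h1, h2⟩ := h2.exists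
  exact ⟨δ, h2, h1⟩

lemma WW_facts {Λ : ℝ} (hΛ : 1 ≤ Λ) {κ : ℕ} (_hκ : κ + 2 ≤ n) {K : Set (Fin n → ℝ)} {v G F : (Fin n → ℝ) → ℝ} (H : Loc Λ κ K v G F) {x : Fin n → ℝ} (hx : x ∈ K) :
    1 ≤ WW Λ v x ∧ (∀ i j, |pd i (pd j v) x| ≤ WW Λ v x) ∧
    ∀ w : Fin n → ℝ, (∑ i, w i^2)/((4*Λ^(κ+2))*WW Λ v x) ≤ ∑ i, ∑ j, TT (κ+1) (AA v (gg G v) x) i j * w i * w j := by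
  have hΛ0 : 0 < Λ := by linarith
  have hA : (AA v (gg G v) x)ᵀ = AA v (gg G v) x := AA_symm _ H.hv.contDiffAt
  have hg := H.gs x hx
  have hg2 : GS 2 (AA v (gg G v) x) := fun j hj => hg j (by omega)
  have hent := entries_le hA hg2
  have hg0 : 0 ≤ gg G v x := by
    unfold gg normSq; exact mul_nonneg (H.G0 x hx) (Finset.sum_nonneg fun i _ => sq_nonneg _)
  have hg1 : gg G v x ≤ n * Λ^3 := by
    unfold gg normSq
    have : ∑ i, grad v x i^2 ≤ n * Λ^2 := by
      refine (Finset.sum_le_sum fun i _ => sq_le_sq' (neg_le_of_abs_le (H.dv x hx i)) (le_of_abs_le (H.dv x hx i))).trans ?_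
      simp
    calc _ ≤ Λ * (n * Λ^2) := mul_le_mul (H.G1 x hx) this (Finset.sum_nonneg fun i _ => sq_nonneg _) hΛ0.le
      _ = _ := by ring
  have htr : trace (AA v (gg G v) x) = lapl v x - n * gg G v x := by
    simp [Matrix.trace, AA_apply, lapl, Finset.sum_sub_distrib]
  have htr1 : trace (AA v (gg G v) x) ≤ lapl v x := by
    rw [htr]; have : 0 ≤ n * gg G v x := by positivity
    linarith
  have htr0 : 0 < trace (AA v (gg G v) x) := by
    have h1 := hg 1 (by omega)
    have : SS 1 (AA v (gg G v) x) = trace (AA v (gg G v) x) := by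
      simp [SS, TT]
    linarith
  have hp : (0:ℝ) ≤ n * Λ^3 := by positivity
  have hW1 : 1 ≤ WW Λ v x := by unfold WW; linarith
  have hW2 : trace (AA v (gg G v) x) ≤ WW Λ v x := by unfold WW; linarith
  refine ⟨hW1, fun i j => ?_, fun w => ?_⟩
  · have h1 := hent i j
    rw [AA_apply] at h1
    have h2 : |gg G v x * (1 : Matrix (Fin n) (Fin n) ℝ) i j| ≤ n * Λ^3 := by
      rw [Matrix.one_apply]; split_ifs
      · rw [mul_one, abs_of_nonneg hg0]; exact hg1
      · simpa using hp
    have h3 := abs_sub_abs_le_abs_sub (pd i (pd j v) x) (gg G v x * (1 : Matrix (Fin n) (Fin n) ℝ) i j)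
    unfold WW; linarith
  · refine le_trans ?_ (G1 hA κ hg w)
    rw [div_eq_mul_inv, mul_comm]
    have : 0 ≤ ∑ i, w i^2 := Finset.sum_nonneg fun i _ => sq_nonneg _
    refine mul_le_mul_of_nonneg_right ?_ this
    rw [H.ss x hx, inv_eq_one_div, div_le_div_iff₀ (by positivity) (by positivity)]
    have h1 : 1 ≤ F x^(κ+2) * Λ^(κ+2) := by
      rw [← mul_pow]
      refine one_le_pow₀ ?_
      have := H.F0 x hx
      rw [div_le_iff₀ hΛ0] at this; exact this
    have hF : 0 ≤ F x := le_trans (by positivity) (H.F0 x hx)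
    calc 1 * (4 * trace (AA v (gg G v) x)) ≤ (F x^(κ+2) * Λ^(κ+2)) * (4 * WW Λ v x) := by
          gcongr
      _ = _ := by ring

lemma dv_lip {Λ : ℝ} {v : (Fin n → ℝ) → ℝ} (hv : ContDiff ℝ 2 v) {x : Fin n → ℝ} {h : ℝ} (hW : 1 ≤ WW Λ v x)
    (hW2 : ∀ i j, |pd i (pd j v) x| ≤ WW Λ v x) (hu : ∀ i j y, dist y x ≤ h → |pd i (pd j v) y - pd i (pd j v) x| ≤ 1) {y z : Fin n → ℝ}
    (hy : dist y x ≤ h) (hz : dist z x ≤ h) (m : Fin n) : |pd m v y - pd m v z| ≤ n * (2 * WW Λ v x) * ‖y - z‖ := by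
  refine lip_of_pd ((pd_contDiff (m := 1) hv (by norm_num)).differentiable one_ne_zero) (convex_closedBall x h) (B := 2 * WW Λ v x) ?_
    (mem_closedBall.2 hz) (mem_closedBall.2 hy)
  intro w hw i
  have h1 := hu i m w hw
  have h2 := abs_sub_abs_le_abs_sub (pd i (pd m v) w) (pd i (pd m v) x)
  linarith [hW2 i m]

lemma starH_of {Λ : ℝ} (hΛ : 1 ≤ Λ) (hn : 3 ≤ n) {κ : ℕ} (hκ : κ + 2 ≤ n) {K : Set (Fin n → ℝ)} {v G F : (Fin n → ℝ) → ℝ} (H : Loc Λ κ K v G F)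
    {x : Fin n → ℝ} {h : ℝ} (hh : 0 < h) (hx : closedBall x h ⊆ K)
    (hu : ∀ i j y, dist y x ≤ h → |pd i (pd j v) y - pd i (pd j v) x| ≤ 1) : StarH (Λ*(4*(n:ℝ)^3+1)) κ v G F (WW Λ v x) h x := by
  have hn3 : (3:ℝ) ≤ n := by exact_mod_cast hn
  have hxx : x ∈ closedBall x h := mem_closedBall_self hh.le
  have hxK := hx hxx
  obtain ⟨hW, hW2, -⟩ := WW_facts hΛ hκ H hxK
  have hL := fun y (hy : dist y x ≤ h) (m : Fin n) => dv_lip H.hv hW hW2 hu hy (by simpa using hh.le : dist x x ≤ h) m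
  set W := WW Λ v x with hWd
  have hΛ0 : 0 < Λ := by linarith
  have hn2 : (n:ℝ) ≤ n^3 := by nlinarith [sq_nonneg ((n:ℝ))]
  have hbase : Λ ≤ Λ*(4*(n:ℝ)^3+1) := by nlinarith [pow_pos (by linarith : (0:ℝ) < n) 3]
  have hy0 : ∀ y ∈ closedBall x h, ‖y - x‖ ≤ h := fun y hy => by rw [← dist_eq_norm]; exact hy
  have hb3 : (1:ℝ) * (4 * n) ≤ Λ*(4*(n:ℝ)^3+1) := by
    refine mul_le_mul hΛ (by linarith) (by positivity) (by linarith)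
  have hb4 : Λ * n ≤ Λ*(4*(n:ℝ)^3+1) := by gcongr; nlinarith
  refine ⟨hW, H.G0 x hxK, (H.G1 x hxK).trans hbase, (H.F1 x hxK).trans hbase, hW2, fun y hy => ⟨H.gs y (hx hy), H.ss y (hx hy), ?_, ?_, ?_, ?_⟩, ?_, ?_, ?_⟩
  · exact lt_of_lt_of_le (by positivity) (H.F0 y (hx hy))
  · exact fun m => (H.dv y (hx hy) m).trans hbase
  · intro m
    refine (hL y hy m).trans ?_
    calc n * (2 * W) * ‖y - x‖ ≤ n * (2 * W) * h := by gcongr; exact hy0 y hy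
      _ = (2 * n) * (h * W) := by ring
      _ ≤ (Λ*(4*(n:ℝ)^3+1)) * (h * W) := mul_le_mul_of_nonneg_right (by linarith) (by positivity)
      _ = _ := by ring
  · have := lip_of_pd (H.hG.differentiable one_ne_zero) (convex_closedBall x h) (B := Λ) (fun z hz i => H.dG z (hx hz) i) hxx hy
    refine this.trans ?_
    calc n * Λ * ‖y - x‖ ≤ n * Λ * h := by gcongr; exact hy0 y hy
      _ ≤ (Λ*(4*(n:ℝ)^3+1)) * h := mul_le_mul_of_nonneg_right (by linarith) hh.le
  · intro l
    have h1 := ddq_close H.hv hh (l := l) (x := x) (ε := 1) (fun y hy => hu l l y hy)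
    have h2 := abs_sub_abs_le_abs_sub (ddq l h v x) (pd l (pd l v) x)
    have h3 := hW2 l l
    have : |ddq l h v x| ≤ 3 * W := by linarith
    refine this.trans ?_
    gcongr; linarith
  · obtain ⟨L, b, hb, hL⟩ := H.tG x hxK
    refine ⟨L, b, hb.trans hbase, fun y hy => (hL y (hx hy)).trans ?_⟩
    gcongr
    exact hy0 y hy
  · obtain ⟨L, b, c, hb, hc, hT⟩ := H.tF x hxK
    refine ⟨L, b, c, hb.trans hbase, fun m => (hc m).trans hbase, fun y hy => (hT y (hx hy)).trans ?_⟩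
    have h1 : ∀ m, (pd m v y - pd m v x)^2 ≤ 4 * n^2 * (h^2 * W^2) := by
      intro m
      have := hL y hy m
      have h2 : |pd m v y - pd m v x| ≤ n * (2 * W) * h := this.trans (by gcongr; exact hy0 y hy)
      calc (pd m v y - pd m v x)^2 = |pd m v y - pd m v x|^2 := (sq_abs _).symm
        _ ≤ (n * (2 * W) * h)^2 := by gcongr
        _ = _ := by ring
    have h2 : ∑ m, (pd m v y - pd m v x)^2 ≤ n * (4 * n^2 * (h^2 * W^2)) := by
      refine (Finset.sum_le_sum fun m _ => h1 m).trans ?_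
      simp
    have h3 : ‖y - x‖^2 ≤ h^2 * W^2 := by
      calc ‖y-x‖^2 ≤ h^2 * 1 := by rw [mul_one]; gcongr; exact hy0 y hy
        _ ≤ _ := by gcongr; exact one_le_pow₀ hW
    calc Λ*(‖y-x‖^2 + ∑ m, (pd m v y - pd m v x)^2) ≤ Λ * (h^2 * W^2 + n * (4 * n^2 * (h^2 * W^2))) := by gcongr
      _ = _ := by ring

lemma Gam_ex {Λ : ℝ} (hΛ : 1 ≤ Λ) {κ : ℕ} (hκ : κ + 2 ≤ n) {K S : Set (Fin n → ℝ)} {v G F : (Fin n → ℝ) → ℝ} (H : Loc Λ κ K v G F)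
    {ρ : ℝ} (hρ : 0 < ρ) (hS : ∀ x ∈ S, closedBall x ρ ⊆ K) {ε : ℝ} (hε : 0 < ε) :
    ∃ Γ : (Fin n → ℝ) → ℝ, ContDiff ℝ 2 Γ ∧ ∀ x ∈ S, (∀ i, |pd i Γ x - pd i G x| ≤ ε) ∧ ∀ i j, |pd i (pd j Γ) x| ≤ (3*Λ*(1+2*n^2)) * WW Λ v x := by
  obtain ⟨δ1, hδ1, h1⟩ := unif_fin (g := fun i : Fin n => pd i G) (fun i => (pd_contDiff (m := 0) H.hG (by norm_num)).continuous)
    (fun i => pd_hcs H.hGc) hε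
  obtain ⟨δ2, hδ2, h2⟩ := unif_fin (g := fun i : Fin n × Fin n => pd i.1 (pd i.2 v))
    (fun i => (pd_contDiff (m := 0) (pd_contDiff (m := 1) H.hv (by norm_num)) (by norm_num)).continuous)
    (fun i => pd_hcs (pd_hcs H.hvc)) one_pos
  obtain ⟨δ, hδ, hd1, hd2⟩ : ∃ δ : ℝ, 0 < δ ∧ δ ≤ δ1 ∧ 2*δ ≤ min δ2 ρ := ⟨min δ1 (min δ2 ρ / 2), by positivity, min_le_left _ _, by
    have := min_le_right δ1 (min δ2 ρ / 2); linarith⟩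
  have hd3 : 2*δ ≤ δ2 := hd2.trans (min_le_left _ _)
  have hd4 : 2*δ ≤ ρ := hd2.trans (min_le_right _ _)
  have cG : ∀ i, Continuous (pd i G) := fun i => (pd_contDiff (m := 0) H.hG (by norm_num)).continuous
  refine ⟨mol δ hδ G, mol_contDiff hδ H.hG.continuous 2, fun x hx => ⟨fun i => ?_, fun i j => ?_⟩⟩
  · rw [pd_mol hδ H.hG H.hGc]
    refine mol_close hδ (cG i) fun y hy => h1 i x y ?_
    exact (le_of_lt hy).trans hd1
  · rw [pd_mol hδ H.hG H.hGc]
    have hxK : x ∈ K := hS x hx (mem_closedBall_self hρ.le)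
    obtain ⟨hW, hW2, -⟩ := WW_facts hΛ hκ H hxK
    have := mol_lip hδ (cG j) (x := x) (B := Λ*(1+2*n^2) * WW Λ v x) (ρ := δ) (by positivity) hδ (fun y hy a ha => by
      have hya : dist (y + a) x ≤ 2 * δ := by
        have h3 := dist_triangle (y + a) y x
        have h4 : dist (y+a) y = ‖a‖ := by simp [dist_eq_norm]
        rw [mem_ball] at hy; linarith
      have hy' : dist y x ≤ 2 * δ := by rw [mem_ball] at hy; linarith
      have h5 := H.lG y (hS x hx (mem_closedBall.2 (hy'.trans hd4))) (y+a) (hS x hx (mem_closedBall.2 (hya.trans hd4))) j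
      refine h5.trans ?_
      have h6 : ∀ m, |pd m v (y+a) - pd m v y| ≤ n * (2 * WW Λ v x) * ‖a‖ := fun m => by
        have := dv_lip H.hv hW hW2 (h := 2*δ) (fun i j y hy => h2 (i, j) x y (hy.trans hd3)) hya hy' m
        rwa [add_sub_cancel_left] at this
      have h7 : ∑ m, |pd m v (y+a) - pd m v y| ≤ n * (n * (2 * WW Λ v x) * ‖a‖) := by
        refine (Finset.sum_le_sum fun m _ => h6 m).trans ?_
        simp
      rw [add_sub_cancel_left]
      calc Λ * (‖a‖ + ∑ m, |pd m v (y+a) - pd m v y|) ≤ Λ * (WW Λ v x * ‖a‖ + n * (n * (2 * WW Λ v x) * ‖a‖)) := by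
            gcongr
            exact le_mul_of_one_le_left (norm_nonneg _) hW
        _ = _ := by ring) i
    refine this.trans (le_of_eq (by ring))

end loc
end IHE

end

noncomputable section
set_option linter.unusedSectionVars false
set_option linter.style.longLine false
set_option linter.unusedSimpArgs false
namespace IHE
section main
variable {n : ℕ}

lemma tau_ex (q : ℝ) : ∃ τ : ℝ, 0 < τ ∧ τ ≤ 1/2 ∧ (1+τ)^q ≤ 2 ∧ 1 ≤ 2 * (1-τ)^q := by
  have c1 : ContinuousAt (fun τ : ℝ => (1+τ)^q) 0 := by
    apply ContinuousAt.rpow_const (by fun_prop); left; norm_num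
  have c2 : ContinuousAt (fun τ : ℝ => 2 * (1-τ)^q) 0 := by
    apply ContinuousAt.mul continuousAt_const
    apply ContinuousAt.rpow_const (by fun_prop); left; norm_num
  have e1 : ∀ᶠ τ in nhds (0:ℝ), (1+τ)^q < 2 := c1.eventually_lt continuousAt_const (by norm_num)
  have e2 : ∀ᶠ τ in nhds (0:ℝ), 1 < 2 * (1-τ)^q := continuousAt_const.eventually_lt c2 (by norm_num)
  have e3 : ∀ᶠ τ in nhdsWithin (0:ℝ) (Ioi 0), τ ∈ Ioo (0:ℝ) (1/2) := Ioo_mem_nhdsGT (by norm_num)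
  obtain ⟨τ, h1, h2, h3⟩ := (e3.and ((e1.and e2).filter_mono nhdsWithin_le_nhds)).exists
  exact ⟨τ, h1.1, h1.2.le, h2.le, h3.le⟩

lemma ratio_q {W w τ q : ℝ} (hW : 1 ≤ W) (hq : 1 ≤ q) (h0 : 0 < τ) (h1 : τ ≤ 1/2) (h2 : (1+τ)^q ≤ 2) (h3 : 1 ≤ 2 * (1-τ)^q) (h : |w - W| ≤ τ) :
    w ≤ 2*W ∧ W ≤ 2*w ∧ W^q ≤ 2 * w^q ∧ w^q ≤ 2 * W^q := by
  obtain ⟨ha, hb⟩ := abs_le.1 h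
  have u1 : w ≤ (1+τ)*W := by nlinarith
  have u2 : (1-τ)*W ≤ w := by nlinarith
  have w0 : 0 < w := by nlinarith
  refine ⟨by nlinarith, by nlinarith, ?_, ?_⟩
  · have : ((1-τ)*W)^q ≤ w^q := Real.rpow_le_rpow (mul_nonneg (by linarith) (by linarith)) u2 (by linarith)
    rw [Real.mul_rpow (by linarith) (by linarith)] at this
    have hp : 0 ≤ W^q := by positivity
    nlinarith
  · have : w^q ≤ ((1+τ)*W)^q := Real.rpow_le_rpow w0.le u1 (by linarith)
    rw [Real.mul_rpow (by linarith) (by linarith)] at this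
    have hp : 0 ≤ W^q := by positivity
    nlinarith

lemma w_ex (hn : 3 ≤ n) {κ : ℕ} (hκ : κ + 2 ≤ n) (x₀ : Fin n → ℝ) {R : ℝ} (hR : 0 < R) {Λ : ℝ} (hΛ : 1 ≤ Λ) : ∃ Λ2 : ℝ, 1 ≤ Λ2 ∧ 3*Λ*(1+2*n^2) ≤ Λ2 ∧
    ∀ v G F : (Fin n → ℝ) → ℝ, Loc Λ κ (closedBall x₀ (3/2*R)) v G F → ∀ q : ℝ, 1 ≤ q → ∃ w : (Fin n → ℝ) → ℝ, ContDiff ℝ 2 w ∧ (∀ x, 0 < w x) ∧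
      ∀ x ∈ closedBall x₀ (5/4*R), PW Λ2 κ v G w (WW Λ v x) x ∧ (WW Λ v x)^q ≤ 2 * w x^q ∧ w x^q ≤ 2 * (WW Λ v x)^q := by
  set Λ1 : ℝ := Λ*(4*(n:ℝ)^3+1) with hΛ1d
  have hΛ1 : 1 ≤ Λ1 := by
    rw [hΛ1d]; have : (0:ℝ) ≤ 4*(n:ℝ)^3 := by positivity
    nlinarith
  obtain ⟨Cs, hCs0, hCs⟩ := star (n := n) κ hκ Λ1 hΛ1
  have hΛp : 0 ≤ 4*Λ^(κ+2) := by positivity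
  have hΛp2 : 0 ≤ 3*Λ*(1+2*(n:ℝ)^2) := by positivity
  refine ⟨Λ + Cs + 4*Λ^(κ+2) + 3*Λ*(1+2*n^2), by linarith, by linarith, fun v G F H q hq => ?_⟩
  obtain ⟨τ, t0, t1, t2, t3⟩ := tau_ex q
  have hn0 : (0:ℝ) < n := by exact_mod_cast (by omega : 0 < n)
  obtain ⟨δ, hδ, h2⟩ := unif_fin (g := fun i : Fin n × Fin n => pd i.1 (pd i.2 v))
    (fun i => (pd_contDiff (m := 0) (pd_contDiff (m := 1) H.hv (by norm_num)) (by norm_num)).continuous)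
    (fun i => pd_hcs (pd_hcs H.hvc)) (ε := min 1 (τ/(2*n))) (by positivity)
  set h : ℝ := min δ (R/4) with hhd
  have hh : 0 < h := by positivity
  have hu : ∀ x i j y, dist y x ≤ h → |pd i (pd j v) y - pd i (pd j v) x| ≤ min 1 (τ/(2*n)) := fun x i j y hy => h2 (i,j) x y (hy.trans (min_le_left _ _))
  have hcl : ∀ x, |(w0 h v x + (1 + n*Λ^3)) - WW Λ v x| ≤ τ := by
    intro x
    have e : (w0 h v x + (1 + n*Λ^3)) - WW Λ v x = ∑ l, (ddq l h v x - pd l (pd l v) x) := by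
      unfold w0 WW lapl; rw [Finset.sum_sub_distrib]; ring
    rw [e]
    have h5 : ∀ l ∈ Finset.univ, |ddq l h v x - pd l (pd l v) x| ≤ 2 * (τ/(2*n)) := fun l _ =>
      ddq_close H.hv hh fun y hy => (hu x l l y hy).trans (min_le_right _ _)
    refine (Finset.abs_sum_le_sum_abs _ _).trans ((Finset.sum_le_sum h5).trans ?_)
    simp; field_simp; rfl
  let θ : ContDiffBump x₀ := ⟨11/8*R, 3/2*R, by positivity, by linarith⟩
  refine ⟨fun y => θ y * (w0 h v y + (1 + n*Λ^3)) + (1 - θ y), ?_, ?_, ?_⟩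
  · exact (θ.contDiff.mul ((w0_contDiff H.hv h).add contDiff_const)).add (contDiff_const.sub θ.contDiff)
  · intro x
    have a0 := θ.nonneg' x
    have a1 : θ x ≤ 1 := θ.le_one
    by_cases hx : x ∈ closedBall x₀ (3/2*R)
    · have hW := (WW_facts hΛ hκ H hx).1
      have := (abs_le.1 (hcl x)).1
      have h6 : 1/2 ≤ w0 h v x + (1 + n*Λ^3) := by linarith
      nlinarith
    · have : θ x = 0 := θ.zero_of_le_dist (by
        rw [mem_closedBall, not_le] at hx; exact hx.le)
      simp [this]
  · intro x hx
    have hxK : x ∈ closedBall x₀ (3/2*R) := closedBall_subset_closedBall (by linarith) hx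
    have hxh : closedBall x h ⊆ closedBall x₀ (3/2*R) := by
      refine closedBall_subset_closedBall' ?_
      have h7 : h ≤ R/4 := min_le_right _ _
      rw [mem_closedBall] at hx; linarith
    obtain ⟨hW, hW2, hE⟩ := WW_facts hΛ hκ H hxK
    have S := hCs v G F (WW Λ v x) h x H.hv hh (starH_of hΛ hn hκ H hh hxh fun i j y hy => (hu x i j y hy).trans (min_le_left _ _))
    have hev : ∀ y ∈ ball x₀ (11/8*R), θ y * (w0 h v y + (1 + n*Λ^3)) + (1 - θ y) = w0 h v y + (1 + n*Λ^3) := by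
      intro y hy
      have : θ y = 1 := θ.one_of_mem_closedBall (ball_subset_closedBall hy)
      rw [this]; ring
    have hxb : x ∈ ball x₀ (11/8*R) := by
      rw [mem_ball]; rw [mem_closedBall] at hx; linarith
    have hdw : Differentiable ℝ (w0 h v) := (w0_contDiff H.hv h).differentiable two_ne_zero
    have hp1 : ∀ y ∈ ball x₀ (11/8*R), ∀ m, pd m (fun y => θ y * (w0 h v y + (1 + n*Λ^3)) + (1 - θ y)) y = pd m (w0 h v) y := by
      intro y hy m
      rw [pd_congr (Filter.eventuallyEq_of_mem (isOpen_ball.mem_nhds hy) hev), pd_add (hdw y) (differentiableAt_const _), pd_const, add_zero]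
    have hp2 : ∀ i j, pd i (pd j (fun y => θ y * (w0 h v y + (1 + n*Λ^3)) + (1 - θ y))) x = pd i (pd j (w0 h v)) x := by
      intro i j
      exact pd_congr (Filter.eventuallyEq_of_mem (isOpen_ball.mem_nhds hxb) fun y hy => hp1 y hy j)
    obtain ⟨r1, r2, r3, r4⟩ := ratio_q hW hq t0 t1 t2 t3 (hcl x)
    have hbig : ∀ {a : ℝ}, a ≤ Λ → a ≤ Λ + Cs + 4*Λ^(κ+2) + 3*Λ*(1+2*n^2) := fun h => by linarith
    simp only [hev x hxb]
    refine ⟨⟨hW, ?_, ?_, hW2, fun i => hbig (H.dv x hxK i), ?_, fun i => hbig (H.dG x hxK i), fun e => ?_, ?_⟩, r3, r4⟩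
    · simp only [hev x hxb]; exact r1
    · simp only [hev x hxb]; exact r2
    · rw [abs_of_nonneg (H.G0 x hxK)]; exact hbig (H.G1 x hxK)
    · refine le_trans ?_ (hE e)
      gcongr
      linarith
    · simp only [hp1 x hxb, hp2]
      refine le_trans ?_ S
      have s1 : 0 ≤ ∑ m, |pd m (w0 h v) x| := by positivity
      have s2 : 0 ≤ (WW Λ v x)^(κ+2) := by positivity
      gcongr <;> linarith

theorem main_local (hn : 3 ≤ n) (κ : ℕ) (hκ : κ + 2 ≤ n) (p : ℝ) (hp : ((κ+2:ℕ) * n : ℝ)/2 < p) (x₀ : Fin n → ℝ) {R : ℝ} (hR : 0 < R) {Λ : ℝ} (hΛ : 1 ≤ Λ)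
    (M2 : ℝ) : ∃ C : ℝ, ∀ v G F : (Fin n → ℝ) → ℝ, Loc Λ κ (closedBall x₀ (3/2*R)) v G F →
      ∫ x in closedBall x₀ (3/2*R), (∑ i, ∑ j, |pd i (pd j v) x|)^p ≤ M2 → ∀ x ∈ ball x₀ R, ∀ i j, |pd i (pd j v) x| ≤ C := by
  obtain ⟨Λ2, hΛ2, hΛ2', hw⟩ := w_ex hn hκ x₀ hR hΛ
  obtain ⟨C2, hC2, hrh⟩ := rh hn κ hκ Λ2 hΛ2
  let ζ : ContDiffBump x₀ := ⟨9/8*R, 5/4*R, by positivity, by linarith⟩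
  have hp0 : 0 < p := lt_of_le_of_lt (by positivity) hp
  set K := closedBall x₀ (3/2*R) with hK
  obtain ⟨C, hC⟩ := moser hn (κ+2) (by omega) p hp ζ ζ.contDiff ζ.hasCompactSupport ζ.nonneg' (fun x => ζ.le_one) C2
    ((2*(1 + n*Λ^3))^p * volume.real K + 2^p * M2) hC2
  refine ⟨C, fun v G F H hM x hx i j => ?_⟩
  have hts : tsupport ζ = closedBall x₀ (5/4*R) := ζ.tsupport_eq
  have hKs : closedBall x₀ (5/4*R) ⊆ K := closedBall_subset_closedBall (by linarith)
  have c2 : ∀ i j, Continuous (pd i (pd j v)) := fun i j => (pd_contDiff (m := 0) (pd_contDiff (m := 1) H.hv (by norm_num)) (by norm_num)).continuous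
  have cW : Continuous (WW Λ v) := by
    unfold WW lapl
    exact (continuous_finsetSum _ fun l _ => c2 l l).add continuous_const
  have hxi : x ∈ interior {x | ζ x = 1} := by
    refine mem_interior.2 ⟨ball x₀ (9/8*R), fun y hy => ζ.one_of_mem_closedBall (ball_subset_closedBall hy), isOpen_ball, ?_⟩
    exact ball_subset_ball (by linarith) hx
  have hxK : x ∈ K := ball_subset_closedBall (ball_subset_ball (by linarith) hx)
  refine ((WW_facts hΛ hκ H hxK).2.1 i j).trans (hC (WW Λ v) cW ?_ ?_ ?_ x hxi)
  · intro y hy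
    rw [hts] at hy
    exact (WW_facts hΛ hκ H (hKs hy)).1
  · intro q hq a ha
    obtain ⟨w, w1, w2, w3⟩ := hw v G F H q hq
    have hta : ∀ y ∈ tsupport (fun y => ζ y^a), y ∈ closedBall x₀ (5/4*R) := by
      intro y hy
      rw [← hts]
      refine closure_mono ?_ hy
      intro z hz
      rw [Function.mem_support] at hz ⊢
      intro h0; rw [h0, zero_pow (by omega)] at hz; exact hz rfl
    have hca : HasCompactSupport (fun y => ζ y^a) := by
      refine HasCompactSupport.intro (isCompact_closedBall x₀ (5/4*R)) fun y hy => ?_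
      have h0 : ζ y = 0 := ζ.zero_of_le_dist (by rw [mem_closedBall, not_le] at hy; exact hy.le)
      simp only [h0]; exact zero_pow (by omega)
    refine hrh v G w (WW Λ v) (fun y => ζ y^a) q H.hv H.hvc H.hG H.hGc w1 w2 cW (ζ.contDiff.pow a) hca hq (fun y hy => (w3 y (hta y hy)).1) ?_
      (fun y hy => (w3 y (hta y hy)).2)
    intro ε hε
    obtain ⟨Γ, g1, g2⟩ := Gam_ex hΛ hκ H (S := closedBall x₀ (5/4*R)) (ρ := R/4) (by positivity) (fun y hy => by
      refine closedBall_subset_closedBall' ?_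
      rw [mem_closedBall] at hy; linarith) hε
    refine ⟨Γ, g1, fun y hy => ⟨(g2 y (hta y hy)).1, fun i j => ((g2 y (hta y hy)).2 i j).trans ?_⟩⟩
    have := (WW_facts hΛ hκ H (hKs (hta y hy))).1
    gcongr
  · have hpt : ∀ y, WW Λ v y^p * ζ y^2 ≤ K.indicator (fun y => (2*(1 + n*Λ^3))^p + 2^p * (∑ i, ∑ j, |pd i (pd j v) y|)^p) y := by
      intro y
      by_cases hy : y ∈ closedBall x₀ (5/4*R)
      · rw [indicator_of_mem (hKs hy)]
        have hW := (WW_facts hΛ hκ H (hKs hy)).1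
        have z0 := ζ.nonneg' y
        have z1 : ζ y ≤ 1 := ζ.le_one
        have hz : ζ y^2 ≤ 1 := by nlinarith
        have hWp : 0 ≤ WW Λ v y^p := by positivity
        refine (mul_le_of_le_one_right hWp hz).trans ?_
        set S := ∑ i, ∑ j, |pd i (pd j v) y| with hS
        have hS0 : 0 ≤ S := Finset.sum_nonneg fun i _ => Finset.sum_nonneg fun j _ => abs_nonneg _
        have hc0 : (0:ℝ) ≤ 1 + n*Λ^3 := by positivity
        have hl : lapl v y ≤ S := by
          unfold lapl
          refine Finset.sum_le_sum fun l _ => (le_abs_self _).trans ?_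
          exact Finset.single_le_sum (f := fun j => |pd l (pd j v) y|) (fun j _ => abs_nonneg _) (Finset.mem_univ l)
        have hWS : WW Λ v y ≤ (1 + n*Λ^3) + S := by unfold WW; linarith
        rcases le_total S (1 + n*Λ^3) with hc | hc
        · have h1 : WW Λ v y^p ≤ (2*(1 + n*Λ^3))^p := Real.rpow_le_rpow (by linarith) (by linarith) hp0.le
          have : 0 ≤ 2^p * S^p := by positivity
          linarith
        · have h1 : WW Λ v y^p ≤ (2*S)^p := Real.rpow_le_rpow (by linarith) (by linarith) hp0.le
          rw [Real.mul_rpow (by norm_num) hS0] at h1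
          have : 0 ≤ (2*(1 + n*Λ^3))^p := by positivity
          linarith
      · have h0 : ζ y = 0 := ζ.zero_of_le_dist (by rw [mem_closedBall, not_le] at hy; exact hy.le)
        rw [h0]
        simp only [ne_eq, OfNat.ofNat_ne_zero, not_false_eq_true, zero_pow, mul_zero]
        refine indicator_nonneg (fun z _ => ?_) y
        have : 0 ≤ ∑ i, ∑ j, |pd i (pd j v) z| := Finset.sum_nonneg fun i _ => Finset.sum_nonneg fun j _ => abs_nonneg _
        positivity
    have cS : Continuous fun y => (∑ i, ∑ j, |pd i (pd j v) y|)^p := by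
      refine Continuous.rpow_const ?_ fun y => Or.inr hp0.le
      exact continuous_finsetSum _ fun i _ => continuous_finsetSum _ fun j _ => (c2 i j).abs
    have hKc : IsCompact K := isCompact_closedBall _ _
    have i1 : IntegrableOn (fun y => (∑ i, ∑ j, |pd i (pd j v) y|)^p) K := cS.continuousOn.integrableOn_compact hKc
    have i0 : IntegrableOn (fun y : Fin n → ℝ => (2*(1 + n*Λ^3))^p) K := continuousOn_const.integrableOn_compact hKc
    calc ∫ y, WW Λ v y^p * ζ y^2 ≤ ∫ y, K.indicator (fun y => (2*(1 + n*Λ^3))^p + 2^p * (∑ i, ∑ j, |pd i (pd j v) y|)^p) y := by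
          refine integral_mono_of_nonneg ?_ ?_ (Filter.Eventually.of_forall hpt)
          · refine Filter.Eventually.of_forall fun y => ?_
            by_cases hy : y ∈ closedBall x₀ (5/4*R)
            · have hW := (WW_facts hΛ hκ H (hKs hy)).1
              show 0 ≤ WW Λ v y^p * ζ y^2
              positivity
            · have h0 : ζ y = 0 := ζ.zero_of_le_dist (by rw [mem_closedBall, not_le] at hy; exact hy.le)
              simp [h0]
          · exact (i0.add (i1.const_mul _)).integrable_indicator measurableSet_closedBall
      _ = (2*(1 + n*Λ^3))^p * volume.real K + 2^p * ∫ y in K, (∑ i, ∑ j, |pd i (pd j v) y|)^p := by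
          rw [integral_indicator measurableSet_closedBall, integral_add i0 (i1.const_mul _), integral_const_mul, setIntegral_const, smul_eq_mul, mul_comm]
      _ ≤ _ := by gcongr

end main
end IHE

end

noncomputable section
set_option linter.unusedSectionVars false
set_option linter.style.longLine false
set_option linter.unusedSimpArgs false
namespace IHE
section fin
variable {n : ℕ}

lemma cut {r : WithTop ℕ∞} {Ω : Set (Fin n → ℝ)} (hΩ : IsOpen Ω) {g χ : (Fin n → ℝ) → ℝ} (hg : ContDiffOn ℝ r g Ω) (hχ : ContDiff ℝ r χ)
    (hχc : HasCompactSupport χ) (hs : tsupport χ ⊆ Ω) : ContDiff ℝ r (fun x => χ x * g x) ∧ HasCompactSupport (fun x => χ x * g x) := by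
  refine ⟨contDiff_iff_contDiffAt.2 fun x => ?_, hχc.mul_right⟩
  by_cases hx : x ∈ tsupport χ
  · exact hχ.contDiffAt.mul (hg.contDiffAt (hΩ.mem_nhds (hs hx)))
  · have : (fun x => χ x * g x) =ᶠ[nhds x] fun _ => 0 := by
      filter_upwards [(isClosed_tsupport χ).isOpen_compl.mem_nhds hx] with y hy
      rw [image_eq_zero_of_notMem_tsupport hy, zero_mul]
    exact contDiffAt_const.congr_of_eventuallyEq this

lemma matNorm_cont : Continuous (matNorm : Matrix (Fin n) (Fin n) ℝ → ℝ) := by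
  unfold matNorm
  have : Continuous ((LinearMap.toContinuousLinearMap.toLinearMap ∘ₗ Matrix.toEuclideanLin.toLinearMap :
    Matrix (Fin n) (Fin n) ℝ →ₗ[ℝ] (EuclideanSpace ℝ (Fin n) →L[ℝ] EuclideanSpace ℝ (Fin n)))) := LinearMap.continuous_of_finiteDimensional _
  exact this.norm

lemma entry_le_matNorm (A : Matrix (Fin n) (Fin n) ℝ) (i j : Fin n) : |A i j| ≤ matNorm A := by
  unfold matNorm
  have h := (LinearMap.toContinuousLinearMap (Matrix.toEuclideanLin A)).le_opNorm (EuclideanSpace.single j (1:ℝ))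
  have h2 := EuclideanSpace.norm_eq ((LinearMap.toContinuousLinearMap (Matrix.toEuclideanLin A)) (EuclideanSpace.single j (1:ℝ)))
  have h3 : ((LinearMap.toContinuousLinearMap (Matrix.toEuclideanLin A)) (EuclideanSpace.single j (1:ℝ))) i = A i j := by
    simp [Matrix.toLpLin_apply]
  have h4 := PiLp.norm_apply_le ((LinearMap.toContinuousLinearMap (Matrix.toEuclideanLin A)) (EuclideanSpace.single j (1:ℝ))) i
  rw [h3, Real.norm_eq_abs] at h4
  refine h4.trans (h.trans ?_)
  simp

lemma vnorm_le_sum (w : Fin n → ℝ) : vnorm w ≤ ∑ i, |w i| := by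
  unfold vnorm
  have h0 : 0 ≤ ∑ i, |w i| := Finset.sum_nonneg fun i _ => abs_nonneg _
  rw [Real.sqrt_le_left h0]
  have := Finset.sum_sq_le_sq_sum_of_nonneg (s := Finset.univ) (f := fun i => |w i|) (fun i _ => abs_nonneg _)
  simpa [sq_abs] using this

lemma le_vnorm (w : Fin n → ℝ) (i : Fin n) : |w i| ≤ vnorm w := by
  unfold vnorm
  apply Real.abs_le_sqrt
  exact Finset.single_le_sum (f := fun i => w i^2) (fun j _ => sq_nonneg _) (Finset.mem_univ i)

lemma matNorm_le_sum (A : Matrix (Fin n) (Fin n) ℝ) : matNorm A ≤ ∑ i, ∑ j, |A i j| := by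
  unfold matNorm
  refine ContinuousLinearMap.opNorm_le_bound _ (Finset.sum_nonneg fun i _ => Finset.sum_nonneg fun j _ => abs_nonneg _) fun v => ?_
  have e : ‖(LinearMap.toContinuousLinearMap (Matrix.toEuclideanLin A)) v‖ = vnorm (A *ᵥ v.ofLp) := by
    rw [EuclideanSpace.norm_eq]; simp [vnorm, Matrix.toLpLin_apply]
  rw [e]
  refine (vnorm_le_sum _).trans ?_
  rw [Finset.sum_mul]
  refine Finset.sum_le_sum fun i _ => ?_
  rw [Matrix.mulVec, dotProduct, Finset.sum_mul]
  refine (Finset.abs_sum_le_sum_abs _ _).trans (Finset.sum_le_sum fun j _ => ?_)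
  rw [abs_mul]
  gcongr
  exact PiLp.norm_apply_le v j

lemma matNorm_nonneg (A : Matrix (Fin n) (Fin n) ℝ) : 0 ≤ matNorm A := norm_nonneg _
lemma vnorm_nonneg (w : Fin n → ℝ) : 0 ≤ vnorm w := Real.sqrt_nonneg _

/-- the W2p bound dominates integrals over smaller sets -/
lemma W2p_dom {p : ℝ} (hp0 : 0 < p) {Ω : Set (Fin n → ℝ)} (hΩ : IsOpen Ω) {x₀ : Fin n → ℝ} {R : ℝ} (hR : 0 < R) (hball : closure (ball x₀ (2 * R)) ⊆ Ω)
    {M : ℝ} {u : (Fin n → ℝ) → ℝ} (hu : ContDiffOn ℝ 2 u Ω) (hM : W2pNorm p u (ball x₀ (2 * R)) ≤ M)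
    {S : Set (Fin n → ℝ)} (hSm : MeasurableSet S) (hS : S ⊆ ball x₀ (2 * R)) {g : (Fin n → ℝ) → ℝ} {c : ℝ} (hc : 0 ≤ c) 
    (hg0 : ∀ y ∈ S, 0 ≤ g y) (hg : ∀ y ∈ S, g y ≤ c * (|u y|^p + vnorm (grad u y)^p + matNorm (hess u y)^p)) :
    ∫ y in S, g y ≤ c * M^p := by
  set J : (Fin n → ℝ) → ℝ := fun y => |u y|^p + vnorm (grad u y)^p + matNorm (hess u y)^p with hJ
  have J0 : ∀ y, 0 ≤ J y := fun y => by
    have := matNorm_nonneg (hess u y); have := vnorm_nonneg (grad u y)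
    simp only [hJ]; positivity
  have cp : ∀ i, ContDiffOn ℝ 1 (pd i u) Ω := fun i => pd_contDiffOn hΩ hu (by norm_num)
  have cpp : ∀ i j, ContDiffOn ℝ 0 (pd i (pd j u)) Ω := fun i j => pd_contDiffOn hΩ (cp j) (by norm_num)
  have cJ : ContinuousOn J Ω := by
    refine ContinuousOn.add (ContinuousOn.add ?_ ?_) ?_
    · exact (hu.continuousOn.abs).rpow_const fun y _ => Or.inr hp0.le
    · refine ContinuousOn.rpow_const ?_ fun y _ => Or.inr hp0.le
      unfold vnorm grad
      exact (continuousOn_finsetSum _ fun i _ => (cp i).continuousOn.pow 2).sqrt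
    · refine ContinuousOn.rpow_const ?_ fun y _ => Or.inr hp0.le
      refine matNorm_cont.comp_continuousOn ?_
      refine continuousOn_pi.2 fun i => continuousOn_pi.2 fun j => ?_
      exact (cpp i j).continuousOn
  have hcc : IsCompact (closure (ball x₀ (2 * R))) := isBounded_ball.isCompact_closure
  have iJ : IntegrableOn J (ball x₀ (2*R)) := ((cJ.mono hball).integrableOn_compact hcc).mono_set subset_closure
  have hI0 : 0 ≤ ∫ y in ball x₀ (2*R), J y := integral_nonneg J0
  have hIM : ∫ y in ball x₀ (2*R), J y ≤ M^p := by
    have h1 : (∫ y in ball x₀ (2*R), J y)^(1/p) ≤ M := hM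
    have h2 := Real.rpow_le_rpow (by positivity) h1 hp0.le
    rwa [← Real.rpow_mul hI0, one_div, inv_mul_cancel₀ hp0.ne', Real.rpow_one] at h2
  calc ∫ y in S, g y ≤ ∫ y in S, c * J y := by
        refine integral_mono_of_nonneg ?_ ((iJ.mono_set hS).const_mul c) ?_
        · exact (ae_restrict_iff' hSm).2 (Filter.Eventually.of_forall hg0)
        · exact (ae_restrict_iff' hSm).2 (Filter.Eventually.of_forall hg)
    _ = c * ∫ y in S, J y := integral_const_mul _ _
    _ ≤ c * ∫ y in ball x₀ (2*R), J y := by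
        exact mul_le_mul_of_nonneg_left (setIntegral_mono_set iJ (Filter.Eventually.of_forall J0) hS.eventuallyLE) hc
    _ ≤ _ := by gcongr

lemma sup_bd (hn : 3 ≤ n) {p : ℝ} (hp : (n:ℝ) < p) {Ω : Set (Fin n → ℝ)} (hΩ : IsOpen Ω) {x₀ : Fin n → ℝ} {R : ℝ} (hR : 0 < R) (hball : closure (ball x₀ (2 * R)) ⊆ Ω)
    {M : ℝ} (hM0 : 0 < M) : ∃ B M2 : ℝ, 1 ≤ B ∧ ∀ u v : (Fin n → ℝ) → ℝ, ContDiffOn ℝ 2 u Ω → W2pNorm p u (ball x₀ (2 * R)) ≤ M → ContDiff ℝ 2 v →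
      (∀ x ∈ ball x₀ (7/4*R), v x = u x) →
      (∀ x ∈ closedBall x₀ (3/2*R), |v x| ≤ B ∧ ∀ m, |pd m v x| ≤ B) ∧ 
      ∫ x in closedBall x₀ (3/2*R), (∑ i, ∑ j, |pd i (pd j v) x|)^p ≤ M2 := by
  have hp0 : 0 < p := lt_of_le_of_lt (by positivity) hp
  obtain ⟨C, hC, hmor⟩ := morrey (n := n) (by omega) hp (r := R/8) (by positivity)
  set c : ℝ := (n:ℝ)^p with hc
  have hc0 : 0 ≤ c := by positivity
  have hn1 : (1:ℝ) ≤ n := by exact_mod_cast (by omega : 1 ≤ n)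
  have hc1 : 1 ≤ c := Real.one_le_rpow hn1 hp0.le
  have hCp : 0 ≤ C * (1 + c * M^p + c * M^p) := by positivity
  refine ⟨1 + C * (1 + c * M^p + c * M^p), ((n:ℝ)^2)^p * M^p, by linarith, fun u v hu hM hv hvu => ?_⟩
  have hU : ∀ x ∈ ball x₀ (7/4*R), v =ᶠ[nhds x] u := fun x hx => Filter.eventuallyEq_of_mem (isOpen_ball.mem_nhds hx) hvu
  have hd1 : ∀ x ∈ ball x₀ (7/4*R), ∀ m, pd m v x = pd m u x := fun x hx m => pd_congr (hU x hx)
  have hd2 : ∀ x ∈ ball x₀ (7/4*R), ∀ i m, pd i (pd m v) x = pd i (pd m u) x := fun x hx i m =>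
    pd_congr (Filter.eventuallyEq_of_mem (isOpen_ball.mem_nhds hx) fun y hy => hd1 y hy m)
  have hJ : ∀ y, 0 ≤ |u y|^p ∧ 0 ≤ vnorm (grad u y)^p ∧ 0 ≤ matNorm (hess u y)^p := fun y =>
    ⟨by positivity, Real.rpow_nonneg (vnorm_nonneg _) _, Real.rpow_nonneg (matNorm_nonneg _) _⟩
  have hent : ∀ y i j, |pd i (pd j u) y| ≤ matNorm (hess u y) := fun y i j => by
    have := entry_le_matNorm (hess u y) i j
    simpa [hess] using this
  constructor
  · intro x hx
    have hS : closedBall x (R/8) ⊆ ball x₀ (7/4*R) := by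
      refine closedBall_subset_ball' ?_
      rw [mem_closedBall] at hx; linarith
    have hS2 : closedBall x (R/8) ⊆ ball x₀ (2*R) := hS.trans (ball_subset_ball (by linarith))
    have key := fun (g : (Fin n → ℝ) → ℝ) => W2p_dom (g := g) hp0 hΩ hR hball hu hM (S := closedBall x (R/8)) measurableSet_closedBall hS2 hc0
    have fin : ∀ g : (Fin n → ℝ) → ℝ, ContDiff ℝ 1 g → (∫ y in closedBall x (R/8), |g y|^p) ≤ c * M^p → (∫ y in closedBall x (R/8), ‖fderiv ℝ g y‖^p) ≤ c * M^p →
        |g x| ≤ 1 + C * (1 + c * M^p + c * M^p) := by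
      intro g hg a b
      have h1 := hmor g hg x
      have h2 : C * (1 + (∫ y in closedBall x (R/8), |g y|^p) + ∫ y in closedBall x (R/8), ‖fderiv ℝ g y‖^p) ≤ C * (1 + c * M^p + c * M^p) := by
        gcongr
      linarith
    refine ⟨fin v (hv.of_le (by norm_num)) ?_ ?_, fun m => fin _ (pd_contDiff hv (by norm_num)) ?_ ?_⟩
    · refine key _ (fun y _ => by positivity) fun y hy => ?_
      rw [hvu y (hS hy)]
      obtain ⟨a1, a2, a3⟩ := hJ y
      nlinarith
    · refine key _ (fun y _ => by positivity) fun y hy => ?_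
      obtain ⟨a1, a2, a3⟩ := hJ y
      have h1 : ‖fderiv ℝ v y‖ ≤ n * vnorm (grad u y) := by
        refine (fd_norm v y).trans ?_
        refine (Finset.sum_le_sum fun i _ => (by rw [hd1 y (hS hy)]; exact le_vnorm (grad u y) i : |pd i v y| ≤ vnorm (grad u y))).trans ?_
        simp
      have h2 := Real.rpow_le_rpow (norm_nonneg _) h1 hp0.le
      rw [Real.mul_rpow (by positivity) (vnorm_nonneg _)] at h2
      nlinarith
    · refine key _ (fun y _ => by positivity) fun y hy => ?_
      obtain ⟨a1, a2, a3⟩ := hJ y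
      have h1 : |pd m v y| ≤ vnorm (grad u y) := by rw [hd1 y (hS hy)]; exact le_vnorm (grad u y) m
      have h2 := Real.rpow_le_rpow (abs_nonneg _) h1 hp0.le
      nlinarith
    · refine key _ (fun y _ => by positivity) fun y hy => ?_
      obtain ⟨a1, a2, a3⟩ := hJ y
      have h1 : ‖fderiv ℝ (pd m v) y‖ ≤ n * matNorm (hess u y) := by
        refine (fd_norm _ y).trans ?_
        refine (Finset.sum_le_sum fun i _ => (by rw [hd2 y (hS hy)]; exact hent y i m : |pd i (pd m v) y| ≤ matNorm (hess u y))).trans ?_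
        simp
      have h2 := Real.rpow_le_rpow (norm_nonneg _) h1 hp0.le
      rw [Real.mul_rpow (by positivity) (matNorm_nonneg _)] at h2
      nlinarith
  · have hS : closedBall x₀ (3/2*R) ⊆ ball x₀ (7/4*R) := closedBall_subset_ball (by linarith)
    have hS2 : closedBall x₀ (3/2*R) ⊆ ball x₀ (2*R) := closedBall_subset_ball (by linarith)
    refine W2p_dom hp0 hΩ hR hball hu hM measurableSet_closedBall hS2 (by positivity) (fun y _ => ?_) fun y hy => ?_
    · exact Real.rpow_nonneg (Finset.sum_nonneg fun i _ => Finset.sum_nonneg fun j _ => abs_nonneg _) _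
    · obtain ⟨a1, a2, a3⟩ := hJ y
      have h1 : ∑ i, ∑ j, |pd i (pd j v) y| ≤ (n:ℝ)^2 * matNorm (hess u y) := by
        refine (Finset.sum_le_sum fun i _ => Finset.sum_le_sum fun j _ => (by rw [hd2 y (hS hy)]; exact hent y i j : |pd i (pd j v) y| ≤ matNorm (hess u y))).trans ?_
        simp; apply le_of_eq; ring
      have h2 := Real.rpow_le_rpow (Finset.sum_nonneg fun i _ => Finset.sum_nonneg fun j _ => abs_nonneg _) h1 hp0.le
      rw [Real.mul_rpow (by positivity) (matNorm_nonneg _)] at h2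
      refine h2.trans ?_
      gcongr
      linarith

end fin
end IHE

end

noncomputable section
set_option linter.unusedSectionVars false
set_option linter.style.longLine false
set_option linter.unusedSimpArgs false
namespace IHE
section locof
variable {n : ℕ}

def C11K {E : Type*} [NormedAddCommGroup E] [NormedSpace ℝ E] (L : ℝ) (K : Set E) (f : E → ℝ) : Prop :=
  1 ≤ L ∧ (∀ y ∈ K, |f y| ≤ L ∧ ‖fderiv ℝ f y‖ ≤ L) ∧
      (∀ y ∈ K, ∀ z ∈ K, ‖fderiv ℝ f z - fderiv ℝ f y‖ ≤ L * ‖z - y‖ ∧ |f z - f y - fderiv ℝ f y (z - y)| ≤ L * ‖z - y‖^2)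

lemma loc_of (hn : 3 ≤ n) {κ : ℕ} {Ω K U : Set (Fin n → ℝ)} (hΩ : IsOpen Ω) (hKΩ : K ⊆ Ω) (hU : IsOpen U) (hKU : K ⊆ U) (hKc : Convex ℝ K)
    {f : ((Fin n → ℝ) × ℝ × (Fin n → ℝ)) → ℝ} {H₁ : ((Fin n → ℝ) × ℝ) → ℝ} (hH : ContDiffOn ℝ 1 H₁ (Ω ×ˢ (univ : Set ℝ)))
    (hH0 : ∀ y ∈ Ω ×ˢ (univ : Set ℝ), 0 ≤ H₁ y) {B c0 Lf LH : ℝ} (hB : 1 ≤ B) (hc0 : 0 < c0)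
    (hf : C11K Lf (K ×ˢ (Icc (-B) B ×ˢ closedBall (0 : Fin n → ℝ) B)) f) (hf0 : ∀ y ∈ K ×ˢ (Icc (-B) B ×ˢ closedBall (0 : Fin n → ℝ) B), c0 ≤ f y)
    (hHK : C11K LH (K ×ˢ Icc (-B) B) H₁)
    {v G : (Fin n → ℝ) → ℝ} (hv : ContDiff ℝ 2 v) (hvc : HasCompactSupport v) (hG : ContDiff ℝ 1 G) (hGc : HasCompactSupport G)
    (hGU : ∀ x ∈ U, G x = H₁ (x, v x)) (hvB : ∀ x ∈ K, |v x| ≤ B ∧ ∀ m, |pd m v x| ≤ B)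
    (gs : ∀ x ∈ K, GS (κ+2) (AA v (gg G v) x)) (ss : ∀ x ∈ K, SS (κ+2) (AA v (gg G v) x) = f (x, v x, grad v x)^(κ+2)) :
    Loc (B + 1/c0 + (Lf + LH)*(n*B)^2) κ K v G (fun x => f (x, v x, grad v x)) := by
  obtain ⟨hLf, hf1, hf2⟩ := hf
  obtain ⟨hLH, hH1, hH2⟩ := hHK
  have hn1 : (1:ℝ) ≤ n := by exact_mod_cast (by omega : 1 ≤ n)
  have hnB : 1 ≤ (n:ℝ)*B := by nlinarith
  have hnB2 : 1 ≤ ((n:ℝ)*B)^2 := one_le_pow₀ hnB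
  have hBnB : B ≤ n * B := by nlinarith
  have hnBs : (n:ℝ)*B ≤ (n*B)^2 := by nlinarith
  have hc1 : 0 < 1/c0 := by positivity
  set Λ := B + 1/c0 + (Lf + LH)*(n*B)^2 with hΛ
  have q1 : LH * (n*B)^2 ≤ Λ := by nlinarith
  have q2 : Lf * (n*B)^2 ≤ Λ := by nlinarith
  have q3 : B ≤ Λ := by nlinarith
  have q4 : 1/c0 ≤ Λ := by nlinarith
  have q5 : LH ≤ Λ := by nlinarith
  have q6 : Lf ≤ Λ := by nlinarith
  have q7 : LH * B ≤ Λ := by nlinarith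
  have hΛ0 : 0 < Λ := by linarith
  have memH : ∀ x ∈ K, (x, v x) ∈ K ×ˢ Icc (-B) B := fun x hx => ⟨hx, abs_le.1 (hvB x hx).1⟩
  have memf : ∀ x ∈ K, (x, v x, grad v x) ∈ K ×ˢ (Icc (-B) B ×ˢ closedBall (0 : Fin n → ℝ) B) := fun x hx => by
    refine ⟨hx, abs_le.1 (hvB x hx).1, ?_⟩
    rw [mem_closedBall, dist_zero_right, pi_norm_le_iff_of_nonneg (by linarith)]
    exact (hvB x hx).2
  have hdv : Differentiable ℝ v := hv.differentiable two_ne_zero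
  have hop : IsOpen (Ω ×ˢ (univ : Set ℝ)) := hΩ.prod isOpen_univ
  have hpG : ∀ x ∈ K, ∀ m, pd m G x = fderiv ℝ H₁ (x, v x) (Pi.single m 1, pd m v x) := by
    intro x hx m
    have h1 : HasFDerivAt H₁ (fderiv ℝ H₁ (x, v x)) (x, v x) :=
      ((hH.differentiableOn one_ne_zero).differentiableAt (hop.mem_nhds ⟨hKΩ hx, mem_univ _⟩)).hasFDerivAt
    have h2 : HasFDerivAt (fun y => (y, v y)) ((ContinuousLinearMap.id ℝ (Fin n → ℝ)).prod (fderiv ℝ v x)) x :=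
      (hasFDerivAt_id x).prodMk (hdv x).hasFDerivAt
    have h3 := h1.comp x h2
    rw [pd_congr (Filter.eventuallyEq_of_mem (hU.mem_nhds (hKU hx)) hGU)]
    unfold pd
    have h4 : fderiv ℝ (fun y => H₁ (y, v y)) x = _ := h3.fderiv
    rw [h4]; rfl
  have hlip : ∀ x ∈ K, ∀ y ∈ K, |v y - v x| ≤ n * B * ‖y - x‖ := fun x hx y hy =>
    lip_of_pd hdv hKc (fun z hz i => (hvB z hz).2 i) hx hy
  have hX : ∀ x ∈ K, ∀ y ∈ K, ‖(y, v y) - (x, v x)‖ ≤ n * B * ‖y - x‖ := by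
    intro x hx y hy
    rw [Prod.mk_sub_mk, Prod.norm_mk]
    exact max_le (le_mul_of_one_le_left (norm_nonneg _) hnB) (hlip x hx y hy)
  have hem : ∀ x ∈ K, ∀ m, ‖((Pi.single m 1 : Fin n → ℝ), pd m v x)‖ ≤ B := by
    intro x hx m
    rw [Prod.norm_mk, Pi.norm_single]
    exact max_le (by simpa using hB) ((hvB x hx).2 m)
  refine ⟨hv, hvc, hG, hGc, gs, ss, fun x hx => ?_, fun x hx => ?_, fun x hx => ?_, fun x hx => ?_, fun x hx m => ((hvB x hx).2 m).trans q3, fun x hx m => ?_,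
    fun x hx => ?_, fun x hx => ?_, fun x hx y hy i => ?_⟩
  · refine le_trans ?_ (hf0 _ (memf x hx))
    rw [div_le_iff₀ hΛ0]; rw [div_le_iff₀ hc0] at q4; linarith
  · exact (le_abs_self _).trans ((hf1 _ (memf x hx)).1.trans q6)
  · rw [hGU x (hKU hx)]; exact hH0 _ ⟨hKΩ hx, mem_univ _⟩
  · rw [hGU x (hKU hx)]; exact (le_abs_self _).trans ((hH1 _ (memH x hx)).1.trans q5)
  · rw [hpG x hx, ← Real.norm_eq_abs]
    refine (ContinuousLinearMap.le_opNorm _ _).trans ?_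
    refine le_trans ?_ q7
    exact mul_le_mul (hH1 _ (memH x hx)).2 (hem x hx m) (norm_nonneg _) (by linarith)
  · set D := fderiv ℝ H₁ (x, v x) with hD
    have hDn : ‖D‖ ≤ LH := (hH1 _ (memH x hx)).2
    refine ⟨D.comp (ContinuousLinearMap.inl ℝ (Fin n → ℝ) ℝ), D (0, 1), ?_, fun y hy => ?_⟩
    · have := D.le_opNorm (0, 1)
      simp only [Prod.norm_mk, norm_zero, norm_one, zero_le_one, max_eq_right, mul_one, Real.norm_eq_abs] at this
      linarith
    · have h1 := (hH2 _ (memH x hx) _ (memH y hy)).2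
      rw [hGU y (hKU hy), hGU x (hKU hx)]
      have e : D ((y, v y) - (x, v x)) = D.comp (ContinuousLinearMap.inl ℝ (Fin n → ℝ) ℝ) (y - x) + D (0, 1) * (v y - v x) := by
        have : (y, v y) - (x, v x) = (y - x, (0:ℝ)) + (v y - v x) • ((0 : Fin n → ℝ), (1:ℝ)) := by
          ext <;> simp
        rw [this, map_add, map_smul, smul_eq_mul, mul_comm]; rfl
      rw [← hD, e] at h1
      refine h1.trans ?_
      calc LH * ‖(y, v y) - (x, v x)‖^2 ≤ LH * (n * B * ‖y - x‖)^2 := by gcongr; exact hX x hx y hy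
        _ = (LH * (n*B)^2) * ‖y - x‖^2 := by ring
        _ ≤ _ := by gcongr
  · set D := fderiv ℝ f (x, v x, grad v x) with hD
    have hDn : ‖D‖ ≤ Lf := (hf1 _ (memf x hx)).2
    refine ⟨D.comp (ContinuousLinearMap.inl ℝ (Fin n → ℝ) (ℝ × (Fin n → ℝ))), D (0, 1, 0), fun m => D (0, 0, Pi.single m 1), ?_, fun m => ?_, fun y hy => ?_⟩
    · have := D.le_opNorm (0, 1, 0)
      simp only [Prod.norm_mk, norm_zero, norm_one, zero_le_one, max_eq_right, max_eq_left, mul_one, Real.norm_eq_abs] at this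
      linarith
    · have := D.le_opNorm (0, 0, Pi.single m 1)
      simp only [Prod.norm_mk, norm_zero, norm_one, Pi.norm_single, zero_le_one, max_eq_right, max_eq_left, mul_one, Real.norm_eq_abs, abs_one] at this
      linarith
    · have h1 := (hf2 _ (memf x hx) _ (memf y hy)).2
      have e : D ((y, v y, grad v y) - (x, v x, grad v x)) = D.comp (ContinuousLinearMap.inl ℝ (Fin n → ℝ) (ℝ × (Fin n → ℝ))) (y - x) + D (0, 1, 0) * (v y - v x)
          + ∑ m, D (0, 0, Pi.single m 1) * (pd m v y - pd m v x) := by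
        have h2 : (y, v y, grad v y) - (x, v x, grad v x) = (y - x, (0:ℝ), (0 : Fin n → ℝ)) + (v y - v x) • ((0 : Fin n → ℝ), (1:ℝ), (0 : Fin n → ℝ))
            + ((0 : Fin n → ℝ), (0:ℝ), grad v y - grad v x) := by
          ext <;> simp
        have h3 : D ((0 : Fin n → ℝ), (0:ℝ), grad v y - grad v x) = ∑ m, D (0, 0, Pi.single m 1) * (pd m v y - pd m v x) := by
          have := fd_apply (D.comp ((ContinuousLinearMap.inr ℝ (Fin n → ℝ) (ℝ × (Fin n → ℝ))).comp (ContinuousLinearMap.inr ℝ ℝ (Fin n → ℝ)))) (grad v y - grad v x)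
          refine this.trans (Finset.sum_congr rfl fun m _ => ?_)
          rw [mul_comm]; rfl
        rw [h2, map_add, map_add, map_smul, smul_eq_mul, mul_comm (v y - v x), h3]; rfl
      rw [← hD, e] at h1
      refine h1.trans ?_
      have hs0 : 0 ≤ ∑ m, (pd m v y - pd m v x)^2 := Finset.sum_nonneg fun m _ => sq_nonneg _
      have h4 : ‖grad v y - grad v x‖^2 ≤ ∑ m, (pd m v y - pd m v x)^2 := by
        have : ‖grad v y - grad v x‖ ≤ vnorm (grad v y - grad v x) := by
          rw [pi_norm_le_iff_of_nonneg (vnorm_nonneg _)]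
          exact fun m => le_vnorm _ m
        calc _ ≤ vnorm (grad v y - grad v x)^2 := by gcongr
          _ = _ := by unfold vnorm; rw [Real.sq_sqrt (Finset.sum_nonneg fun m _ => sq_nonneg _)]; rfl
      have h5 : ‖(y, v y, grad v y) - (x, v x, grad v x)‖^2 ≤ (n*B)^2 * (‖y-x‖^2 + ∑ m, (pd m v y - pd m v x)^2) := by
        have a1 : ‖y - x‖^2 ≤ (n*B*‖y-x‖)^2 := by gcongr; exact le_mul_of_one_le_left (norm_nonneg _) hnB
        have a2 : ‖v y - v x‖^2 ≤ (n*B*‖y-x‖)^2 := by gcongr; exact hlip x hx y hy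
        have a3 : (n*B*‖y-x‖)^2 = (n*B)^2 * ‖y-x‖^2 := by ring
        have a4 : ∑ m, (pd m v y - pd m v x)^2 ≤ (n*B)^2 * ∑ m, (pd m v y - pd m v x)^2 := le_mul_of_one_le_left hs0 hnB2
        have a5 : 0 ≤ (n*B)^2 * ‖y-x‖^2 := by positivity
        rw [Prod.mk_sub_mk, Prod.mk_sub_mk, Prod.norm_mk, Prod.norm_mk]
        rcases max_cases ‖y - x‖ (max ‖v y - v x‖ ‖grad v y - grad v x‖) with ⟨hm, _⟩ | ⟨hm, _⟩ <;> rw [hm]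
        · linarith
        · rcases max_cases ‖v y - v x‖ ‖grad v y - grad v x‖ with ⟨hm, _⟩ | ⟨hm, _⟩ <;> rw [hm] <;> linarith
      calc Lf * ‖(y, v y, grad v y) - (x, v x, grad v x)‖^2 ≤ Lf * ((n*B)^2 * (‖y-x‖^2 + ∑ m, (pd m v y - pd m v x)^2)) := by gcongr
        _ = (Lf * (n*B)^2) * (‖y-x‖^2 + ∑ m, (pd m v y - pd m v x)^2) := by ring
        _ ≤ _ := by gcongr
  · rw [hpG x hx, hpG y hy]
    have e : fderiv ℝ H₁ (y, v y) (Pi.single i 1, pd i v y) - fderiv ℝ H₁ (x, v x) (Pi.single i 1, pd i v x) =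
        (fderiv ℝ H₁ (y, v y) - fderiv ℝ H₁ (x, v x)) (Pi.single i 1, pd i v y) + fderiv ℝ H₁ (x, v x) (0, pd i v y - pd i v x) := by
      have : ((0 : Fin n → ℝ), pd i v y - pd i v x) = ((Pi.single i 1 : Fin n → ℝ), pd i v y) - (Pi.single i 1, pd i v x) := by simp
      rw [this, map_sub, _root_.sub_apply]; ring
    rw [e]
    have b1 : |(fderiv ℝ H₁ (y, v y) - fderiv ℝ H₁ (x, v x)) (Pi.single i 1, pd i v y)| ≤ LH * (n*B*‖y-x‖) * B := by
      rw [← Real.norm_eq_abs]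
      refine (ContinuousLinearMap.le_opNorm _ _).trans (mul_le_mul ?_ (hem y hy i) (norm_nonneg _) (by positivity))
      refine (hH2 _ (memH x hx) _ (memH y hy)).1.trans ?_
      gcongr
      exact hX x hx y hy
    have b2 : |fderiv ℝ H₁ (x, v x) (0, pd i v y - pd i v x)| ≤ LH * |pd i v y - pd i v x| := by
      rw [← Real.norm_eq_abs]
      refine (ContinuousLinearMap.le_opNorm _ _).trans (mul_le_mul (hH1 _ (memH x hx)).2 ?_ (norm_nonneg _) (by positivity))
      simp [Prod.norm_mk]
    have b3 : |pd i v y - pd i v x| ≤ ∑ m, |pd m v y - pd m v x| :=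
      Finset.single_le_sum (f := fun m => |pd m v y - pd m v x|) (fun m _ => abs_nonneg _) (Finset.mem_univ i)
    refine (abs_add_le _ _).trans ((add_le_add b1 b2).trans ?_)
    have b4 : LH * (n*B*‖y-x‖) * B ≤ Λ * ‖y-x‖ := by
      calc LH * (n*B*‖y-x‖) * B = (LH * (n * B) * B) * ‖y-x‖ := by ring
        _ ≤ (LH * (n*B) * (n*B)) * ‖y-x‖ := by gcongr
        _ = (LH * (n*B)^2) * ‖y-x‖ := by ring
        _ ≤ _ := by gcongr
    have b5 : LH * |pd i v y - pd i v x| ≤ Λ * ∑ m, |pd m v y - pd m v x| := by gcongr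
    linarith

end locof
end IHE

end

/-- Interior Hessian estimate for augmented Hessian equations,
convex quadratic case (a priori form of Theorem 1.4, Case 1). -/
theorem interior_hessian_estimate_augmented_case1
    {n : ℕ} (hn : 3 ≤ n) (k : ℕ) (hk2 : 2 ≤ k) (hkn : k ≤ n)
    (Ω : Set (Fin n → ℝ)) (hΩ : IsOpen Ω)
    (p : ℝ) (hp : (k * n : ℝ) / 2 < p)
    (f : ((Fin n → ℝ) × ℝ × (Fin n → ℝ)) → ℝ)
    (hfpos : ∀ y ∈ Ω ×ˢ ((univ : Set ℝ) ×ˢ (univ : Set (Fin n → ℝ))), 0 < f y)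
    (hf : C11On f (Ω ×ˢ ((univ : Set ℝ) ×ˢ (univ : Set (Fin n → ℝ)))))
    (H₁ : ((Fin n → ℝ) × ℝ) → ℝ)
    (hH₁nonneg : ∀ y ∈ Ω ×ˢ (univ : Set ℝ), 0 ≤ H₁ y)
    (hH₁ : C11On H₁ (Ω ×ˢ (univ : Set ℝ)))
    (x₀ : Fin n → ℝ) (R : ℝ) (hR : 0 < R)
    (hball : closure (ball x₀ (2 * R)) ⊆ Ω)
    (M : ℝ) (hM : 0 < M) :
    ∃ C : ℝ, ∀ u : (Fin n → ℝ) → ℝ,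
      ContDiffOn ℝ 2 u Ω →
      (∀ x ∈ Ω,
        esymmMat k (hess u x -
            (H₁ (x, u x) * normSq (grad u x)) • (1 : Matrix (Fin n) (Fin n) ℝ))
          = f (x, u x, grad u x) ^ k ∧
        GammaPlus k (hess u x -
            (H₁ (x, u x) * normSq (grad u x)) • (1 : Matrix (Fin n) (Fin n) ℝ))) →
      W2pNorm p u (ball x₀ (2 * R)) ≤ M →
      ∀ x ∈ ball x₀ R, matNorm (hess u x) ≤ C := by
  obtain ⟨κ, rfl⟩ : ∃ κ, k = κ + 2 := ⟨k - 2, by omega⟩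
  have hpn : (n:ℝ) < p := by
    refine lt_of_le_of_lt ?_ hp
    have h0 : (0:ℝ) ≤ n := Nat.cast_nonneg n
    have h1 : (0:ℝ) ≤ κ := Nat.cast_nonneg κ
    push_cast
    nlinarith [mul_nonneg h1 h0]
  obtain ⟨B, M2, hB, hsup⟩ := IHE.sup_bd hn hpn hΩ hR hball hM
  have hcb : ∀ r, r < 2 → closedBall x₀ (r*R) ⊆ Ω := fun r hr =>
    (closedBall_subset_ball (by nlinarith)).trans (subset_closure.trans hball)
  have hKΩ : closedBall x₀ (3/2*R) ⊆ Ω := hcb _ (by norm_num)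
  have hKc : Convex ℝ (closedBall x₀ (3/2*R)) := convex_closedBall _ _
  have hKk : IsCompact (closedBall x₀ (3/2*R)) := isCompact_closedBall _ _
  have hK2c : Convex ℝ (closedBall x₀ (3/2*R) ×ˢ (Icc (-B) B ×ˢ closedBall (0 : Fin n → ℝ) B)) :=
    hKc.prod ((convex_Icc _ _).prod (convex_closedBall _ _))
  have hK2k : IsCompact (closedBall x₀ (3/2*R) ×ˢ (Icc (-B) B ×ˢ closedBall (0 : Fin n → ℝ) B)) :=
    hKk.prod (isCompact_Icc.prod (isCompact_closedBall _ _))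
  have hK2s : (closedBall x₀ (3/2*R) ×ˢ (Icc (-B) B ×ˢ closedBall (0 : Fin n → ℝ) B)) ⊆
      Ω ×ˢ ((univ : Set ℝ) ×ˢ (univ : Set (Fin n → ℝ))) := fun y hy => ⟨hKΩ hy.1, mem_univ _, mem_univ _⟩
  obtain ⟨Lf, hLf⟩ := IHE.c11_const (hΩ.prod (isOpen_univ.prod isOpen_univ)) hf hK2k hK2c hK2s
  obtain ⟨LH, hLH⟩ := IHE.c11_const (hΩ.prod isOpen_univ) hH₁ (hKk.prod (isCompact_Icc (a := -B) (b := B)))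
    (hKc.prod (convex_Icc _ _)) (fun y hy => ⟨hKΩ hy.1, mem_univ _⟩)
  obtain ⟨c0, hc0, hfc⟩ : ∃ c0 : ℝ, 0 < c0 ∧
      ∀ y ∈ closedBall x₀ (3/2*R) ×ˢ (Icc (-B) B ×ˢ closedBall (0 : Fin n → ℝ) B), c0 ≤ f y := by
    obtain ⟨y, hy, hmin⟩ := hK2k.exists_isMinOn
      ⟨(x₀, 0, 0), mem_closedBall_self (by positivity), ⟨by linarith, by linarith⟩, mem_closedBall_self (by linarith)⟩
      (hf.1.continuousOn.mono hK2s)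
    exact ⟨f y, hfpos y (hK2s hy), fun z hz => hmin hz⟩
  have hΛ : 1 ≤ B + 1/c0 + (Lf + LH)*(n*B)^2 := by
    have h1 : 0 < 1/c0 := by positivity
    have h2 : 0 ≤ (Lf + LH)*((n:ℝ)*B)^2 := mul_nonneg (by linarith [hLf.1, hLH.1]) (sq_nonneg _)
    linarith
  obtain ⟨C, hC⟩ := IHE.main_local hn κ hkn p hp x₀ hR hΛ M2
  refine ⟨∑ _i : Fin n, ∑ _j : Fin n, C, fun u hu heq hW x hx => ?_⟩
  let χ : ContDiffBump x₀ := ⟨7/4*R, 15/8*R, by positivity, by linarith⟩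
  have hts : tsupport χ ⊆ Ω := by
    rw [χ.tsupport_eq]; exact hcb _ (by norm_num)
  obtain ⟨hv, hvc⟩ := IHE.cut hΩ hu (χ.contDiff (n := 2)) χ.hasCompactSupport hts
  have hHu : ContDiffOn ℝ 1 (fun y => H₁ (y, u y)) Ω :=
    hH₁.1.comp (contDiffOn_id.prodMk (hu.of_le (by norm_num))) (fun y hy => ⟨hy, mem_univ _⟩)
  obtain ⟨hG, hGc⟩ := IHE.cut hΩ hHu (χ.contDiff (n := 1)) χ.hasCompactSupport hts
  have hχ1 : ∀ y ∈ ball x₀ (7/4*R), χ y = 1 := fun y hy => χ.one_of_mem_closedBall (ball_subset_closedBall hy)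
  have hvu : ∀ y ∈ ball x₀ (7/4*R), χ y * u y = u y := fun y hy => by rw [hχ1 y hy, one_mul]
  generalize hvdef : (fun x => χ x * u x) = v at hv hvc
  generalize hGdef : (fun x => χ x * H₁ (x, u x)) = G at hG hGc
  have hvu' : ∀ y ∈ ball x₀ (7/4*R), v y = u y := fun y hy => by rw [← hvdef]; exact hvu y hy
  have hGU : ∀ y ∈ ball x₀ (7/4*R), G y = H₁ (y, v y) := fun y hy => by
    rw [← hGdef, hvu' y hy]; simp only [hχ1 y hy, one_mul]
  have hp1 : ∀ i, ∀ y ∈ ball x₀ (7/4*R), pd i v y = pd i u y := fun i y hy =>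
    IHE.pd_congr (Filter.eventuallyEq_of_mem (isOpen_ball.mem_nhds hy) hvu')
  have hp2 : ∀ i j, ∀ y ∈ ball x₀ (7/4*R), pd i (pd j v) y = pd i (pd j u) y := fun i j y hy =>
    IHE.pd_congr (Filter.eventuallyEq_of_mem (isOpen_ball.mem_nhds hy) (hp1 j))
  have hgr : ∀ y ∈ ball x₀ (7/4*R), grad v y = grad u y := fun y hy => funext fun i => hp1 i y hy
  have hhe : ∀ y ∈ ball x₀ (7/4*R), hess v y = hess u y := fun y hy => by
    ext i j; exact hp2 i j y hy
  have hKU : closedBall x₀ (3/2*R) ⊆ ball x₀ (7/4*R) := closedBall_subset_ball (by linarith)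
  have hAA : ∀ y ∈ ball x₀ (7/4*R), IHE.AA v (IHE.gg G v) y = hess u y -
      (H₁ (y, u y) * normSq (grad u y)) • (1 : Matrix (Fin n) (Fin n) ℝ) := fun y hy => by
    simp only [IHE.AA, IHE.gg]
    rw [hGU y hy, hvu' y hy, hgr y hy, hhe y hy]
  have hsym : ∀ y, (IHE.AA v (IHE.gg G v) y)ᵀ = IHE.AA v (IHE.gg G v) y := fun y => IHE.AA_symm _ hv.contDiffAt
  obtain ⟨hvB, hvM⟩ := hsup u v hu hW hv hvu'
  have hloc := IHE.loc_of (κ := κ) hn hΩ hKΩ isOpen_ball hKU hKc hH₁.1 hH₁nonneg hB hc0 hLf hfc hLH hv hvc hG hGc hGU hvB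
    (fun y hy => IHE.GS_of (hsym y) hkn (by rw [hAA y (hKU hy)]; exact (heq y (hKΩ hy)).2))
    (fun y hy => by
      rw [← IHE.esymmMat_eq (hsym y) _ hkn, hAA y (hKU hy), hvu' y (hKU hy), hgr y (hKU hy)]
      exact (heq y (hKΩ hy)).1)
  have hfin := hC v G _ hloc hvM x hx
  have hxU : x ∈ ball x₀ (7/4*R) := ball_subset_ball (by linarith) hx
  refine (IHE.matNorm_le_sum _).trans (Finset.sum_le_sum fun i _ => Finset.sum_le_sum fun j _ => ?_)
  have := hfin i j
  rw [hp2 i j x hxU] at this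
  exact this
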